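/- Fix an integer k ≥ 2. There exist constants C > 0, c > 0 and c′ > 0 depending only on k with the following property. For every finite field F_q (of sufficiently large characteristic in terms of k), every non-degenerate polynomial P ∈ F_q[x_1,x_2] of degree k, and all sets E, F ⊆ F_q^2 with |E|·|F| ≥ C q^3, there exists a subset F_0 ⊆ F with |F_0| ≥ c′·|F| such that |Δ_P(E,y)| ≥ c q for every y ∈ F_0. -/

import Mathlib

open Polynomial

namespace WS

structure Filt (K A : Type) [Field K] [CommRing A] [Algebra K A] where
  W : ℕ → Submodule K A
  mono : ∀ {a b : ℕ}, a ≤ b → W a ≤ W b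
  one : (1 : A) ∈ W 0
  mul : ∀ {a b : ℕ} {x y : A}, x ∈ W a → y ∈ W b → x * y ∈ W (a + b)

section
variable {K A : Type} [Field K] [CommRing A] [Algebra K A]

lemma Filt.pow (f : Filt K A) {a : ℕ} {x : A} (hx : x ∈ f.W a) (n : ℕ) : x ^ n ∈ f.W (n * a) := by
  induction n with
  | zero => simpa using f.one
  | succ n ih =>
    rw [pow_succ, Nat.succ_mul]
    exact f.mul ih hx

lemma Filt.one' (f : Filt K A) (a : ℕ) : (1 : A) ∈ f.W a := f.mono (Nat.zero_le a) f.one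

lemma Filt.mul' (f : Filt K A) {a b c : ℕ} {x y : A} (hx : x ∈ f.W a) (hy : y ∈ f.W b)
    (h : a + b ≤ c) : x * y ∈ f.W c := f.mono h (f.mul hx hy)

lemma Filt.alg (f : Filt K A) (c : K) (a : ℕ) : algebraMap K A c ∈ f.W a := by
  rw [Algebra.algebraMap_eq_smul_one]
  exact Submodule.smul_mem _ _ (f.one' a)

/-- rescaled filtration -/
def Filt.scale (f : Filt K A) (q : ℕ) : Filt K A where
  W w := f.W (q * w)
  mono h := f.mono (Nat.mul_le_mul_left q h)
  one := f.one' _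
  mul hx hy := by rw [mul_add]; exact f.mul hx hy

/-- filtration on polynomials -/
def Filt.poly (f : Filt K A) (κ : ℕ) : Filt K A[X] where
  W a := { carrier := {g | ∀ n, g.coeff n ∈ f.W (a + κ * n)}
           add_mem' := fun ha hb n => by
             rw [coeff_add]; exact Submodule.add_mem _ (ha n) (hb n)
           zero_mem' := fun n => by simp
           smul_mem' := fun c g hg n => by
             rw [coeff_smul]; exact Submodule.smul_mem _ _ (hg n) }
  mono h := fun g hg n => f.mono (by omega) (hg n)
  one := fun n => by
    rw [coeff_one]
    split_ifs
    · exact f.one' _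
    · exact Submodule.zero_mem _
  mul := fun {a b x y} hx hy n => by
    rw [coeff_mul]
    refine Submodule.sum_mem _ fun ij hij => ?_
    have hij := Finset.HasAntidiagonal.mem_antidiagonal.1 hij
    refine f.mul' (hx _) (hy _) ?_
    rw [← hij]; ring_nf; rfl

lemma Filt.mem_poly (f : Filt K A) (κ a : ℕ) (g : A[X]) :
    g ∈ (f.poly κ).W a ↔ ∀ n, g.coeff n ∈ f.W (a + κ * n) := Iff.rfl

lemma Filt.C_mem (f : Filt K A) (κ : ℕ) {a : ℕ} {x : A} (hx : x ∈ f.W a) :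
    (C x : A[X]) ∈ (f.poly κ).W a := by
  intro n
  rw [coeff_C]
  split_ifs with h
  · exact f.mono (by omega) hx
  · exact Submodule.zero_mem _

lemma Filt.X_mul_mem (f : Filt K A) (κ : ℕ) {a : ℕ} {g : A[X]} (hx : g ∈ (f.poly κ).W (a + κ)) :
    X * g ∈ (f.poly κ).W a := by
  intro n
  cases n with
  | zero => simp
  | succ n =>
    rw [coeff_X_mul]
    exact f.mono (by rw [mul_add]; omega) (hx n)

lemma aeval_supp (x : A) (p : K[X]) : aeval x p = ∑ j ∈ p.support, p.coeff j • x ^ j := by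
  rw [aeval_def, eval₂_eq_sum, Polynomial.sum]
  simp only [Algebra.smul_def]

/-- evaluation of a bivariate polynomial in an algebra -/
noncomputable def ev (Q : K[X][X]) (x y : A) : A := Q.eval₂ (aeval x : K[X] →ₐ[K] A).toRingHom y

def Wt (h w : ℕ) (Q : K[X][X]) : Prop := ∀ i j, (Q.coeff i).coeff j ≠ 0 → j + h * i ≤ w

lemma ev_eq_sum (Q : K[X][X]) (x y : A) : ev Q x y =
    ∑ i ∈ Q.support, ∑ j ∈ (Q.coeff i).support, (Q.coeff i).coeff j • (x ^ j * y ^ i) := by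
  rw [ev, eval₂_eq_sum, Polynomial.sum]
  refine Finset.sum_congr rfl fun i _ => ?_
  have : (aeval x : K[X] →ₐ[K] A).toRingHom (Q.coeff i) = aeval x (Q.coeff i) := rfl
  rw [this, aeval_supp, Finset.sum_mul]
  simp only [smul_mul_assoc]

lemma ev_map {B : Type} [CommRing B] [Algebra K B] (φ : A →ₐ[K] B) (Q : K[X][X]) (x y : A) :
    φ (ev Q x y) = ev Q (φ x) (φ y) := by
  simp [ev_eq_sum, map_sum]

lemma ev_mem (f : Filt K A) {h w : ℕ} {Q : K[X][X]} (hQ : Wt h w Q) {x y : A}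
    (hx : x ∈ f.W 1) (hy : y ∈ f.W h) : ev Q x y ∈ f.W w := by
  rw [ev_eq_sum]
  refine Submodule.sum_mem _ fun i _ => Submodule.sum_mem _ fun j hj => Submodule.smul_mem _ _ ?_
  rw [mem_support_iff] at hj
  have := hQ i j hj
  refine f.mul' (f.pow hx j) (f.pow hy i) ?_
  nlinarith

lemma Wt.derivative {h w : ℕ} {Q : K[X][X]} (hQ : Wt h w Q) : Wt h (w - h) (derivative Q) := by
  intro i j hij
  rw [coeff_derivative] at hij
  have h1 : (Q.coeff (i+1)).coeff j ≠ 0 := by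
    intro h0
    apply hij
    have : (((i : K[X]) + 1)) = C ((i : K) + 1) := by simp
    rw [this, coeff_mul_C, h0, zero_mul]
  have := hQ _ _ h1
  rw [mul_add] at this
  omega

lemma pow_sub_pow_mem (f : Filt K A) {a : ℕ} {x x' : A} (hx : x ∈ f.W a) (hx' : x' ∈ f.W a)
    (n : ℕ) : ∃ k ∈ f.W (n * a), x' ^ n - x ^ n = (x' - x) * k := by
  induction n with
  | zero => exact ⟨0, Submodule.zero_mem _, by simp⟩
  | succ n ih =>
    obtain ⟨k, hk, e⟩ := ih
    refine ⟨x' * k + x ^ n, Submodule.add_mem _ (f.mul' hx' hk (by rw [Nat.succ_mul]; omega))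
      (f.mono (by rw [Nat.succ_mul]; omega) (f.pow hx n)), ?_⟩
    linear_combination x' * e

lemma taylor_diff (f : Filt K A) {h w : ℕ} {Q : K[X][X]} (hQ : Wt h w Q) {x x' y y' : A}
    (hx : x ∈ f.W 1) (hx' : x' ∈ f.W 1) (hy : y ∈ f.W h) (hy' : y' ∈ f.W h) :
    ∃ k1 ∈ f.W w, ∃ k2 ∈ f.W w,
      ev Q x' y' - ev Q x y = (x' - x) * k1 + (y' - y) * k2 := by
  choose a ha ha' using pow_sub_pow_mem f hx hx'
  choose b hb hb' using pow_sub_pow_mem f hy hy'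
  refine ⟨∑ i ∈ Q.support, ∑ j ∈ (Q.coeff i).support, (Q.coeff i).coeff j • (a j * y' ^ i), ?_,
    ∑ i ∈ Q.support, ∑ j ∈ (Q.coeff i).support, (Q.coeff i).coeff j • (x ^ j * b i), ?_, ?_⟩
  · refine Submodule.sum_mem _ fun i _ => Submodule.sum_mem _ fun j hj =>
      Submodule.smul_mem _ _ ?_
    rw [mem_support_iff] at hj
    have := hQ i j hj
    exact f.mul' (ha j) (f.pow hy' i) (by nlinarith)
  · refine Submodule.sum_mem _ fun i _ => Submodule.sum_mem _ fun j hj =>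
      Submodule.smul_mem _ _ ?_
    rw [mem_support_iff] at hj
    have := hQ i j hj
    exact f.mul' (f.pow hx j) (hb i) (by nlinarith)
  · simp only [ev_eq_sum, Finset.mul_sum, ← Finset.sum_sub_distrib, ← Finset.sum_add_distrib]
    refine Finset.sum_congr rfl fun i _ => Finset.sum_congr rfl fun j _ => ?_
    rw [← smul_sub, mul_smul_comm, mul_smul_comm, ← smul_add]
    congr 1
    linear_combination y' ^ i * ha' j + x ^ j * hb' i

lemma pow_taylor_mem (f : Filt K A) {a : ℕ} {y z : A} (hy : y ∈ f.W a) (hz : y + z ∈ f.W a)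
    (n : ℕ) : ∃ k ∈ f.W (n * a), (y + z) ^ n = y ^ n + z * (n * y ^ (n - 1)) + z ^ 2 * k := by
  induction n with
  | zero => exact ⟨0, Submodule.zero_mem _, by simp⟩
  | succ n ih =>
    obtain ⟨k, hk, e⟩ := ih
    refine ⟨(y + z) * k + n * y ^ (n - 1), Submodule.add_mem _
      (f.mul' hz hk (by rw [Nat.succ_mul]; omega)) ?_, ?_⟩
    · have : (n : A) = algebraMap K A n := by simp
      rw [this]
      exact f.mul' (f.alg _ 0) (f.pow hy _) (by
        rw [zero_add]; exact Nat.mul_le_mul_right _ (by omega))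
    · rw [pow_succ, e]
      cases n with
      | zero => simp; ring
      | succ n =>
        have : n + 1 - 1 = n := by omega
        have h2 : n + 1 + 1 - 1 = n + 1 := by omega
        rw [this, h2]; push_cast; ring

lemma taylor_snd (f : Filt K A) {h w : ℕ} {Q : K[X][X]} (hQ : Wt h w Q) {x y z : A}
    (hx : x ∈ f.W 1) (hy : y ∈ f.W h) (hz : y + z ∈ f.W h) :
    ∃ k ∈ f.W w, ev Q x (y + z) = ev Q x y + z * ev (derivative Q) x y + z ^ 2 * k := by
  choose b hb hb' using pow_taylor_mem f hy hz
  refine ⟨∑ i ∈ Q.support, ∑ j ∈ (Q.coeff i).support, (Q.coeff i).coeff j • (x ^ j * b i), ?_, ?_⟩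
  · refine Submodule.sum_mem _ fun i _ => Submodule.sum_mem _ fun j hj =>
      Submodule.smul_mem _ _ ?_
    rw [mem_support_iff] at hj
    have := hQ i j hj
    exact f.mul' (f.pow hx j) (hb i) (by nlinarith)
  · have hd : ev (derivative Q) x y = ∑ i ∈ Q.support, ∑ j ∈ (Q.coeff i).support,
        (Q.coeff i).coeff j • (x ^ j * (i * y ^ (i-1))) := by
      rw [ev, derivative_apply, Polynomial.sum, eval₂_finsetSum]
      refine Finset.sum_congr rfl fun i _ => ?_
      rw [eval₂_mul, eval₂_C, eval₂_X_pow, map_mul]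
      have h1 : (aeval x : K[X] →ₐ[K] A).toRingHom (Q.coeff i) = aeval x (Q.coeff i) := rfl
      have h2 : (aeval x : K[X] →ₐ[K] A).toRingHom (i : K[X]) = i := by simp
      rw [h1, h2, aeval_supp, Finset.sum_mul, Finset.sum_mul]
      refine Finset.sum_congr rfl fun j _ => ?_
      simp only [smul_mul_assoc, mul_assoc]
    rw [hd]
    simp only [ev_eq_sum, Finset.mul_sum, ← Finset.sum_add_distrib]
    refine Finset.sum_congr rfl fun i _ => Finset.sum_congr rfl fun j _ => ?_
    rw [mul_smul_comm, mul_smul_comm, ← smul_add, ← smul_add]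
    congr 1
    linear_combination x ^ j * hb' i

end
end WS

namespace WS
section
variable {K A : Type} [Field K] [CommRing A] [Algebra K A]

lemma ev_C (Q : K[X][X]) (u v : A) : ev Q (C u) (C v) = C (ev Q u v) := by
  have := ev_map ((CAlgHom (R := A) (A := A)).restrictScalars K) Q u v
  exact this.symm

theorem hensel_aux (f : Filt K A) {h d p : ℕ} (hh : 1 ≤ h) (hd : 1 ≤ d) (hp : 2 ≤ p) {Q : K[X][X]}
    (hQ : Wt h (h * d) Q) {u v : A} (hu : u ∈ f.W 1) (hv : v ∈ f.W h) (h0 : ev Q u v = 0)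
    (D ρ u' : A[X]) (hD : D = C (ev (derivative Q) u v)) (hρ : ρ = D ^ 2 * X)
    (hu' : u' = C u + ρ ^ p - ρ) :
    u' ∈ (f.poly (2 * (h * d))).W 1 ∧ ρ ∈ (f.poly (2 * (h * d))).W 0 ∧ ∀ N : ℕ,
    ∃ s ∈ (f.poly (2 * (h * d))).W (h * d), C v + D * X * s ∈ (f.poly (2 * (h * d))).W h ∧
      ∃ E ∈ (f.poly (2 * (h * d))).W (h * d), X ^ N ∣ E ∧
       ev Q u' (C v + D * X * s) = D ^ 2 * X * E := by
  set P := f.poly (2 * (h * d)) with hP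
  set g := h * d with hg
  have hhg : h ≤ g := Nat.le_mul_of_pos_right _ hd
  have hDm : D ∈ P.W (g - h) := by
    rw [hD]; exact f.C_mem _ (ev_mem f hQ.derivative hu hv)
  have hρm : ρ ∈ P.W 0 := by
    rw [hρ, mul_comm]
    apply f.X_mul_mem
    exact P.mono (by omega) (P.pow hDm 2)
  have hum : u' ∈ P.W 1 := by
    rw [hu']
    refine Submodule.sub_mem _ (Submodule.add_mem _ (f.C_mem _ hu) ?_) (P.mono (by omega) hρm)
    exact P.mono (by omega) (P.pow hρm p)
  have hvm : C v ∈ P.W h := f.C_mem _ hv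
  have hum0 : C u ∈ P.W 1 := f.C_mem _ hu
  have hym : ∀ s ∈ P.W g, C v + D * X * s ∈ P.W h := by
    intro s hs
    refine Submodule.add_mem _ hvm ?_
    have : D * X * s = X * (D * s) := by ring
    rw [this]
    apply f.X_mul_mem
    exact P.mul' hDm hs (by omega)
  have hQ0 : ev Q (C u) (C v) = 0 := by rw [ev_C, h0, C_0]
  have hQ1 : ev (derivative Q) (C u) (C v) = D := by rw [ev_C, hD]
  obtain ⟨p', rfl⟩ : ∃ p', p = p' + 1 := ⟨p - 1, by omega⟩
  have hux : u' - C u = D ^ 2 * X * (ρ ^ p' - 1) := by rw [hu', pow_succ, ← hρ]; ring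
  have hρp : ρ ^ p' - 1 ∈ P.W 0 := Submodule.sub_mem _ (P.mono (by omega) (P.pow hρm p')) P.one
  refine ⟨hum, hρm, fun N => ?_⟩
  induction N with
  | zero =>
    refine ⟨0, Submodule.zero_mem _, hym 0 (Submodule.zero_mem _), ?_⟩
    obtain ⟨k1, hk1, k2, hk2, e⟩ := taylor_diff P hQ hum0 hum hvm hvm
    refine ⟨(ρ ^ p' - 1) * k1, P.mul' hρp hk1 (by omega), by simp, ?_⟩
    rw [hQ0, hux] at e
    rw [mul_zero, add_zero]
    linear_combination e
  | succ N ih =>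
    obtain ⟨s, hs, hy, E, hE, ⟨e, he⟩, hev⟩ := ih
    have hs' : s - E ∈ P.W g := Submodule.sub_mem _ hs hE
    refine ⟨s - E, hs', hym _ hs', ?_⟩
    have hy2 : (C v + D * X * s) + (- (D * X * E)) ∈ P.W h := by
      have := hym _ hs'
      convert this using 1; ring
    obtain ⟨k, hk, e1⟩ := taylor_snd P hQ hum hy hy2
    obtain ⟨k1, hk1, k2, hk2, e2⟩ := taylor_diff P hQ.derivative hum0 hum hvm hy
    rw [hQ1, hux] at e2
    refine ⟨X * (E * (-(D * (ρ ^ p' - 1) * k1) - s * k2 + E * k)), ?_, ?_, ?_⟩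
    · apply f.X_mul_mem
      refine P.mul' (b := 2 * g) hE ?_ (by omega)
      refine Submodule.add_mem _ (Submodule.sub_mem _ (Submodule.neg_mem _ ?_) ?_) ?_
      · exact P.mul' (P.mul hDm hρp) hk1 (by omega)
      · exact P.mul' hs hk2 (by omega)
      · exact P.mul' hE hk (by omega)
    · rw [he]
      exact ⟨e * (-(D * (ρ ^ p' - 1) * k1) - s * k2 + X ^ N * e * k), by ring⟩
    · have : C v + D * X * (s - E) = (C v + D * X * s) + (- (D * X * E)) := by ring
      rw [this, e1, hev]
      linear_combination (-(D * X * E)) * e2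

end
end WS

namespace WS
section
variable {K A : Type} [Field K] [CommRing A] [Algebra K A]

abbrev Idx (n1 n2 d p : ℕ) : Type := Fin n1 × Fin d × Fin n2 × Fin d × Fin p

noncomputable def evF {n1 n2 d p : ℕ} (F : Idx n1 n2 d p → K) (u v u' v' r : A) : A :=
  ∑ x : Idx n1 n2 d p, F x • (u ^ (x.1 : ℕ) * v ^ (x.2.1 : ℕ) * u' ^ (x.2.2.1 : ℕ) *
    v' ^ (x.2.2.2.1 : ℕ) * r ^ (x.2.2.2.2 : ℕ))

lemma evF_map {B : Type} [CommRing B] [Algebra K B] (φ : A →ₐ[K] B) {n1 n2 d p : ℕ}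
    (F : Idx n1 n2 d p → K) (u v u' v' r : A) :
    φ (evF F u v u' v' r) = evF F (φ u) (φ v) (φ u') (φ v') (φ r) := by
  simp [evF, map_sum]

lemma evF_add {n1 n2 d p : ℕ} (F G : Idx n1 n2 d p → K) (u v u' v' r : A) :
    evF (F + G) u v u' v' r = evF F u v u' v' r + evF G u v u' v' r := by
  simp [evF, add_smul, Finset.sum_add_distrib]

lemma evF_smul {n1 n2 d p : ℕ} (c : K) (F : Idx n1 n2 d p → K) (u v u' v' r : A) :
    evF (c • F) u v u' v' r = c • evF F u v u' v' r := by
  simp [evF, mul_smul, Finset.smul_sum]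

lemma evF_mem (f : Filt K A) {n1 n2 d p h a e : ℕ} (F : Idx n1 n2 d p → K) {u v u' v' r : A}
    (hu : u ∈ f.W 1) (hv : v ∈ f.W h) (hu' : u' ∈ f.W a) (hv' : v' ∈ f.W (a * h))
    (hr : ∀ l < p, r ^ l ∈ f.W e) :
    evF F u v u' v' r ∈ f.W (n1 + h * d + a * (n2 + h * d) + e) := by
  refine Submodule.sum_mem _ fun x _ => Submodule.smul_mem _ _ ?_
  obtain ⟨α, i, α', j, l⟩ := x
  refine f.mul' (f.mul (f.mul (f.mul (f.pow hu α) (f.pow hv i)) (f.pow hu' α')) (f.pow hv' j))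
    (hr l l.2) ?_
  have h1 := α.2.le
  have h2 : (i : ℕ) * h ≤ h * d := by rw [mul_comm]; exact Nat.mul_le_mul_left _ i.2.le
  have h3 : (α' : ℕ) * a ≤ a * n2 := by rw [mul_comm]; exact Nat.mul_le_mul_left _ α'.2.le
  have h4 : (j : ℕ) * (a * h) ≤ a * (h * d) := by
    rw [mul_comm, mul_assoc]; exact Nat.mul_le_mul_left _ (Nat.mul_le_mul_left _ j.2.le)
  rw [mul_add]
  omega

/-- congruence modulo an ideal in the variable v' -/
lemma evF_congr (I : Ideal A) {n1 n2 d p : ℕ} (F : Idx n1 n2 d p → K) {u v u' y y' r : A}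
    (hy : y - y' ∈ I) : evF F u v u' y r - evF F u v u' y' r ∈ I := by
  rw [evF, evF, ← Finset.sum_sub_distrib]
  refine Ideal.sum_mem _ fun x _ => ?_
  rw [← smul_sub, ← mul_sub_right_distrib, ← mul_sub_left_distrib, Algebra.smul_def]
  refine Ideal.mul_mem_left _ _ (Ideal.mul_mem_right _ _ (Ideal.mul_mem_left _ _ ?_))
  exact Ideal.mem_of_dvd _ (sub_dvd_pow_sub_pow y y' _) hy

end

section codim
variable {K V : Type} [Field K] [AddCommGroup V] [Module K V] [FiniteDimensional K V]

lemma codim_inf {ι : Type} (s : Finset ι) (U : ι → Submodule K V) (m : ι → ℕ)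
    (hU : ∀ i ∈ s, Module.finrank K V ≤ Module.finrank K (U i) + m i) :
    ∃ S : Submodule K V, (∀ i ∈ s, S ≤ U i) ∧
      Module.finrank K V ≤ Module.finrank K S + ∑ i ∈ s, m i := by
  classical
  induction s using Finset.induction_on with
  | empty => exact ⟨⊤, by simp, by simp⟩
  | insert a s ha ih =>
    obtain ⟨S, hS, hd⟩ := ih fun i hi => hU i (Finset.mem_insert_of_mem hi)
    refine ⟨S ⊓ U a, ?_, ?_⟩
    · intro i hi
      rcases Finset.mem_insert.1 hi with rfl | hi
      · exact inf_le_right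
      · exact inf_le_left.trans (hS i hi)
    · rw [Finset.sum_insert ha]
      have h1 := Submodule.finrank_sup_add_finrank_inf_eq S (U a)
      have h2 := hU a (Finset.mem_insert_self _ _)
      have h3 := Submodule.finrank_le (S ⊔ U a)
      omega

lemma codim_ker {B : Type} [AddCommGroup B] [Module K B] (L : V →ₗ[K] B) (S : Submodule K B)
    [FiniteDimensional K S] (hL : ∀ x, L x ∈ S) :
    Module.finrank K V ≤ Module.finrank K (LinearMap.ker L) + Module.finrank K S := by
  have h1 := LinearMap.finrank_range_add_finrank_ker L
  have h2 : LinearMap.range L ≤ S := by rintro _ ⟨x, rfl⟩; exact hL x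
  have h3 := Submodule.finrank_mono h2
  omega

end codim
end WS

namespace WS
section
variable {K A : Type} [Field K] [CommRing A] [Algebra K A]

def monoSet (u v v1 : A) (h w : ℕ) : Set A :=
  {x | ∃ i j l : ℕ, i + h * (j + l) ≤ w ∧ x = u ^ i * v ^ j * v1 ^ l}

def stdFilt (u v v1 : A) (h : ℕ) : Filt K A where
  W w := Submodule.span K (monoSet u v v1 h w)
  mono hab := Submodule.span_mono (by
    rintro x ⟨i, j, l, hw, rfl⟩; exact ⟨i, j, l, hw.trans hab, rfl⟩)
  one := Submodule.subset_span ⟨0, 0, 0, by simp, by simp⟩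
  mul := fun {a b x y} hx hy => by
    have := Submodule.mul_mem_mul hx hy
    rw [Submodule.span_mul_span] at this
    refine Submodule.span_mono ?_ this
    rintro _ ⟨_, ⟨i, j, l, hw, rfl⟩, _, ⟨i', j', l', hw', rfl⟩, rfl⟩
    refine ⟨i + i', j + j', l + l', ?_, by simp only; ring⟩
    have : h * (j + j' + (l + l')) = h * (j + l) + h * (j' + l') := by ring
    omega

lemma stdFilt_u (u v v1 : A) (h : ℕ) : u ∈ (stdFilt (K := K) u v v1 h).W 1 :=
  Submodule.subset_span ⟨1, 0, 0, by simp, by simp⟩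
lemma stdFilt_v (u v v1 : A) (h : ℕ) : v ∈ (stdFilt (K := K) u v v1 h).W h :=
  Submodule.subset_span ⟨0, 1, 0, by simp, by simp⟩
lemma stdFilt_v1 (u v v1 : A) (h : ℕ) : v1 ∈ (stdFilt (K := K) u v v1 h).W h :=
  Submodule.subset_span ⟨0, 0, 1, by simp, by simp⟩

def redSet (u v v1 : A) (h d d1 w : ℕ) : Set A :=
  {x | ∃ i j l : ℕ, j < d ∧ l < d1 ∧ i + h * (j + l) ≤ w ∧ x = u ^ i * v ^ j * v1 ^ l}

def redSet1 (u v v1 : A) (h d1 w : ℕ) : Set A :=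
  {x | ∃ i j l : ℕ, l < d1 ∧ i + h * (j + l) ≤ w ∧ x = u ^ i * v ^ j * v1 ^ l}

def redSet0 (u v : A) (h d w : ℕ) : Set A :=
  {x | ∃ i j : ℕ, j < d ∧ i + h * j ≤ w ∧ x = u ^ i * v ^ j}

lemma mono_red1 {u v v1 : A} {h d1 : ℕ}
    (hR : v1 ^ d1 ∈ Submodule.span K (redSet1 u v v1 h d1 (h * d1))) (l : ℕ) :
    ∀ i j w : ℕ, i + h * (j + l) ≤ w →
      u ^ i * v ^ j * v1 ^ l ∈ Submodule.span K (redSet1 u v v1 h d1 w) := by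
  induction l using Nat.strong_induction_on with
  | _ l ih =>
    intro i j w hw
    by_cases hl : l < d1
    · exact Submodule.subset_span ⟨i, j, l, hl, hw, rfl⟩
    · push Not at hl
      have e : u ^ i * v ^ j * v1 ^ l = (u ^ i * v ^ j * v1 ^ (l - d1)) * v1 ^ d1 := by
        rw [mul_assoc (u ^ i * v ^ j), ← pow_add, Nat.sub_add_cancel hl]
      rw [e]
      have hm := Submodule.mem_map_of_mem (f := LinearMap.mulLeft K (u ^ i * v ^ j * v1 ^ (l - d1))) hR
      rw [Submodule.map_span, LinearMap.mulLeft_apply] at hm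
      refine (Submodule.span_le.2 ?_) hm
      rintro _ ⟨_, ⟨i', j', l', hl', hw', rfl⟩, rfl⟩
      have := ih (l - d1 + l') (by omega) (i + i') (j + j') w (by
        obtain ⟨t, rfl⟩ := Nat.exists_eq_add_of_le hl
        have : d1 + t - d1 = t := by omega
        rw [this]
        nlinarith)
      rw [LinearMap.mulLeft_apply, SetLike.mem_coe]
      convert this using 1
      ring

lemma mono_red0 {u v v1 : A} {h d d1 : ℕ}
    (hR : v ^ d ∈ Submodule.span K (redSet0 u v h d (h * d))) (j : ℕ) :
    ∀ i l w : ℕ, l < d1 → i + h * (j + l) ≤ w →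
      u ^ i * v ^ j * v1 ^ l ∈ Submodule.span K (redSet u v v1 h d d1 w) := by
  induction j using Nat.strong_induction_on with
  | _ j ih =>
    intro i l w hl1 hw
    by_cases hl : j < d
    · exact Submodule.subset_span ⟨i, j, l, hl, hl1, hw, rfl⟩
    · push Not at hl
      have e : u ^ i * v ^ j * v1 ^ l = (u ^ i * v ^ (j - d) * v1 ^ l) * v ^ d := by
        conv_lhs => rw [← Nat.sub_add_cancel hl, pow_add]
        ring
      rw [e]
      have hm := Submodule.mem_map_of_mem (f := LinearMap.mulLeft K (u ^ i * v ^ (j - d) * v1 ^ l)) hR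
      rw [Submodule.map_span, LinearMap.mulLeft_apply] at hm
      refine (Submodule.span_le.2 ?_) hm
      rintro _ ⟨_, ⟨i', j', hl', hw', rfl⟩, rfl⟩
      have := ih (j - d + j') (by omega) (i + i') l w hl1 (by
        obtain ⟨t, rfl⟩ := Nat.exists_eq_add_of_le hl
        have : d + t - d = t := by omega
        rw [this]
        nlinarith)
      rw [LinearMap.mulLeft_apply, SetLike.mem_coe]
      convert this using 1
      ring

lemma stdFilt_le {u v v1 : A} {h d d1 : ℕ}
    (hR0 : v ^ d ∈ Submodule.span K (redSet0 u v h d (h * d)))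
    (hR1 : v1 ^ d1 ∈ Submodule.span K (redSet1 u v v1 h d1 (h * d1))) (w : ℕ) :
    (stdFilt (K := K) u v v1 h).W w ≤ Submodule.span K (redSet u v v1 h d d1 w) := by
  refine Submodule.span_le.2 ?_
  rintro _ ⟨i, j, l, hw, rfl⟩
  refine (Submodule.span_le.2 ?_) (mono_red1 hR1 l i j w hw)
  rintro _ ⟨i, j, l, hl, hw, rfl⟩
  exact mono_red0 hR0 j i l w hl hw

lemma redSet_finrank (u v v1 : A) {h d d1 : ℕ} (w : ℕ) :
    FiniteDimensional K (Submodule.span K (redSet u v v1 h d d1 w)) ∧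
    Module.finrank K (Submodule.span K (redSet u v v1 h d d1 w)) ≤ d * d1 * (w + 1) := by
  classical
  let g : Fin d × Fin d1 × Fin (w + 1) → A := fun x =>
    u ^ (x.2.2 : ℕ) * v ^ (x.1 : ℕ) * v1 ^ (x.2.1 : ℕ)
  have hsub : redSet u v v1 h d d1 w ⊆ Set.range g := by
    rintro _ ⟨i, j, l, hj, hl, hw, rfl⟩
    exact ⟨(⟨j, hj⟩, ⟨l, hl⟩, ⟨i, by omega⟩), rfl⟩
  have h1 := Submodule.span_mono (R := K) hsub
  haveI : FiniteDimensional K (Submodule.span K (Set.range g)) :=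
    FiniteDimensional.span_of_finite K (Set.finite_range g)
  refine ⟨Submodule.finiteDimensional_of_le h1, (Submodule.finrank_mono h1).trans ?_⟩
  refine (finrank_range_le_card g).trans ?_
  simp [Fintype.card_prod, mul_assoc]

lemma stdFilt_finrank {u v v1 : A} {h d d1 : ℕ}
    (hR0 : v ^ d ∈ Submodule.span K (redSet0 u v h d (h * d)))
    (hR1 : v1 ^ d1 ∈ Submodule.span K (redSet1 u v v1 h d1 (h * d1))) (w : ℕ) :
    FiniteDimensional K ((stdFilt (K := K) u v v1 h).W w) ∧
    Module.finrank K ((stdFilt (K := K) u v v1 h).W w) ≤ d * d1 * (w + 1) := by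
  obtain ⟨h1, h2⟩ := redSet_finrank (K := K) u v v1 (h := h) (d := d) (d1 := d1) w
  have := stdFilt_le hR0 hR1 w
  exact ⟨Submodule.finiteDimensional_of_le this, (Submodule.finrank_mono this).trans h2⟩

/-- explicit representatives -/
lemma stdFilt_rep {u v : A} {h d : ℕ} 
    (hR0 : v ^ d ∈ Submodule.span K (redSet0 u v h d (h * d))) {w : ℕ} {x : A}
    (hx : x ∈ (stdFilt (K := K) u v v h).W w) :
    ∃ G : K[X][X], G.degree < d ∧ (∀ i, (G.coeff i).natDegree ≤ w) ∧ ev G u v = x := by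
  have hR1 : v ^ 1 ∈ Submodule.span K (redSet1 u v v h 1 (h * 1)) :=
    Submodule.subset_span ⟨0, 1, 0, by simp, by simp, by simp⟩
  have := stdFilt_le hR0 hR1 w hx
  refine Submodule.span_induction (p := fun x _ => ∃ G : K[X][X], G.degree < d ∧
    (∀ i, (G.coeff i).natDegree ≤ w) ∧ ev G u v = x) ?_ ?_ ?_ ?_ this
  · rintro _ ⟨i, j, l, hj, hl, hw, rfl⟩
    obtain rfl : l = 0 := by omega
    refine ⟨C (X ^ i) * X ^ j, ?_, ?_, ?_⟩
    · refine (degree_C_mul_X_pow_le _ _).trans_lt (by exact_mod_cast hj)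
    · intro k
      rw [coeff_C_mul_X_pow]
      split_ifs
      · rw [natDegree_X_pow]; omega
      · simp
    · rw [ev, eval₂_mul, eval₂_C, eval₂_X_pow]; simp
  · exact ⟨0, by simp [WithBot.bot_lt_coe], by simp, by simp [ev]⟩
  · rintro x y _ _ ⟨G, hG, hG1, rfl⟩ ⟨G', hG', hG1', rfl⟩
    refine ⟨G + G', ?_, ?_, by simp [ev, eval₂_add]⟩
    · exact (degree_add_le _ _).trans_lt (max_lt hG hG')
    · intro i; rw [coeff_add]
      exact (natDegree_add_le _ _).trans (max_le (hG1 i) (hG1' i))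
  · rintro a x _ ⟨G, hG, hG1, rfl⟩
    refine ⟨C (C a) * G, ?_, ?_, ?_⟩
    · refine lt_of_le_of_lt ?_ hG
      by_cases ha : a = 0
      · simp [ha]
      · rw [degree_C_mul (by simpa using ha)]
    · intro i; rw [coeff_C_mul]
      exact (natDegree_C_mul_le _ _).trans (hG1 i)
    · simp [ev, eval₂_mul, Algebra.smul_def]
end
end WS

namespace WS
section
variable {K A : Type} [Field K] [CommRing A] [Algebra K A]

lemma ev_range (Q : K[X][X]) (x y : A) {n : ℕ} (hn : Q.natDegree < n) :
    ev Q x y = ∑ i ∈ Finset.range n, aeval x (Q.coeff i) * y ^ i := by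
  rw [ev, eval₂_eq_sum_range' _ hn]; rfl

/-- weights of coefficient terms -/
lemma aeval_coeff_mem {Q : K[X][X]} {h w : ℕ} (hQ : Wt h w Q) (u z : A) (i : ℕ) (S : Submodule K A)
    (hS : ∀ j, j + h * i ≤ w → u ^ j * z ∈ S) : aeval u (Q.coeff i) * z ∈ S := by
  rw [aeval_supp, Finset.sum_mul]
  refine Submodule.sum_mem _ fun j hj => ?_
  rw [smul_mul_assoc]
  exact Submodule.smul_mem _ _ (hS j (hQ i j (mem_support_iff.1 hj)))

lemma rel0 {Q : K[X][X]} {h d : ℕ} (hQ : Wt h (h * d) Q) (hm : Q.Monic) (hd : Q.natDegree = d)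
    {u v : A} (h0 : ev Q u v = 0) : v ^ d ∈ Submodule.span K (redSet0 u v h d (h * d)) := by
  rw [ev_range Q u v (n := d + 1) (by omega), Finset.sum_range_succ, ← hd, hm.coeff_natDegree,
    map_one, one_mul, hd] at h0
  rw [eq_neg_of_add_eq_zero_right h0]
  refine Submodule.neg_mem _ (Submodule.sum_mem _ fun i hi => ?_)
  refine aeval_coeff_mem hQ _ _ _ _ fun j hj => ?_
  exact Submodule.subset_span ⟨j, i, Finset.mem_range.1 hi, hj, rfl⟩

noncomputable def qdiff (Q : K[X][X]) (x y y1 : A) : A :=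
  ∑ i ∈ Finset.range (Q.natDegree + 1), aeval x (Q.coeff i) *
    ∑ a ∈ Finset.range i, y1 ^ a * y ^ (i - 1 - a)

lemma qdiff_mul (Q : K[X][X]) (x y y1 : A) :
    qdiff Q x y y1 * (y1 - y) = ev Q x y1 - ev Q x y := by
  rw [ev_range Q x y1 (n := Q.natDegree + 1) (by omega),
    ev_range Q x y (n := Q.natDegree + 1) (by omega), qdiff, Finset.sum_mul,
    ← Finset.sum_sub_distrib]
  refine Finset.sum_congr rfl fun i _ => ?_
  rw [mul_assoc, geom_sum₂_mul, mul_sub]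

lemma qdiff_map {B : Type} [CommRing B] [Algebra K B] (φ : A →ₐ[K] B) (Q : K[X][X]) (x y y1 : A) :
    φ (qdiff Q x y y1) = qdiff Q (φ x) (φ y) (φ y1) := by
  simp [qdiff, map_sum, ← aeval_algHom_apply]

lemma rel1 {Q : K[X][X]} {h d : ℕ} (hQ : Wt h (h * d) Q) (hm : Q.Monic) (hd : Q.natDegree = d)
    (hd1 : 1 ≤ d) {u v v1 : A} (h0 : qdiff Q u v v1 = 0) :
    v1 ^ (d - 1) ∈ Submodule.span K (redSet1 u v v1 h (d - 1) (h * (d - 1))) := by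
  obtain ⟨e, rfl⟩ : ∃ e, d = e + 1 := ⟨d - 1, by omega⟩
  rw [qdiff, Finset.sum_range_succ, hm.coeff_natDegree, map_one, one_mul, hd,
    Finset.sum_range_succ (fun a => v1 ^ a * v ^ (e + 1 - 1 - a)), ← add_assoc] at h0
  simp only [add_tsub_cancel_right, Nat.sub_self, pow_zero, mul_one] at h0 ⊢
  rw [eq_neg_of_add_eq_zero_right h0]
  refine Submodule.neg_mem _ (Submodule.add_mem _ (Submodule.sum_mem _ fun i hi => ?_)
    (Submodule.sum_mem _ fun a ha => ?_))
  · have hi := Finset.mem_range.1 hi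
    rw [Finset.mul_sum]
    refine Submodule.sum_mem _ fun a ha => ?_
    have ha := Finset.mem_range.1 ha
    refine aeval_coeff_mem hQ _ _ _ _ fun j hj => ?_
    refine Submodule.subset_span ⟨j, i - 1 - a, a, by omega, ?_, by ring⟩
    have : i - 1 - a + a = i - 1 := by omega
    rw [this]
    obtain ⟨i, rfl⟩ : ∃ i', i = i' + 1 := ⟨i - 1, by omega⟩
    simp only [add_tsub_cancel_right]
    nlinarith
  · have ha := Finset.mem_range.1 ha
    refine Submodule.subset_span ⟨0, e - a, a, ha, ?_, by ring⟩
    have : e - a + a = e := by omega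
    rw [this]; omega

/-- universal ring for one relation -/
lemma exists_ring (T1 T2 : MvPolynomial (Fin 3) K) :
    ∃ (A : Type) (_ : CommRing A) (_ : Algebra K A) (u v v1 : A),
      MvPolynomial.aeval ![u, v, v1] T1 = 0 ∧ MvPolynomial.aeval ![u, v, v1] T2 = 0 ∧
      ∀ (B : Type) [CommRing B] [Algebra K B] (x y y1 : B),
        MvPolynomial.aeval ![x, y, y1] T1 = 0 → MvPolynomial.aeval ![x, y, y1] T2 = 0 →
        ∃ φ : A →ₐ[K] B, φ u = x ∧ φ v = y ∧ φ v1 = y1 := by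
  let I : Ideal (MvPolynomial (Fin 3) K) := Ideal.span {T1, T2}
  let π : MvPolynomial (Fin 3) K →ₐ[K] (MvPolynomial (Fin 3) K ⧸ I) := Ideal.Quotient.mkₐ K I
  have hπ : ∀ T, MvPolynomial.aeval ![π (.X 0), π (.X 1), π (.X 2)] T = π T := by
    intro T
    have : MvPolynomial.aeval ![π (.X 0), π (.X 1), π (.X 2)] = π := by
      apply MvPolynomial.algHom_ext
      intro i
      fin_cases i <;> simp
    rw [this]
  refine ⟨MvPolynomial (Fin 3) K ⧸ I, inferInstance, inferInstance, π (.X 0), π (.X 1), π (.X 2),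
    ?_, ?_, ?_⟩
  · rw [hπ]; exact Ideal.Quotient.eq_zero_iff_mem.2 (Ideal.subset_span (by simp))
  · rw [hπ]; exact Ideal.Quotient.eq_zero_iff_mem.2 (Ideal.subset_span (by simp))
  · intro B _ _ x y y1 h1 h2
    refine ⟨Ideal.Quotient.liftₐ I (MvPolynomial.aeval ![x, y, y1]) ?_, ?_, ?_, ?_⟩
    · intro a ha
      have : I ≤ RingHom.ker (MvPolynomial.aeval ![x, y, y1] : MvPolynomial (Fin 3) K →ₐ[K] B) := by
        refine Ideal.span_le.2 ?_
        rintro t (rfl | rfl)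
        · exact h1
        · exact h2
      exact this ha
    · exact (Ideal.Quotient.lift_mk I _ _).trans (by simp)
    · exact (Ideal.Quotient.lift_mk I _ _).trans (by simp)
    · exact (Ideal.Quotient.lift_mk I _ _).trans (by simp)

/-- ring of type Δ : a curve -/
theorem ringD (Q : K[X][X]) : ∃ (A : Type) (_ : CommRing A) (_ : Algebra K A) (u v : A),
      ev Q u v = 0 ∧
      ∀ (B : Type) [CommRing B] [Algebra K B] (x y : B), ev Q x y = 0 →
        ∃ φ : A →ₐ[K] B, φ u = x ∧ φ v = y := by
  obtain ⟨A, i1, i2, u, v, v1, h1, -, h⟩ := exists_ring (K := K)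
    (ev Q (MvPolynomial.X 0) (MvPolynomial.X 1)) 0
  refine ⟨A, i1, i2, u, v, ?_, ?_⟩
  · simpa [ev_map] using h1
  · intro B _ _ x y hxy
    obtain ⟨φ, a, b, -⟩ := h B x y 0 (by simpa [ev_map] using hxy) (by simp)
    exact ⟨φ, a, b⟩

/-- ring of type Δ' : pairs of distinct points in a fibre -/
theorem ringD' (Q : K[X][X]) : ∃ (A : Type) (_ : CommRing A) (_ : Algebra K A) (u v v1 : A),
      ev Q u v = 0 ∧ ev Q u v1 = 0 ∧ qdiff Q u v v1 = 0 ∧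
      ∀ (B : Type) [CommRing B] [Algebra K B] [IsDomain B] (x y y1 : B), ev Q x y = 0 →
        ev Q x y1 = 0 → y1 ≠ y →
        ∃ φ : A →ₐ[K] B, φ u = x ∧ φ v = y ∧ φ v1 = y1 := by
  obtain ⟨A, i1, i2, u, v, v1, h1, h2, h⟩ := exists_ring (K := K)
    (ev Q (MvPolynomial.X 0) (MvPolynomial.X 1))
    (qdiff Q (MvPolynomial.X 0) (MvPolynomial.X 1) (MvPolynomial.X 2))
  have h1 : ev Q u v = 0 := by simpa [ev_map] using h1
  have h2 : qdiff Q u v v1 = 0 := by simpa [qdiff_map] using h2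
  refine ⟨A, i1, i2, u, v, v1, h1, ?_, h2, ?_⟩
  · have := qdiff_mul Q u v v1
    rw [h2, h1, zero_mul, sub_zero] at this
    exact this.symm
  · intro B _ _ _ x y y1 hxy hxy1 hne
    refine h B x y y1 (by simpa [ev_map] using hxy) ?_
    have := qdiff_mul Q x y y1
    rw [hxy, hxy1, sub_zero] at this
    have := (mul_eq_zero.1 this).resolve_right (sub_ne_zero.2 hne)
    simpa [qdiff_map] using this
end
end WS

namespace WS
section det
variable {R : Type} [CommRing R]

lemma det_natDegree_le {n : ℕ} (Mx : Matrix (Fin n) (Fin n) R[X]) (c : Fin n → ℕ)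
    (h : ∀ i j, (Mx i j).natDegree ≤ c j) : Mx.det.natDegree ≤ ∑ j, c j := by
  rw [Matrix.det_apply]
  refine natDegree_sum_le_of_forall_le _ _ fun σ _ => ?_
  refine (natDegree_smul_le _ _).trans ?_
  refine (natDegree_prod_le _ _).trans ?_
  exact Finset.sum_le_sum fun j _ => h _ _

lemma resultant_natDegree_le (M G : R[X][X]) {d d' e n : ℕ} (hM : ∀ i, (M.coeff i).natDegree ≤ e)
    (hG : ∀ i, (G.coeff i).natDegree ≤ n) :
    (resultant M G d d').natDegree ≤ d * n + d' * e := by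
  rw [resultant]
  refine (det_natDegree_le _ (fun j => Fin.addCases (fun _ => n) (fun _ => e) j) ?_).trans ?_
  · intro i j
    rw [sylvester, Matrix.of_apply]
    refine Fin.addCases (fun j => ?_) (fun j => ?_) j
    · simp only [Fin.addCases_left]
      split_ifs
      · exact hG _
      · simp
    · simp only [Fin.addCases_right]
      split_ifs
      · exact hM _
      · simp
  · rw [Fin.sum_univ_add]
    simp
end det

section
variable {κ : Type} [Field κ]

lemma sum_orders_le (p : κ[X]) (hp : p ≠ 0) {ι : Type} (S : Finset ι) (x : ι → κ)
    (hx : Set.InjOn x S) (o : ι → ℕ)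
    (h : ∀ i ∈ S, (X - C (x i)) ^ o i ∣ p) : ∑ i ∈ S, o i ≤ p.natDegree := by
  classical
  have : ∏ i ∈ S, (X - C (x i)) ^ o i ∣ p := by
    refine Finset.prod_dvd_of_coprime ?_ h
    intro i hi j hj hij
    exact (isCoprime_X_sub_C_of_isUnit_sub
      (sub_ne_zero.2 (fun e => hij (hx hi hj e))).isUnit).pow
  have h2 := natDegree_le_of_dvd this hp
  rw [natDegree_prod _ _ fun i _ => pow_ne_zero _ (X_sub_C_ne_zero _)] at h2
  simpa using h2

lemma roots_eq_of_card {R : Type} [CommRing R] [IsDomain R] {f : R[X]} (hf : f ≠ 0) {s : Multiset R}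
    (hs : s.Nodup) (h : ∀ x ∈ s, f.IsRoot x) (hc : f.natDegree = Multiset.card s) :
    f.roots = s := by
  symm
  apply Multiset.eq_of_le_of_card_le
  · rw [Multiset.le_iff_subset hs]
    intro x hx
    exact (mem_roots hf).2 (h x hx)
  · rw [← hc]; exact card_roots' f

lemma derivative_ne_zero_of_roots {f : κ[X]} (hf : f ≠ 0) {s : Finset κ}
    (h : ∀ x ∈ s, f.IsRoot x) (hc : f.natDegree = s.card) {x : κ} (hx : x ∈ s) :
    (derivative f).eval x ≠ 0 := by
  classical
  intro h0
  have h1 := (one_lt_rootMultiplicity_iff_isRoot hf).2 ⟨h x hx, h0⟩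
  have h2 := roots_eq_of_card hf s.nodup h hc
  rw [← count_roots, h2, Multiset.count_eq_one_of_mem s.nodup hx] at h1
  exact lt_irrefl _ h1

/-- Hensel for power series -/
lemma hensel_ps {R : Type} [CommRing R] (f : (PowerSeries R)[X]) (hf : f.Monic) (a : R)
    (h0 : eval₂ PowerSeries.constantCoeff a f = 0)
    (h1 : IsUnit (eval₂ PowerSeries.constantCoeff a (derivative f))) :
    ∃ y : PowerSeries R, f.eval y = 0 ∧ PowerSeries.constantCoeff y = a := by
  have hh : HenselianRing (PowerSeries R) (Ideal.span {PowerSeries.X}) := inferInstance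
  have key : ∀ g : (PowerSeries R)[X], PowerSeries.constantCoeff (g.eval (PowerSeries.C a)) =
      eval₂ PowerSeries.constantCoeff a g := by
    intro g
    rw [← eval₂_at_apply, PowerSeries.constantCoeff_C]
  obtain ⟨y, hy, hya⟩ := hh.is_henselian f hf (PowerSeries.C a) (by
    rw [Ideal.mem_span_singleton, PowerSeries.X_dvd_iff, key, h0]) (by
    have : IsUnit (f.derivative.eval (PowerSeries.C a)) := by
      rw [PowerSeries.isUnit_iff_constantCoeff, key]; exact h1
    exact this.map _)
  refine ⟨y, hy, ?_⟩
  rw [Ideal.mem_span_singleton, PowerSeries.X_dvd_iff, map_sub, PowerSeries.constantCoeff_C,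
    sub_eq_zero] at hya
  exact hya

noncomputable abbrev shf (x0 : κ) : PowerSeries κ := PowerSeries.C x0 + PowerSeries.X

lemma shf_aeval (x0 : κ) (p : κ[X]) :
    aeval (shf x0) p = ((p.comp (C x0 + X) : κ[X]) : PowerSeries κ) := by
  have h : (aeval (shf x0) : κ[X] →ₐ[κ] _) =
      (Polynomial.coeToPowerSeries.algHom κ).comp (aeval (C x0 + X)) := by
    apply Polynomial.algHom_ext
    simp [shf]
  rw [h]
  simp [comp, aeval_def, Polynomial.coeToPowerSeries.algHom_apply]

lemma dvd_of_shf_dvd (x0 : κ) (p : κ[X]) (o : ℕ) (h : PowerSeries.X ^ o ∣ aeval (shf x0) p) :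
    (X - C x0) ^ o ∣ p := by
  rw [shf_aeval, PowerSeries.X_pow_dvd_iff] at h
  have h1 : X ^ o ∣ p.comp (C x0 + X) := by
    rw [X_pow_dvd_iff]
    intro m hm
    have := h m hm
    rwa [coeff_coe] at this
  obtain ⟨g, hg⟩ := h1
  refine ⟨g.comp (X - C x0), ?_⟩
  have : (p.comp (C x0 + X)).comp (X - C x0) = p := by
    rw [comp_assoc]; simp
  rw [← this, hg]
  simp

lemma constCoeff_ev (Q : κ[X][X]) (x0 : κ) (y : PowerSeries κ) :
    PowerSeries.constantCoeff (ev Q (shf x0) y) =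
      (Q.map (evalRingHom x0)).eval (PowerSeries.constantCoeff y) := by
  rw [ev, hom_eval₂, eval_map]
  congr 1
  apply Polynomial.ringHom_ext
  · intro a; simp
  · simp [shf]

theorem local_order (M G : κ[X][X]) {d : ℕ} (hM : M.Monic) (hd : M.natDegree = d)
    (hG : G.natDegree ≤ d) (x0 : κ) (R : Finset κ) (hR : R.card = d)
    (hRr : ∀ β ∈ R, (M.map (evalRingHom x0)).eval β = 0) (o : κ → ℕ)
    (H : ∀ β ∈ R, ∀ y : PowerSeries κ, PowerSeries.constantCoeff y = β → ev M (shf x0) y = 0 →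
      PowerSeries.X ^ (o β) ∣ ev G (shf x0) y) :
    (X - C x0) ^ (∑ β ∈ R, o β) ∣ resultant M G d d := by
  classical
  apply dvd_of_shf_dvd
  let φ : κ[X] →+* PowerSeries κ := (aeval (shf x0) : κ[X] →ₐ[κ] _).toRingHom
  have hφ : ∀ p, aeval (shf x0) p = φ p := fun _ => rfl
  have hMφ : (M.map φ).Monic := hM.map φ
  have hdφ : (M.map φ).natDegree = d := by rw [hM.natDegree_map, hd]
  have hc : (PowerSeries.constantCoeff).comp φ = evalRingHom x0 := by
    apply Polynomial.ringHom_ext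
    · intro a; simp [φ]
    · simp [φ, shf]
  have hM0 : (M.map (evalRingHom x0)).Monic := hM.map _
  have hd0 : (M.map (evalRingHom x0)).natDegree = R.card := by rw [hM.natDegree_map, hd, hR]
  have hy : ∀ β ∈ R, ∃ y : PowerSeries κ, (M.map φ).eval y = 0 ∧
      PowerSeries.constantCoeff y = β := by
    intro β hβ
    apply hensel_ps _ hMφ
    · rw [eval₂_map, hc, ← eval_map]; exact hRr β hβ
    · rw [derivative_map, eval₂_map, hc, ← eval_map, ← derivative_map]
      exact (derivative_ne_zero_of_roots hM0.ne_zero hRr hd0 hβ).isUnit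
  choose! y hy1 hy2 using hy
  have hroots : (M.map φ).roots = R.val.map y := by
    apply roots_eq_of_card hMφ.ne_zero
    · refine Multiset.Nodup.map_on ?_ R.nodup
      intro a ha b hb e
      rw [← hy2 a ha, ← hy2 b hb, e]
    · intro x hx
      obtain ⟨β, hβ, rfl⟩ := Multiset.mem_map.1 hx
      exact hy1 β hβ
    · rw [hdφ, Multiset.card_map]; exact hR.symm
  have hsp : (M.map φ).Splits := by
    rw [splits_iff_card_roots, hroots, hdφ, Multiset.card_map]; exact hR
  have := resultant_eq_prod_eval (M.map φ) (G.map φ) d (natDegree_map_le.trans hG) hsp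
  rw [hdφ, resultant_map_map, hMφ.leadingCoeff, one_pow, one_mul, hroots, Multiset.map_map] at this
  rw [hφ, this, ← Finset.prod_pow_eq_pow_sum]
  change _ ∣ ∏ β ∈ R, _
  refine Finset.prod_dvd_prod_of_dvd _ _ fun β hβ => ?_
  have := H β hβ (y β) (hy2 β hβ) (by
    have := hy1 β hβ
    rwa [eval_map] at this)
  rw [Function.comp_apply, eval_map]
  exact this
end
end WS

namespace WS
section
lemma prod_prime_dvd {R : Type*} [CommRing R] [IsDomain R] {ι : Type*} [DecidableEq ι] (f : ι → R)
    (s : Finset ι) : ∀ (_ : ∀ i ∈ s, Prime (f i)) (_ : ∀ i ∈ s, ∀ j ∈ s, i ≠ j → ¬ f i ∣ f j) (N : R)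
    (_ : ∀ i ∈ s, f i ∣ N), ∏ i ∈ s, f i ∣ N := by
  induction s using Finset.induction_on with
  | empty => intro _ _ N _; simp
  | insert a s ha ih =>
    intro hp hne N hd
    rw [Finset.prod_insert ha]
    obtain ⟨N', rfl⟩ := hd a (Finset.mem_insert_self _ _)
    apply mul_dvd_mul_left
    refine ih (fun i hi => hp i (Finset.mem_insert_of_mem hi))
      (fun i hi j hj => hne i (Finset.mem_insert_of_mem hi) j (Finset.mem_insert_of_mem hj)) N' ?_
    intro i hi
    refine ((hp i (Finset.mem_insert_of_mem hi)).dvd_or_dvd (hd i (Finset.mem_insert_of_mem hi))).resolve_left ?_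
    refine hne i (Finset.mem_insert_of_mem hi) a (Finset.mem_insert_self _ _) ?_
    rintro rfl; exact ha hi

lemma resultant_ne {R : Type} [CommRing R] [IsDomain R] [IsIntegrallyClosed R] {M G : R[X]} {d : ℕ}
    (hM : M.Monic) (hirr : Irreducible M) (hd : M.natDegree = d) (hG : G ≠ 0)
    (hGd : G.degree < d) : resultant M G d d ≠ 0 := by
  let L := FractionRing R
  have hinj : Function.Injective (algebraMap R L) := IsFractionRing.injective R L
  have h1 : Irreducible (M.map (algebraMap R L)) :=
    (Monic.irreducible_iff_irreducible_map_fraction_map hM).1 hirr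
  have hG' : G.map (algebraMap R L) ≠ 0 := (Polynomial.map_ne_zero_iff hinj).2 hG
  have hdd : (M.map (algebraMap R L)).natDegree = d := by rw [hM.natDegree_map, hd]
  have hcop : IsCoprime (M.map (algebraMap R L)) (G.map (algebraMap R L)) := by
    refine (h1.coprime_iff_not_dvd).2 fun hdvd => ?_
    have := degree_le_of_dvd hdvd hG'
    rw [degree_eq_natDegree (hM.map _).ne_zero, hdd] at this
    exact absurd (lt_of_le_of_lt (this.trans degree_map_le) hGd) (lt_irrefl _)
  have h2 := Polynomial.resultant_ne_zero _ _ hcop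
  have hle : (G.map (algebraMap R L)).natDegree ≤ d := by
    apply natDegree_le_of_degree_le
    exact degree_map_le.trans hGd.le
  have h3 : resultant (M.map (algebraMap R L)) (G.map (algebraMap R L)) d d ≠ 0 := by
    obtain ⟨k, hk⟩ := Nat.exists_eq_add_of_le hle
    have h4 := resultant_add_right_deg (M.map (algebraMap R L)) (G.map (algebraMap R L)) d _ k le_rfl
    rw [← hk] at h4
    rw [h4, ← hdd, (hM.map (algebraMap R L)).coeff_natDegree, one_pow, one_mul]
    exact h2
  rw [resultant_map_map] at h3
  intro h
  rw [h, map_zero] at h3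
  exact h3 rfl
end

section
variable {K : Type} [Field K] {p : ℕ} [hp : Fact p.Prime] [CharP K p]

lemma inv_poly (n : ℕ) (hn : 0 < n) (hnp : n < p) (m : ℕ) : ∀ f : K[X], f.natDegree ≤ m →
    f.comp (X + C (n : K)) = f → ∃ g : K[X], f = g.comp (X ^ p - X) := by
  have hp1 : 1 < p := hp.out.one_lt
  have hmon : (X ^ p - X : K[X]).Monic := monic_X_pow_sub (by simpa using hp1)
  have hdeg : (X ^ p - X : K[X]).natDegree = p := by
    rw [natDegree_sub_eq_left_of_natDegree_lt] <;> simp [hp1]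
  have hn0 : (n : K) ≠ 0 := by
    rw [Ne, CharP.cast_eq_zero_iff K p]
    exact fun h => absurd (Nat.le_of_dvd hn h) (by omega)
  have hfr : ∀ i : ℕ, (i : K) ^ p = i := fun i => by
    rw [← frobenius_def]; exact map_natCast (frobenius K p) i
  induction m using Nat.strong_induction_on with
  | _ m ih =>
    intro f hf hinv
    have hev : ∀ i : ℕ, f.eval ((i * n : ℕ) : K) = f.eval 0 := by
      intro i
      induction i with
      | zero => simp
      | succ i ih2 =>
        rw [← ih2]
        conv_rhs => rw [← hinv]
        rw [eval_comp]; simp; ring_nf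
    set f0 := f - C (f.eval 0) with hf0
    have hrem : f0 %ₘ (X ^ p - X) = 0 := by
      apply eq_zero_of_natDegree_lt_card_of_eval_eq_zero (f := fun i : Fin p => ((i * n : ℕ) : K))
      · intro i j hij
        simp only [Nat.cast_mul] at hij
        have := mul_right_cancel₀ hn0 hij
        have := (CharP.cast_eq_iff_mod_eq K p).1 this
        rw [Nat.mod_eq_of_lt i.2, Nat.mod_eq_of_lt j.2] at this
        exact Fin.ext this
      · intro i
        have h1 := congrArg (eval ((i * n : ℕ) : K)) (modByMonic_add_div f0 (X ^ p - X))
        rw [eval_add, eval_mul, eval_sub, eval_pow, eval_X, hfr, sub_self, zero_mul, add_zero] at h1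
        rw [h1, hf0, eval_sub, hev, eval_C, sub_self]
      · rw [Fintype.card_fin]
        have := natDegree_modByMonic_lt f0 hmon (by intro h; rw [h] at hdeg; simp at hdeg; omega)
        omega
    have hdiv := modByMonic_add_div f0 (X ^ p - X)
    rw [hrem, zero_add] at hdiv
    set f1 := f0 /ₘ (X ^ p - X) with hf1
    by_cases hz : f1 = 0
    · refine ⟨C (f.eval 0), ?_⟩
      rw [hz, mul_zero] at hdiv
      rw [C_comp]
      exact sub_eq_zero.1 hdiv.symm
    have hdf1 : f1.natDegree + p ≤ f.natDegree := by
      have h2 : f0.natDegree = f.natDegree := by rw [hf0, natDegree_sub_C]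
      rw [← h2, ← hdiv, hmon.natDegree_mul' hz, hdeg]; omega
    have hinv1 : f1.comp (X + C (n : K)) = f1 := by
      have h3 : f0.comp (X + C (n : K)) = f0 := by rw [hf0, sub_comp, hinv, C_comp]
      have hs : (X ^ p - X : K[X]).comp (X + C (n : K)) = X ^ p - X := by
        rw [sub_comp, pow_comp, X_comp, add_pow_char, ← C_pow, hfr]; ring
      rw [← hdiv, mul_comp, hs] at h3
      exact mul_left_cancel₀ hmon.ne_zero h3
    obtain ⟨g, hg⟩ := ih f1.natDegree (by omega) f1 le_rfl hinv1
    refine ⟨C (f.eval 0) + X * g, ?_⟩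
    rw [add_comp, C_comp, mul_comp, X_comp, ← hg, hdiv, hf0]; ring

/-- Artin-Schreier pullback stays irreducible -/
theorem irr_AS {Q : K[X][X]} (hQ : Q.Monic) (hirr : Irreducible Q) (hd : Q.natDegree < p) (a0 : K) :
    Irreducible (Q.map (aeval (C a0 + X ^ p - X : K[X]) : K[X] →ₐ[K] K[X]).toRingHom) := by
  classical
  have hp1 : 1 < p := hp.out.one_lt
  set θ : K[X] →+* K[X] := (aeval (C a0 + X ^ p - X : K[X]) : K[X] →ₐ[K] K[X]).toRingHom with hθ
  have hθa : ∀ f, θ f = f.comp (C a0 + X ^ p - X) := fun f => by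
    simp [hθ, comp, aeval_def]
  have hθi : Function.Injective θ := by
    intro f g hfg
    rw [hθa, hθa] at hfg
    have h1 : (f - g).comp (C a0 + X ^ p - X) = 0 := by rw [sub_comp, hfg, sub_self]
    rcases comp_eq_zero_iff.1 h1 with h | ⟨_, h⟩
    · exact sub_eq_zero.1 h
    · exfalso
      have h2 := congrArg (fun q => coeff q p) h
      generalize (C a0 + X ^ p - X : K[X]).coeff 0 = z at h2
      simp [coeff_X, coeff_C, hp1.ne, show p ≠ 0 by omega] at h2
  set N := Q.map θ with hN
  have hNm : N.Monic := hQ.map θ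
  have hNd : N.natDegree = Q.natDegree := hQ.natDegree_map θ
  have hNu : ¬ IsUnit N := by
    intro hu
    have h1 := hNm.natDegree_eq_zero.1 (natDegree_eq_zero_of_isUnit hu)
    rw [hN, ← Polynomial.map_one θ] at h1
    have h2 := Polynomial.map_injective θ hθi h1
    exact hirr.not_isUnit (h2 ▸ isUnit_one)
  -- a monic irreducible factor
  obtain ⟨g, hgm, hgi, hgN⟩ : ∃ g : K[X][X], g.Monic ∧ Irreducible g ∧ g ∣ N := by
    obtain ⟨g, hgi, hgN⟩ := WfDvdMonoid.exists_irreducible_factor hNu hNm.ne_zero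
    obtain ⟨e, he⟩ := hgN
    have hl : g.leadingCoeff * e.leadingCoeff = 1 := by
      rw [← leadingCoeff_mul, ← he, hNm.leadingCoeff]
    have hu : IsUnit (C e.leadingCoeff : K[X][X]) :=
      (IsUnit.of_mul_eq_one _ (by rw [mul_comm]; exact hl)).map C
    refine ⟨g * C e.leadingCoeff, ?_, ?_, ?_⟩
    · rw [Monic, leadingCoeff_mul, leadingCoeff_C, hl]
    · exact (irreducible_mul_isUnit hu).2 hgi
    · rw [hu.mul_right_dvd, he]; exact dvd_mul_right _ _
  have hge : 0 < g.natDegree := by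
    rcases Nat.eq_zero_or_pos g.natDegree with h | h
    · exact absurd ((hgm.natDegree_eq_zero.1 h) ▸ isUnit_one) hgi.not_isUnit
    · exact h
  let T : ℕ → K[X] ≃ₐ[K] K[X] := fun n => algEquivAevalXAddC (n : K)
  have hT : ∀ n f, T n f = f.comp (X + C (n : K)) := fun n f => by
    simp [T, comp, aeval_def]
  let Tm : ℕ → K[X][X] ≃+* K[X][X] := fun n => Polynomial.mapEquiv (T n).toRingEquiv
  have hTm : ∀ n (f : K[X][X]), Tm n f = f.map ((T n).toRingEquiv : K[X] →+* K[X]) := fun n f => rfl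
  have hTN : ∀ n, Tm n N = N := by
    intro n
    rw [hTm, hN, Polynomial.map_map]
    congr 1
    have hfr : (n : K) ^ p = n := by
      rw [← frobenius_def]; exact map_natCast (frobenius K p) n
    apply Polynomial.ringHom_ext
    · intro a; simp [hθ, T]
    · have : ((T n).toRingEquiv : K[X] →+* K[X]) (θ X) = T n (θ X) := rfl
      rw [RingHom.comp_apply, this, hT, hθa, X_comp, sub_comp, add_comp, pow_comp, X_comp, C_comp,
        add_pow_char, ← C_pow, hfr]; ring
  have hTg : ∀ n, (Tm n g).Monic := fun n => hgm.map _
  have hninj : ¬ Set.InjOn (fun n => Tm n g) (Finset.range p) := by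
    intro hinj
    have hdvd : ∏ n ∈ Finset.range p, Tm n g ∣ N := by
      apply prod_prime_dvd
      · intro n _
        exact ((MulEquiv.irreducible_iff (Tm n)).2 hgi).prime
      · intro i hi j hj hij hd
        apply hij
        apply hinj hi hj
        have hass : Associated (Tm i g) (Tm j g) :=
          ((((MulEquiv.irreducible_iff (Tm j)).2 hgi).dvd_iff.1 hd).resolve_left
            ((MulEquiv.irreducible_iff (Tm i)).2 hgi).not_isUnit).symm
        exact eq_of_monic_of_associated (hTg i) (hTg j) hass
      · intro n _
        have := map_dvd (Tm n) hgN
        rwa [hTN] at this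
    have h1 := natDegree_le_of_dvd hdvd hNm.ne_zero
    rw [natDegree_prod_of_monic _ _ fun n _ => hTg n] at h1
    have h2 : ∀ n ∈ Finset.range p, (Tm n g).natDegree = g.natDegree := fun n _ =>
      hgm.natDegree_map _
    rw [Finset.sum_congr rfl h2, Finset.sum_const, Finset.card_range, smul_eq_mul] at h1
    nlinarith
  obtain ⟨c, hc0, hcp, hcg⟩ : ∃ c, 0 < c ∧ c < p ∧ Tm c g = g := by
    simp only [Set.InjOn] at hninj
    push Not at hninj
    have key : ∀ i j : ℕ, i < j → j < p → Tm i g = Tm j g → ∃ c, 0 < c ∧ c < p ∧ Tm c g = g := by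
      intro i j hij hj e
      refine ⟨j - i, by omega, by omega, ?_⟩
      apply (Tm i).injective
      rw [e, hTm, hTm, hTm, Polynomial.map_map]
      congr 1
      apply Polynomial.ringHom_ext
      · intro a; simp [T]
      · have : (((T i).toRingEquiv : K[X] →+* K[X]).comp ((T (j-i)).toRingEquiv : K[X] →+* K[X])) X
          = T i (T (j - i) X) := rfl
        rw [this, hT, hT]
        have h3 : ((T j).toRingEquiv : K[X] →+* K[X]) X = T j X := rfl
        rw [h3, hT]
        simp only [X_comp, add_comp, C_comp]
        rw [Nat.cast_sub hij.le, C_sub]; ring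
    obtain ⟨i, hi, j, hj, e, hne⟩ := hninj
    simp only [Finset.coe_range, Set.mem_Iio] at hi hj
    rcases lt_or_gt_of_ne hne with h | h
    · exact key i j h hj e
    · exact key j i h hi e.symm
  -- coefficients descend
  have hlift : g ∈ lifts θ := by
    rw [lifts_iff_coeff_lifts]
    intro m
    have h1 : (g.coeff m).comp (X + C (c : K)) = g.coeff m := by
      have := congrArg (fun q => coeff q m) hcg
      simp only [hTm, coeff_map] at this
      rw [← hT]; exact this
    obtain ⟨e, he⟩ := inv_poly c hc0 hcp _ _ le_rfl h1
    refine ⟨e.comp (X - C a0), ?_⟩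
    rw [hθa, comp_assoc, he]
    congr 1
    simp
    ring
  obtain ⟨g', hg', hg'd, hg'm⟩ := lifts_and_natDegree_eq_and_monic hlift hgm
  have hdvd : g' ∣ Q := by
    rw [← Polynomial.map_dvd_map θ hθi hg'm, hg']; exact hgN
  have hass : Associated g' Q := by
    refine (hirr.dvd_iff.1 hdvd).resolve_left ?_ |>.symm
    intro hu
    have := natDegree_eq_zero_of_isUnit hu
    omega
  have heq : g' = Q := eq_of_monic_of_associated hg'm hQ hass
  rw [hN, ← heq, hg']
  exact hgi
end
end WS

namespace WS
section
variable {K B : Type} [Field K] [CommRing B] [Algebra K B]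

lemma ev_congr_hom {L : Type} [CommRing L] (π : B →+* L) (Q : K[X][X]) {x x' y y' : B}
    (hx : π x = π x') (hy : π y = π y') : π (ev Q x y) = π (ev Q x' y') := by
  simp [ev_eq_sum, map_sum, Algebra.smul_def, hx, hy]

lemma qdiff_congr_hom {L : Type} [CommRing L] (π : B →+* L) (Q : K[X][X]) {x y y' : B}
    (hy : π y = π y') : π (qdiff Q x y y') = π (qdiff Q x y y) := by
  simp [qdiff, map_sum, hy]

lemma qdiff_self (Q : K[X][X]) (x y : B) : qdiff Q x y y = ev (derivative Q) x y := by
  rw [ev_range (derivative Q) x y (n := Q.natDegree + 1)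
    (lt_of_le_of_lt (natDegree_derivative_le Q) (by omega)), qdiff, Finset.sum_range_succ']
  rw [Finset.sum_range_succ (fun i => aeval x ((derivative Q).coeff i) * y ^ i)]
  have h0 : (derivative Q).coeff Q.natDegree = 0 := by
    rw [coeff_derivative, coeff_eq_zero_of_natDegree_lt (by omega), zero_mul]
  rw [h0]
  simp only [Finset.range_zero, Finset.sum_empty, mul_zero, map_zero, zero_mul]
  congr 1
  refine Finset.sum_congr rfl fun i _ => ?_
  have : ∑ a ∈ Finset.range (i + 1), y ^ a * y ^ (i + 1 - 1 - a) = (i + 1 : ℕ) * y ^ i := by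
    rw [Finset.sum_congr rfl (g := fun _ => y ^ i), Finset.sum_const, Finset.card_range, nsmul_eq_mul]
    intro a ha
    have := Finset.mem_range.1 ha
    rw [← pow_add]; congr 1; omega
  rw [this, coeff_derivative, map_mul]
  simp only [map_add, map_natCast, map_one]
  push_cast; ring

/-- comparison of approximate roots -/
lemma cmp_roots {L : Type} [Field L] (π : B →+* L) (hπ : ∀ z, π z ≠ 0 → IsUnit z) (I : Ideal B)
    (Q : K[X][X]) {x' y y0 : B} (h1 : ev Q x' y ∈ I) (h2 : ev Q x' y0 ∈ I) (hy : π y = π y0)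
    (hD : π (ev (derivative Q) x' y) ≠ 0) : y - y0 ∈ I := by
  have hu : IsUnit (qdiff Q x' y y0) := by
    apply hπ
    rw [qdiff_congr_hom π Q hy, qdiff_self]
    exact hD
  have h3 : qdiff Q x' y y0 * (y0 - y) ∈ I := by
    rw [qdiff_mul]; exact I.sub_mem h2 h1
  rw [← neg_sub]
  exact I.neg_mem ((Ideal.unit_mul_mem_iff_mem I hu).1 h3)

/-- vanishing along the diagonal curve, universal form -/
def VanP (Q : K[X][X]) {n1 n2 d p : ℕ} (F : Idx n1 n2 d p → K) (N : ℕ) (b : K) (l : ℕ) : Prop :=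
  ∀ (B : Type) [CommRing B] [Algebra K B] (x y : B), ev Q x y = 0 →
    IsUnit (ev (derivative Q) x y) → ∀ z : B, ∃ w : B,
      z ^ N ∣ ev Q (x + z ^ p - z) (y + z * w) ∧
      z ^ l ∣ evF F x y (x + z ^ p - z) (y + z * w) (algebraMap K B b + z)

def VanM (Q : K[X][X]) {n1 n2 d p : ℕ} (F : Idx n1 n2 d p → K) (N : ℕ) (b : K) (l : ℕ) : Prop :=
  ∀ (B : Type) [CommRing B] [IsDomain B] [Algebra K B] (x y y1 : B), ev Q x y = 0 →
    ev Q x y1 = 0 → y1 ≠ y →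
    IsUnit (ev (derivative Q) x y1) → ∀ z : B, ∃ w : B,
      z ^ N ∣ ev Q (x + z ^ p - z) (y1 + z * w) ∧
      z ^ l ∣ evF F x y (x + z ^ p - z) (y1 + z * w) (algebraMap K B b + z)

/-- evaluation of polynomial expansions as algebra hom -/
noncomputable def evp {A : Type} [CommRing A] [Algebra K A] (φ : A →ₐ[K] B) (σ : B) : A[X] →ₐ[K] B :=
  { eval₂RingHom φ.toRingHom σ with
    commutes' := fun r => by
      simp [Polynomial.algebraMap_apply] }

lemma evp_C {A : Type} [CommRing A] [Algebra K A] (φ : A →ₐ[K] B) (σ : B) (a : A) :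
    evp φ σ (C a) = φ a := by
  change eval₂ _ _ _ = _
  simp

lemma evp_X {A : Type} [CommRing A] [Algebra K A] (φ : A →ₐ[K] B) (σ : B) :
    evp φ σ X = σ := by
  change eval₂ _ _ _ = _
  simp

end
end WS

namespace WS
section
variable {K : Type} [Field K]

theorem diag_exp {A : Type} [CommRing A] [Algebra K A] {u v v1 : A} {h d d1 p : ℕ} (hh : 1 ≤ h)
    (hd : 1 ≤ d) (hp : 2 ≤ p) {Q : K[X][X]} (hQ : Wt h (h * d) Q)
    (hR0 : v ^ d ∈ Submodule.span K (redSet0 u v h d (h * d)))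
    (hR1 : v1 ^ d1 ∈ Submodule.span K (redSet1 u v v1 h d1 (h * d1)))
    (h1 : ev Q u v1 = 0) (b : K) (N l n1 n2 : ℕ) :
    ∃ U : Submodule K (Idx n1 n2 d p → K),
      Module.finrank K (Idx n1 n2 d p → K) ≤ Module.finrank K U +
        ∑ n ∈ Finset.range l, d * d1 * (n1 + n2 + 2 * (h * d) + 2 * (h * d) * n + 1) ∧
      ∀ F ∈ U, ∀ (B : Type) [CommRing B] [Algebra K B] (φ : A →ₐ[K] B),
        IsUnit (ev (derivative Q) (φ u) (φ v1)) → ∀ z : B, ∃ w : B,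
        z ^ N ∣ ev Q (φ u + z ^ p - z) (φ v1 + z * w) ∧
        z ^ l ∣ evF F (φ u) (φ v) (φ u + z ^ p - z) (φ v1 + z * w) (algebraMap K B b + z) := by
  set f : Filt K A := stdFilt u v v1 h with hf
  obtain ⟨D, hD⟩ : ∃ D : A[X], D = C (ev (derivative Q) u v1) := ⟨_, rfl⟩
  obtain ⟨ρ, hρ⟩ : ∃ ρ : A[X], ρ = D ^ 2 * X := ⟨_, rfl⟩
  obtain ⟨u', hu'⟩ : ∃ u' : A[X], u' = C u + ρ ^ p - ρ := ⟨_, rfl⟩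
  obtain ⟨hum, hρm, H⟩ := hensel_aux f hh hd hp hQ (stdFilt_u u v v1 h) (stdFilt_v1 u v v1 h) h1
    D ρ u' hD hρ hu'
  obtain ⟨s, hs, hy, E, hE, hNE, he⟩ := H N
  set y := C v1 + D * X * s with hydef
  let Φ : (Idx n1 n2 d p → K) →ₗ[K] A[X] :=
    { toFun := fun F => evF F (C u) (C v) u' y (algebraMap K A[X] b + ρ)
      map_add' := fun F G => evF_add F G _ _ _ _ _
      map_smul' := fun c F => evF_smul c F _ _ _ _ _ }
  have hΦm : ∀ F, Φ F ∈ (f.poly (2 * (h * d))).W (n1 + h * d + 1 * (n2 + h * d) + 0) := by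
    intro F
    refine evF_mem (f.poly (2 * (h * d))) F (f.C_mem _ (stdFilt_u u v v1 h))
      (f.C_mem _ (stdFilt_v u v v1 h)) hum (by rw [one_mul]; exact hy) ?_
    intro i _
    have := (f.poly (2 * (h * d))).pow (Submodule.add_mem _ ((f.poly (2 * (h * d))).alg b 0) hρm) i
    simpa using this
  let L : ℕ → (Idx n1 n2 d p → K) →ₗ[K] A := fun n => ((lcoeff A n).restrictScalars K).comp Φ
  have hL : ∀ n F, L n F = (Φ F).coeff n := fun n F => rfl
  obtain ⟨S, hS, hSd⟩ := codim_inf (Finset.range l) (fun n => LinearMap.ker (L n))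
    (fun n => d * d1 * (n1 + n2 + 2 * (h * d) + 2 * (h * d) * n + 1)) (by
      intro n _
      obtain ⟨hfin, hfr⟩ := stdFilt_finrank hR0 hR1 (n1 + n2 + 2 * (h * d) + 2 * (h * d) * n)
      have := codim_ker (L n) (f.W (n1 + n2 + 2 * (h * d) + 2 * (h * d) * n)) (by
        intro F
        have := hΦm F n
        refine f.mono ?_ this
        omega)
      exact this.trans (Nat.add_le_add_left hfr _))
  refine ⟨S, hSd, ?_⟩
  intro F hF B _ _ φ hu z
  obtain ⟨e, he2⟩ := hu.exists_left_inv
  set δ := ev (derivative Q) (φ u) (φ v1) with hδ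
  have hev : evp φ (e ^ 2 * z) D = δ := by rw [hD, evp_C, ev_map]
  have hevρ : evp φ (e ^ 2 * z) ρ = z := by
    rw [hρ, map_mul, map_pow, hev, evp_X]
    linear_combination z * (e * δ + 1) * he2
  have hevu : evp φ (e ^ 2 * z) u' = φ u + z ^ p - z := by
    rw [hu', map_sub, map_add, map_pow, hevρ, evp_C]
  have hevy : evp φ (e ^ 2 * z) y = φ v1 + z * (δ * e ^ 2 * evp φ (e ^ 2 * z) s) := by
    rw [hydef, map_add, map_mul, map_mul, hev, evp_C, evp_X]; ring
  have hσ : ∀ n, z ^ n ∣ (e ^ 2 * z) ^ n := fun n => ⟨(e ^ 2) ^ n, by ring⟩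
  refine ⟨δ * e ^ 2 * evp φ (e ^ 2 * z) s, ?_, ?_⟩
  · rw [← hevu, ← hevy, ← ev_map, he, map_mul]
    refine Dvd.dvd.mul_left ?_ _
    obtain ⟨E', rfl⟩ := hNE
    rw [map_mul, map_pow, evp_X]
    exact (hσ N).mul_right _
  · have hdv : X ^ l ∣ Φ F := by
      rw [X_pow_dvd_iff]
      intro n hn
      exact hS n (Finset.mem_range.2 hn) hF
    obtain ⟨G, hG⟩ := hdv
    have h2 := congrArg (evp φ (e ^ 2 * z)) hG
    change evp φ (e ^ 2 * z) (evF F (C u) (C v) u' y (algebraMap K A[X] b + ρ)) = _ at h2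
    rw [evF_map, evp_C, evp_C, hevu, hevy, map_add, AlgHom.commutes, hevρ, map_mul, map_pow, evp_X]
      at h2
    rw [h2]
    exact (hσ l).mul_right _

theorem diagP {h d p : ℕ} (hh : 1 ≤ h)
    (hd : 1 ≤ d) (hp : 2 ≤ p) {Q : K[X][X]} (hQ : Wt h (h * d) Q) (hm : Q.Monic)
    (hdeg : Q.natDegree = d) (b : K) (N l n1 n2 : ℕ) :
    ∃ U : Submodule K (Idx n1 n2 d p → K),
      Module.finrank K (Idx n1 n2 d p → K) ≤ Module.finrank K U +
        ∑ n ∈ Finset.range l, d * 1 * (n1 + n2 + 2 * (h * d) + 2 * (h * d) * n + 1) ∧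
      ∀ F ∈ U, VanP Q F N b l := by
  obtain ⟨A, _, _, u, v, h0, huniv⟩ := ringD Q
  have hR1 : v ^ 1 ∈ Submodule.span K (redSet1 u v v h 1 (h * 1)) :=
    Submodule.subset_span ⟨0, 1, 0, by simp, by simp, by simp⟩
  obtain ⟨U, hU, H⟩ := diag_exp hh hd hp hQ (rel0 hQ hm hdeg h0) hR1
    h0 b N l n1 n2
  refine ⟨U, hU, fun F hF B _ _ x y hxy hu z => ?_⟩
  obtain ⟨φ, rfl, rfl⟩ := huniv B x y hxy
  exact H F hF B φ hu z

theorem diagM {h d p : ℕ} (hh : 1 ≤ h)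
    (hd : 1 ≤ d) (hp : 2 ≤ p) {Q : K[X][X]} (hQ : Wt h (h * d) Q) (hm : Q.Monic)
    (hdeg : Q.natDegree = d) (b : K) (N l n1 n2 : ℕ) :
    ∃ U : Submodule K (Idx n1 n2 d p → K),
      Module.finrank K (Idx n1 n2 d p → K) ≤ Module.finrank K U +
        ∑ n ∈ Finset.range l, d * (d - 1) * (n1 + n2 + 2 * (h * d) + 2 * (h * d) * n + 1) ∧
      ∀ F ∈ U, VanM Q F N b l := by
  obtain ⟨A, _, _, u, v, v1, h0, h1, hq, huniv⟩ := ringD' Q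
  obtain ⟨U, hU, H⟩ := diag_exp hh hd hp hQ (rel0 hQ hm hdeg h0) (rel1 hQ hm hdeg hd hq)
    h1 b N l n1 n2
  refine ⟨U, hU, fun F hF B _ _ _ x y y1 hxy hxy1 hne hu z => ?_⟩
  obtain ⟨φ, rfl, rfl, rfl⟩ := huniv B x y y1 hxy hxy1 hne
  exact H F hF B φ hu z

/-- multiplicity weight -/
def kk (d : ℕ) (a : ℤ) : ℕ := if 0 ≤ a then 1 else d - 1

theorem exists_F {h d p : ℕ} (hh : 1 ≤ h)
    (hd : 1 ≤ d) (hp : 2 ≤ p) {Q : K[X][X]} (hQ : Wt h (h * d) Q) (hm : Q.Monic)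
    (hdeg : Q.natDegree = d) (N n1 n2 : ℕ) (a : Fin p → ℤ)
    (hcount : ∑ b, ∑ n ∈ Finset.range (a b).natAbs,
      d * kk d (a b) * (n1 + n2 + 2 * (h * d) + 2 * (h * d) * n + 1) < n1 * d * n2 * d * p) :
    ∃ F : Idx n1 n2 d p → K, F ≠ 0 ∧ ∀ b : Fin p, (0 ≤ a b → VanP Q F N ((b : ℕ) : K) (a b).natAbs) ∧
      (a b < 0 → VanM Q F N ((b : ℕ) : K) (a b).natAbs) := by
  have key : ∀ b : Fin p, ∃ U : Submodule K (Idx n1 n2 d p → K),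
      Module.finrank K (Idx n1 n2 d p → K) ≤ Module.finrank K U +
        ∑ n ∈ Finset.range (a b).natAbs, d * kk d (a b) * (n1 + n2 + 2 * (h * d) + 2 * (h * d) * n + 1) ∧
      ∀ F ∈ U, (0 ≤ a b → VanP Q F N ((b : ℕ) : K) (a b).natAbs) ∧
      (a b < 0 → VanM Q F N ((b : ℕ) : K) (a b).natAbs) := by
    intro b
    by_cases hb : 0 ≤ a b
    · obtain ⟨U, hU, H⟩ := diagP hh hd hp hQ hm hdeg ((b : ℕ) : K) N (a b).natAbs n1 n2
      refine ⟨U, ?_, fun F hF => ⟨fun _ => H F hF, fun h => absurd hb (by omega)⟩⟩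
      rw [kk, if_pos hb]; exact hU
    · obtain ⟨U, hU, H⟩ := diagM hh hd hp hQ hm hdeg ((b : ℕ) : K) N (a b).natAbs n1 n2
      refine ⟨U, ?_, fun F hF => ⟨fun h => absurd h hb, fun _ => H F hF⟩⟩
      rw [kk, if_neg hb]; exact hU
  choose U hU H using key
  obtain ⟨S, hS, hSd⟩ := codim_inf Finset.univ U _ fun b _ => hU b
  have hdim : Module.finrank K (Idx n1 n2 d p → K) = n1 * d * n2 * d * p := by
    rw [Module.finrank_fintype_fun_eq_card]
    simp only [Idx, Fintype.card_prod, Fintype.card_fin]; ring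
  have hpos : 0 < Module.finrank K S := by omega
  have : Nontrivial S := Module.finrank_pos_iff.1 hpos
  obtain ⟨F, hF⟩ := exists_ne (0 : S)
  refine ⟨F.1, fun h => hF (Subtype.ext h), fun b => H b F.1 (hS b (Finset.mem_univ _) F.2)⟩
end
end WS

namespace WS
section
variable {K : Type} [Field K] {p : ℕ} [hp : Fact p.Prime] [CharP K p]
variable {B : Type} [CommRing B] [Algebra K B]

lemma charP_alg (K : Type) [Field K] (p : ℕ) [CharP K p] (B : Type) [CommRing B] [Algebra K B]
    [Nontrivial B] : CharP B p :=
  charP_of_injective_algebraMap (algebraMap K B).injective p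

include K in
lemma fr_add (x y : B) : (x + y) ^ p = x ^ p + y ^ p := by
  cases subsingleton_or_nontrivial B with
  | inl _ => exact Subsingleton.elim _ _
  | inr _ =>
    have := charP_alg K p B
    exact add_pow_char x y p

include K in
lemma fr_sub (x y : B) : (x - y) ^ p = x ^ p - y ^ p := by
  have := fr_add (K := K) (p := p) (x - y) y
  rw [sub_add_cancel] at this
  rw [this]; ring

noncomputable def Rs (p a : ℕ) (x : B) : B := ∑ i ∈ Finset.range a, x ^ p ^ i

lemma Rs_map {B' : Type} [CommRing B'] [Algebra K B'] (φ : B →ₐ[K] B') (a : ℕ) (x : B) :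
    φ (Rs p a x) = Rs p a (φ x) := by simp [Rs]

include K in
lemma Rs_fr (a : ℕ) (x : B) : (Rs p a x) ^ p - Rs p a x = x ^ p ^ a - x := by
  induction a with
  | zero =>
    have : p ≠ 0 := hp.out.ne_zero
    simp [Rs, this]
  | succ a ih =>
    have e : Rs p (a + 1) x = Rs p a x + x ^ p ^ a := by rw [Rs, Finset.sum_range_succ]; rfl
    rw [e, fr_add (K := K), ← pow_mul, ← pow_succ]
    linear_combination ih

include K in
lemma Rs_add (a : ℕ) (x y : B) : Rs p a (x + y) = Rs p a x + Rs p a y := by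
  rw [Rs, Rs, Rs, ← Finset.sum_add_distrib]
  refine Finset.sum_congr rfl fun i hi => ?_
  clear hi
  induction i with
  | zero => simp
  | succ i ih => rw [pow_succ, pow_mul, ih, fr_add (K := K), ← pow_mul, ← pow_mul]

lemma Rs_dvd (a : ℕ) (x : B) : x ∣ Rs p a x :=
  Finset.dvd_sum fun i _ => dvd_pow_self x (pow_ne_zero _ hp.out.ne_zero)

lemma ev_pow_card [Fintype K] (Q : K[X][X]) (x y : B) :
    ev Q (x ^ Fintype.card K) (y ^ Fintype.card K) = (ev Q x y) ^ Fintype.card K := by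
  have := ev_map (FiniteField.frobeniusAlgHom K B) Q x y
  simpa using this.symm

theorem gamma_exp [Fintype K] {a : ℕ} (ha : 1 ≤ a) (hq : Fintype.card K = p ^ a)
    {A : Type} [CommRing A] [Algebra K A] {u v : A} {h d : ℕ} (hh : 1 ≤ h)
    (hd : 1 ≤ d) {Q : K[X][X]} (hQ : Wt h (h * d) Q) (h1 : ev Q u v = 0)
    {n1 n2 : ℕ} (F : Idx n1 n2 d p → K) (N : ℕ) (c : K) (hc : c ^ p = c) :
    ∃ Ψ : A[X], (∀ n, Ψ.coeff n ∈ (stdFilt (K := K) u v v h).W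
        (n1 + h * d + p ^ a * (n2 + h * d) + p ^ a + 2 * (h * d) * p ^ a * n)) ∧
      ∀ (B : Type) [CommRing B] [Algebra K B] (φ : A →ₐ[K] B) (σ : B), ∃ w : B, ∀ r : B,
        r = Rs p a (φ u) - algebraMap K B c +
          (ev (derivative Q) (φ u ^ p ^ a) (φ v ^ p ^ a)) ^ 2 * σ →
        σ ^ N ∣ ev Q (φ u + r ^ p - r) (φ v ^ p ^ a + σ * w) ∧
        evp φ σ Ψ = evF F (φ u) (φ v) (φ u + r ^ p - r) (φ v ^ p ^ a + σ * w) r := by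
  set q := p ^ a with hqdef
  set f : Filt K A := stdFilt u v v h with hf
  have huq : u ^ q ∈ (f.scale q).W 1 := by
    have := f.pow (stdFilt_u (K := K) u v v h) q
    exact this
  have hvq : v ^ q ∈ (f.scale q).W h := by
    have := f.pow (stdFilt_v (K := K) u v v h) q
    exact this
  have h1q : ev Q (u ^ q) (v ^ q) = 0 := by
    rw [← hq, ev_pow_card, h1, zero_pow]
    rw [hq]; exact pow_ne_zero _ hp.out.ne_zero
  obtain ⟨D, hD⟩ : ∃ D : A[X], D = C (ev (derivative Q) (u ^ q) (v ^ q)) := ⟨_, rfl⟩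
  obtain ⟨ρ, hρ⟩ : ∃ ρ : A[X], ρ = D ^ 2 * X := ⟨_, rfl⟩
  obtain ⟨u', hu'⟩ : ∃ u' : A[X], u' = C (u ^ q) + ρ ^ p - ρ := ⟨_, rfl⟩
  obtain ⟨hum, hρm, H⟩ := hensel_aux (f.scale q) hh hd hp.out.two_le hQ huq hvq h1q
    D ρ u' hD hρ hu'
  obtain ⟨s, hs, hy, E, hE, hNE, he⟩ := H N
  set y := C (v ^ q) + D * X * s with hydef
  have conv : ∀ (g : A[X]) (w : ℕ), g ∈ ((f.scale q).poly (2 * (h * d))).W w →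
      g ∈ (f.poly (2 * (h * d) * q)).W (q * w) := by
    intro g w hg n
    have := hg n
    have e : q * w + 2 * (h * d) * q * n = q * (w + 2 * (h * d) * n) := by ring
    rw [e]; exact this
  set r : A[X] := C (Rs p a u) - algebraMap K A[X] c + ρ with hr
  have hRs : Rs p a u ∈ f.W (p ^ (a - 1)) := by
    refine Submodule.sum_mem _ fun i hi => ?_
    refine f.mono ?_ (f.pow (stdFilt_u (K := K) u v v h) (p ^ i))
    rw [mul_one]
    exact Nat.pow_le_pow_right hp.out.pos (by have := Finset.mem_range.1 hi; omega)
  have hrm : r ∈ (f.poly (2 * (h * d) * q)).W (p ^ (a - 1)) := by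
    refine Submodule.add_mem _ (Submodule.sub_mem _ (f.C_mem _ hRs)
      ((f.poly (2 * (h * d) * q)).alg c _)) ?_
    exact (f.poly (2 * (h * d) * q)).mono (by simp) (conv _ _ hρm)
  have hrp : r ^ p - r = C (u ^ q) - C u + ρ ^ p - ρ := by
    have e1 : r ^ p = C (Rs p a u) ^ p - algebraMap K A[X] c + ρ ^ p := by
      rw [hr, fr_add (K := K), fr_sub (K := K), ← map_pow (algebraMap K A[X]), hc]
    have e2 := congrArg (C : A → A[X]) (Rs_fr (K := K) (p := p) a u)
    rw [C_sub, C_sub, C_pow] at e2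
    rw [e1, hr]
    linear_combination e2
  refine ⟨evF F (C u) (C v) u' y r, ?_, ?_⟩
  · have := evF_mem (f.poly (2 * (h * d) * q)) (a := q) (e := q) (h := h) F
      (f.C_mem _ (stdFilt_u (K := K) u v v h)) (f.C_mem _ (stdFilt_v (K := K) u v v h))
      (by simpa using conv _ _ hum) (conv _ _ hy) (by
        intro l hl
        refine (f.poly (2 * (h * d) * q)).mono ?_ ((f.poly (2 * (h * d) * q)).pow hrm l)
        calc l * p ^ (a - 1) ≤ p * p ^ (a - 1) := Nat.mul_le_mul_right _ hl.le
          _ = q := by rw [hqdef, ← pow_succ']; congr 1; omega)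
    exact this
  · intro B _ _ φ σ
    set δ := ev (derivative Q) (φ u ^ q) (φ v ^ q) with hδ
    have hev : evp φ σ D = δ := by rw [hD, evp_C, ev_map, map_pow, map_pow]
    refine ⟨δ * evp φ σ s, ?_⟩
    intro r' hr'
    have hevr : evp φ σ r = r' := by
      rw [hr, map_add, map_sub, evp_C, AlgHom.commutes, hρ, map_mul, map_pow, hev, evp_X, Rs_map, hr']
    have hevu : evp φ σ u' = φ u + r' ^ p - r' := by
      have : u' = C u + r ^ p - r := by rw [hu']; linear_combination -hrp
      rw [this, map_sub, map_add, map_pow, hevr, evp_C]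
    have hevy : evp φ σ y = φ v ^ q + σ * (δ * evp φ σ s) := by
      rw [hydef, map_add, map_mul, map_mul, hev, evp_C, evp_X, map_pow]; ring
    constructor
    · rw [← hevu, ← hevy, ← ev_map, he, map_mul]
      refine Dvd.dvd.mul_left ?_ _
      obtain ⟨E', rfl⟩ := hNE
      rw [map_mul, map_pow, evp_X]
      exact dvd_mul_right _ _
    · rw [evF_map, evp_C, evp_C, hevu, hevy, hevr]
end
end WS

namespace WS
section
variable {S : Type} [CommRing S]

lemma ord_mul (t : S) (m : ℕ) (e g : PowerSeries S)
    (hg : ∀ μ, t ^ (m - μ) ∣ PowerSeries.coeff μ g) (μ : ℕ) :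
    t ^ (m - μ) ∣ PowerSeries.coeff μ (e * g) := by
  rw [PowerSeries.coeff_mul]
  refine Finset.dvd_sum fun ij hij => Dvd.dvd.mul_left ?_ _
  have := Finset.HasAntidiagonal.mem_antidiagonal.1 hij
  exact (pow_dvd_pow t (by omega)).trans (hg ij.2)

lemma ord_pow (t : S) (e f : PowerSeries S) (l : ℕ) : ∀ (g : PowerSeries S) (μ : ℕ),
    t ^ (l - μ) ∣ PowerSeries.coeff μ
      (g * (PowerSeries.C t * e + PowerSeries.X * f) ^ l) := by
  intro g μ
  apply ord_mul
  clear μ g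
  induction l with
  | zero => intro μ; simp
  | succ l ih =>
    intro μ
    rw [pow_succ', add_mul, map_add]
    refine dvd_add ?_ ?_
    · rw [mul_assoc, PowerSeries.coeff_C_mul]
      have h1 := ord_mul t l e _ ih μ
      refine Dvd.dvd.trans ?_ (mul_dvd_mul_left t h1)
      rw [← pow_succ']
      exact pow_dvd_pow _ (by omega)
    · rw [mul_assoc]
      cases μ with
      | zero => simp
      | succ μ =>
        rw [PowerSeries.coeff_succ_X_mul]
        have h1 := ord_mul t l f _ ih μ
        have : l + 1 - (μ + 1) = l - μ := by omega
        rw [this]; exact h1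
end

section
variable {K : Type} [Field K] {p : ℕ} [hp : Fact p.Prime] [CharP K p]

noncomputable def psC (K : Type) [Field K] (S : Type) [CommRing S] [Algebra K S] :
    S →ₐ[K] PowerSeries S :=
  { PowerSeries.C (R := S) with commutes' := fun r => by simp [PowerSeries.algebraMap_apply] }

lemma psC_apply (S : Type) [CommRing S] [Algebra K S] (x : S) : psC K S x = PowerSeries.C x := rfl

lemma evp_ps {A S : Type} [CommRing A] [Algebra K A] [CommRing S] [Algebra K S] (φ : A →ₐ[K] S)
    (Ψ : A[X]) : evp ((psC K S).comp φ) PowerSeries.X Ψ =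
      ((Ψ.map φ.toRingHom : S[X]) : PowerSeries S) := by
  have h : (evp ((psC K S).comp φ) (PowerSeries.X : PowerSeries S)).toRingHom =
      (Polynomial.coeToPowerSeries.ringHom (R := S)).comp (mapRingHom φ.toRingHom) := by
    apply Polynomial.ringHom_ext
    · intro a
      change evp _ _ _ = _
      rw [evp_C]; simp [psC_apply]
    · change evp _ _ _ = _
      rw [evp_X]; simp
  exact congrArg (fun f => f Ψ) h

lemma isUnit_of_pi {κ : Type} [Field κ] (z : PowerSeries (PowerSeries κ))
    (h : (PowerSeries.constantCoeff.comp PowerSeries.constantCoeff : _ →+* κ) z ≠ 0) : IsUnit z := by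
  rw [PowerSeries.isUnit_iff_constantCoeff, PowerSeries.isUnit_iff_constantCoeff]
  exact (isUnit_iff_ne_zero.2 h)

theorem gamma_local [Fintype K] {a : ℕ} (ha : 1 ≤ a) (hq : Fintype.card K = p ^ a)
    {A : Type} [CommRing A] [Algebra K A] {u v : A} {h d : ℕ} (hh : 1 ≤ h)
    (hd : 1 ≤ d) {Q : K[X][X]} 
    {n1 n2 : ℕ} (F : Idx n1 n2 d p → K) (N : ℕ) (c b : K) (hc : c ^ p = c) (hb : b ^ p = b)
    (Ψ : A[X])
    (hΨ : ∀ (B : Type) [CommRing B] [Algebra K B] (φ : A →ₐ[K] B) (σ : B), ∃ w : B, ∀ r : B,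
        r = Rs p a (φ u) - algebraMap K B c +
          (ev (derivative Q) (φ u ^ p ^ a) (φ v ^ p ^ a)) ^ 2 * σ →
        σ ^ N ∣ ev Q (φ u + r ^ p - r) (φ v ^ p ^ a + σ * w) ∧
        evp φ σ Ψ = evF F (φ u) (φ v) (φ u + r ^ p - r) (φ v ^ p ^ a + σ * w) r)
    {κ : Type} [Field κ] [Algebra K κ] (a0 : K) (hab : b = Rs p a a0 - c)
    (φ : A →ₐ[K] PowerSeries κ) (y1 : PowerSeries κ)
    (hφu : φ u = shf (algebraMap K κ a0))
    (hv0 : ev Q (φ u) (φ v) = 0) (hv1 : ev Q (φ u) y1 = 0)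
    (hcc : PowerSeries.constantCoeff y1 = PowerSeries.constantCoeff (φ v) ^ p ^ a)
    (hun : IsUnit (ev (derivative Q) (φ u) y1)) (l : ℕ) (hl : l ≤ N)
    (htype : (VanP Q F N b l ∧ y1 = φ v) ∨ (VanM Q F N b l ∧ y1 ≠ φ v)) (μ : ℕ) (hμ : μ < N) :
    PowerSeries.X ^ (l - μ) ∣ φ (Ψ.coeff μ) := by
  set ι := psC K (PowerSeries κ) with hι
  set φ' := ι.comp φ with hφ'
  obtain ⟨w, hw⟩ := hΨ (PowerSeries (PowerSeries κ)) φ' PowerSeries.X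
  set D := ev (derivative Q) (φ' u ^ p ^ a) (φ' v ^ p ^ a) with hD
  set r := Rs p a (φ' u) - algebraMap K (PowerSeries (PowerSeries κ)) c + D ^ 2 * PowerSeries.X with hr
  obtain ⟨hw1, hw2⟩ := hw r rfl
  set π : PowerSeries (PowerSeries κ) →+* κ := PowerSeries.constantCoeff.comp PowerSeries.constantCoeff with hπ
  set z := r - algebraMap K (PowerSeries (PowerSeries κ)) b with hz
  have hzr : z ^ p - z = r ^ p - r := by
    rw [hz, fr_sub (K := K), ← map_pow, hb]; ring
  have hx' : φ' u + z ^ p - z = φ' u + r ^ p - r := by linear_combination hzr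
  have hbz : algebraMap K (PowerSeries (PowerSeries κ)) b + z = r := by rw [hz]; ring
  have hφ'u : φ' u = PowerSeries.C (φ u) := rfl
  have hφ'v : φ' v = PowerSeries.C (φ v) := rfl
  -- z in (t, σ)
  obtain ⟨e, hzef⟩ : ∃ e, z = PowerSeries.C (PowerSeries.X : PowerSeries κ) * e + PowerSeries.X * D ^ 2 := by
    obtain ⟨e, he⟩ := Rs_dvd (p := p) a (PowerSeries.C (PowerSeries.X : PowerSeries κ))
    refine ⟨e, ?_⟩
    rw [← he]
    have h1 : Rs p a (φ' u) = algebraMap K (PowerSeries (PowerSeries κ)) (Rs p a a0) +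
        Rs p a (PowerSeries.C (PowerSeries.X : PowerSeries κ)) := by
      have : φ' u = algebraMap K (PowerSeries (PowerSeries κ)) a0 + PowerSeries.C (PowerSeries.X : PowerSeries κ) := by
        rw [hφ'u, hφu, shf, map_add]
        congr 1
        rw [PowerSeries.algebraMap_apply, PowerSeries.algebraMap_apply]
      rw [this, Rs_add (K := K)]
      congr 1
      exact (Rs_map (K := K) (p := p) (Algebra.ofId K (PowerSeries (PowerSeries κ))) a a0).symm
    rw [hz, hr, h1, hab, map_sub]; ring
  have hπz : π z = 0 := by rw [hzef]; simp [hπ]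
  have hιev : ∀ (T : K[X][X]) (x y : PowerSeries κ), ev T (PowerSeries.C x) (PowerSeries.C y) =
      PowerSeries.C (ev T x y) := fun T x y => (ev_map ι T x y).symm
  have hun' : IsUnit (ev (derivative Q) (φ' u) (PowerSeries.C y1)) := by
    rw [hφ'u, hιev]; exact hun.map PowerSeries.C
  obtain ⟨w1, hN1, hl1⟩ : ∃ w1, z ^ N ∣ ev Q (φ' u + z ^ p - z) (PowerSeries.C y1 + z * w1) ∧
      z ^ l ∣ evF F (φ' u) (φ' v) (φ' u + z ^ p - z) (PowerSeries.C y1 + z * w1)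
        (algebraMap K (PowerSeries (PowerSeries κ)) b + z) := by
    rcases htype with ⟨hV, rfl⟩ | ⟨hV, hne⟩
    · exact hV (PowerSeries (PowerSeries κ)) (φ' u) (φ' v) (by rw [hφ'u, hφ'v, hιev, hv0, map_zero]) hun' z
    · exact hV (PowerSeries (PowerSeries κ)) (φ' u) (φ' v) (PowerSeries.C y1)
        (by rw [hφ'u, hφ'v, hιev, hv0, map_zero]) (by rw [hφ'u, hιev, hv1, map_zero])
        (fun h => hne (PowerSeries.C_injective h)) hun' z
  rw [hx'] at hN1
  rw [hx', hbz] at hl1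
  let I : Ideal (PowerSeries (PowerSeries κ)) := Ideal.span {z ^ l, PowerSeries.X ^ N}
  have hzI : z ^ l ∈ I := Ideal.subset_span (by simp)
  have hXI : (PowerSeries.X : PowerSeries (PowerSeries κ)) ^ N ∈ I := Ideal.subset_span (by simp)
  have hzNI : z ^ N ∈ I := I.mem_of_dvd (pow_dvd_pow z hl) hzI
  have hcmp := cmp_roots π (fun z hz => isUnit_of_pi z hz) I Q (x' := φ' u + r ^ p - r)
    (y := PowerSeries.C y1 + z * w1) (y0 := φ' v ^ p ^ a + PowerSeries.X * w)
    (I.mem_of_dvd hN1 hzNI) (I.mem_of_dvd hw1 hXI) (by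
      rw [map_add, map_mul, hπz, map_add, map_mul, hφ'v]
      simp [hπ, hcc]) (by
      rw [ev_congr_hom π (derivative Q) (x' := φ' u) (y' := PowerSeries.C y1)]
      · exact (hun'.map π).ne_zero
      · rw [← hx', map_sub, map_add, map_pow, hπz, zero_pow hp.out.ne_zero]; simp
      · rw [map_add, map_mul, hπz]; simp)
  have hF := evF_congr I F (u := φ' u) (v := φ' v) (u' := φ' u + r ^ p - r) (r := r) hcmp
  rw [← hw2, evp_ps] at hF
  have hmem : ((Ψ.map φ.toRingHom : (PowerSeries κ)[X]) : PowerSeries (PowerSeries κ)) ∈ I := by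
    have := I.sub_mem (I.mem_of_dvd hl1 hzI) hF
    rwa [sub_sub_cancel] at this
  obtain ⟨α, β, hαβ⟩ := Ideal.mem_span_pair.1 hmem
  have hco := congrArg (PowerSeries.coeff μ) hαβ
  rw [coeff_coe, coeff_map, map_add, PowerSeries.coeff_mul_X_pow', if_neg (by omega), add_zero] at hco
  change _ = φ (Ψ.coeff μ) at hco
  rw [← hco, hzef]
  exact ord_pow _ e _ l α μ
end
end WS

namespace WS
section
variable {K : Type} [Field K]

/-- base change of bivariate polynomials -/
noncomputable def bc (κ : Type) [Field κ] [Algebra K κ] (Q : K[X][X]) : κ[X][X] :=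
  Q.map (mapRingHom (algebraMap K κ))

lemma bc_coeff (κ : Type) [Field κ] [Algebra K κ] (Q : K[X][X]) (i : ℕ) :
    (bc κ Q).coeff i = (Q.coeff i).map (algebraMap K κ) := by simp [bc]

lemma ev_bc {κ : Type} [Field κ] [Algebra K κ] (Q : K[X][X]) {B : Type} [CommRing B] [Algebra κ B]
    [Algebra K B] [IsScalarTower K κ B] (x y : B) : ev (bc κ Q) x y = ev Q x y := by
  rw [ev, bc, eval₂_map, ev]
  congr 1
  apply Polynomial.ringHom_ext
  · intro a
    simp [← IsScalarTower.algebraMap_apply]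
  · simp

lemma bc_derivative (κ : Type) [Field κ] [Algebra K κ] (Q : K[X][X]) :
    derivative (bc κ Q) = bc κ (derivative Q) := by simp [bc, derivative_map]

lemma bc_monic (κ : Type) [Field κ] [Algebra K κ] {Q : K[X][X]} (hQ : Q.Monic) : (bc κ Q).Monic :=
  hQ.map _

lemma bc_natDegree (κ : Type) [Field κ] [Algebra K κ] {Q : K[X][X]} (hQ : Q.Monic) :
    (bc κ Q).natDegree = Q.natDegree := hQ.natDegree_map _

lemma eval_map_ev {κ : Type} [Field κ] (M : κ[X][X]) (x0 β : κ) :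
    (M.map (evalRingHom x0)).eval β = ev M x0 β := by
  rw [eval_map, ev]
  congr 1

lemma ev_eq_eval_map {κ : Type} [Field κ] {B : Type} [CommRing B] [Algebra κ B] (M : κ[X][X])
    (x y : B) : (M.map (aeval x : κ[X] →ₐ[κ] B).toRingHom).eval y = ev M x y := by
  rw [eval_map, ev]

/-- Lifting a simple root to power series -/
lemma lift_root {κ : Type} [Field κ] {M : κ[X][X]} (hM : M.Monic) (x0 β : κ) (h0 : ev M x0 β = 0)
    (h1 : ev (derivative M) x0 β ≠ 0) :
    ∃ y : PowerSeries κ, ev M (shf x0) y = 0 ∧ PowerSeries.constantCoeff y = β := by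
  have key : ∀ T : κ[X][X], eval₂ PowerSeries.constantCoeff β
      (T.map (aeval (shf x0) : κ[X] →ₐ[κ] PowerSeries κ).toRingHom) = ev T x0 β := by
    intro T
    rw [eval₂_map, ev]
    congr 1
    apply Polynomial.ringHom_ext
    · intro a; simp
    · simp [shf]
  obtain ⟨y, hy, hc⟩ := hensel_ps (M.map (aeval (shf x0) : κ[X] →ₐ[κ] PowerSeries κ).toRingHom)
    (hM.map _) β (by rw [key, h0]) (by rw [derivative_map, key]; exact isUnit_iff_ne_zero.2 h1)
  refine ⟨y, ?_, hc⟩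
  rw [← ev_eq_eval_map]; exact hy

lemma simple_of_card {κ : Type} [Field κ] {M : κ[X][X]} (hM : M.Monic) (x0 : κ) (R : Finset κ)
    (hR : R.card = M.natDegree) (hRr : ∀ β ∈ R, ev M x0 β = 0) {β : κ} (hβ : ev M x0 β = 0) :
    β ∈ R ∧ ev (derivative M) x0 β ≠ 0 := by
  have hm := hM.map (evalRingHom x0)
  have hr : ∀ x ∈ R, (M.map (evalRingHom x0)).IsRoot x := fun x hx => by
    rw [IsRoot, eval_map_ev]; exact hRr x hx
  have hn : (M.map (evalRingHom x0)).natDegree = R.card := by rw [hM.natDegree_map, hR]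
  have h1 := roots_eq_of_card hm.ne_zero R.nodup hr hn
  have hβR : β ∈ R := by
    have : β ∈ (M.map (evalRingHom x0)).roots := by
      rw [mem_roots hm.ne_zero, IsRoot, eval_map_ev]; exact hβ
    rw [h1] at this; exact this
  refine ⟨hβR, ?_⟩
  have := derivative_ne_zero_of_roots hm.ne_zero hr hn hβR
  rwa [derivative_map, eval_map_ev] at this

lemma Wt_coeff {Q : K[X][X]} {h w : ℕ} (hQ : Wt h w Q) (i : ℕ) : (Q.coeff i).natDegree ≤ w := by
  by_contra hcon
  push Not at hcon
  have h1 : (Q.coeff i).coeff (Q.coeff i).natDegree ≠ 0 := by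
    rw [coeff_natDegree, Ne, leadingCoeff_eq_zero]
    intro h0
    rw [h0] at hcon; simp at hcon
  have := hQ i _ h1
  omega

variable {p : ℕ} [hp : Fact p.Prime] [CharP K p]
open Classical in
theorem zero_count [Fintype K] {a : ℕ} (ha : 1 ≤ a) (hq : Fintype.card K = p ^ a)
    {h d : ℕ} (hh : 1 ≤ h)
    (hd : 1 ≤ d) {Q : K[X][X]} (hQ : Wt h (h * d) Q) (hm : Q.Monic) (hirr : Irreducible Q)
    (hdeg : Q.natDegree = d)
    {A : Type} [CommRing A] [Algebra K A] {u v : A} (huv : ev Q u v = 0)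
    (huniv : ∀ (B : Type) [CommRing B] [Algebra K B] (x y : B), ev Q x y = 0 →
        ∃ φ : A →ₐ[K] B, φ u = x ∧ φ v = y)
    {n1 n2 : ℕ} (F : Idx n1 n2 d p → K) (N : ℕ) (al : Fin p → ℤ)
    (hF : ∀ b : Fin p, (0 ≤ al b → VanP Q F N ((b : ℕ) : K) (al b).natAbs) ∧
      (al b < 0 → VanM Q F N ((b : ℕ) : K) (al b).natAbs))
    (hN : ∀ b, (al b).natAbs ≤ N)
    (c : K) (hc : c ^ p = c) (bb : K → Fin p) (hbb : ∀ x, ((bb x : ℕ) : K) = Rs p a x - c)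
    (Ψ : A[X]) (wt : ℕ → ℕ) (hΨm : ∀ n, Ψ.coeff n ∈ (stdFilt (K := K) u v v h).W (wt n))
    (hΨ : ∀ (B : Type) [CommRing B] [Algebra K B] (φ : A →ₐ[K] B) (σ : B), ∃ w : B, ∀ r : B,
        r = Rs p a (φ u) - algebraMap K B c +
          (ev (derivative Q) (φ u ^ p ^ a) (φ v ^ p ^ a)) ^ 2 * σ →
        σ ^ N ∣ ev Q (φ u + r ^ p - r) (φ v ^ p ^ a + σ * w) ∧
        evp φ σ Ψ = evF F (φ u) (φ v) (φ u + r ^ p - r) (φ v ^ p ^ a + σ * w) r)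
    {κ : Type} [Field κ] [Algebra K κ] (Gd : Finset K) (R : K → Finset κ)
    (hR : ∀ x ∈ Gd, (R x).card = d)
    (hRr : ∀ x ∈ Gd, ∀ β ∈ R x, ev Q (algebraMap K κ x) β = 0)
    (μ : ℕ) (hμ : μ < N) (hμ0 : Ψ.coeff μ ≠ 0) :
    ∑ x ∈ Gd, ∑ β ∈ R x, (if (0 ≤ al (bb x) ↔ β ^ p ^ a = β) then (al (bb x)).natAbs - μ else 0) ≤
      d * wt μ + d * (h * d) := by
  obtain ⟨G, hGd, hGw, hG⟩ := stdFilt_rep (rel0 hQ hm hdeg huv) (hΨm μ)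
  have hG0 : G ≠ 0 := by
    rintro rfl
    apply hμ0
    rw [← hG]; simp [ev]
  have hres := resultant_ne hm hirr hdeg hG0 hGd
  have hres' : resultant (bc κ Q) (bc κ G) d d ≠ 0 := by
    rw [bc, bc, resultant_map_map]
    have hinj : Function.Injective (mapRingHom (algebraMap K κ)) :=
      Polynomial.map_injective _ (algebraMap K κ).injective
    exact (map_ne_zero_iff _ hinj).2 hres
  have hdeg' : (resultant (bc κ Q) (bc κ G) d d).natDegree ≤ d * wt μ + d * (h * d) := by
    apply resultant_natDegree_le
    · intro i; rw [bc_coeff]; exact natDegree_map_le.trans (Wt_coeff hQ i)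
    · intro i; rw [bc_coeff]; exact natDegree_map_le.trans (hGw i)
  refine (sum_orders_le _ hres' Gd (fun x => algebraMap K κ x)
    (fun x _ y _ e => (algebraMap K κ).injective e) _ ?_).trans hdeg'
  intro x hx
  have hMm := bc_monic κ hm
  have hMd : (bc κ Q).natDegree = d := by rw [bc_natDegree κ hm, hdeg]
  have hRM : ∀ β ∈ R x, ev (bc κ Q) (algebraMap K κ x) β = 0 := fun β hβ => by
    rw [ev_bc]; exact hRr x hx β hβ
  apply local_order (bc κ Q) (bc κ G) hMm hMd
    (natDegree_map_le.trans (natDegree_le_of_degree_le hGd.le)) (algebraMap K κ x) (R x) (hR x hx)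
    (fun β hβ => by rw [eval_map_ev]; exact hRM β hβ)
    (fun β => if (0 ≤ al (bb x) ↔ β ^ p ^ a = β) then (al (bb x)).natAbs - μ else 0)
  intro β hβ y hyβ hy
  split_ifs with hmatch
  swap
  · simp
  have hyQ : ev Q (shf (algebraMap K κ x)) y = 0 := by rw [← hy, ev_bc]
  obtain ⟨φ, hφu, hφv⟩ := huniv (PowerSeries κ) _ y hyQ
  -- the conjugate root
  have hβq : ev (bc κ Q) (algebraMap K κ x) (β ^ p ^ a) = 0 := by
    have h1 := ev_pow_card Q (algebraMap K κ x) β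
    rw [hRr x hx β hβ, zero_pow Fintype.card_ne_zero, ← map_pow, FiniteField.pow_card, hq] at h1
    rw [ev_bc]; exact h1
  obtain ⟨hβqR, hβqD⟩ := simple_of_card hMm (algebraMap K κ x) (R x) (by rw [hR x hx, hMd]) hRM hβq
  obtain ⟨y1, hy1, hy1c, hty⟩ : ∃ y1, ev Q (shf (algebraMap K κ x)) y1 = 0 ∧
      PowerSeries.constantCoeff y1 = β ^ p ^ a ∧ (β ^ p ^ a = β ↔ y1 = y) := by
    by_cases hb : β ^ p ^ a = β
    · exact ⟨y, hyQ, by rw [hyβ, hb], by simp [hb]⟩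
    · obtain ⟨y1, h1, h2⟩ := lift_root hMm _ _ hβq hβqD
      refine ⟨y1, by rw [← h1, ev_bc], h2, ?_⟩
      simp only [hb, false_iff]
      rintro rfl
      exact hb (by rw [← h2, hyβ])
  have hbp : (((bb x : ℕ) : K)) ^ p = ((bb x : ℕ) : K) := by
    rw [← frobenius_def]; exact map_natCast (frobenius K p) _
  have hun : IsUnit (ev (derivative Q) (φ u) y1) := by
    rw [PowerSeries.isUnit_iff_constantCoeff, hφu, ← ev_bc (κ := κ), constCoeff_ev, eval_map_ev, hy1c,
      isUnit_iff_ne_zero, ← bc_derivative]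
    exact hβqD
  have := gamma_local ha hq hh hd (Q := Q) F N c ((bb x : ℕ) : K) hc hbp Ψ hΨ x (hbb x) φ y1 hφu
    (by rw [hφu, hφv, hyQ]) (by rw [hφu, hy1]) (by rw [hy1c, hφv, hyβ]) hun
    (al (bb x)).natAbs (hN _) (by
      rcases le_or_gt 0 (al (bb x)) with h0 | h0
      · left; exact ⟨(hF _).1 h0, by rw [hφv]; exact hty.1 (hmatch.1 h0)⟩
      · right; refine ⟨(hF _).2 h0, ?_⟩
        rw [hφv]
        intro e
        exact absurd (hmatch.2 (hty.2 e)) (by omega)) μ hμ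
  rw [← hG, ev_map, hφu, hφv] at this
  rw [ev_bc]; exact this
end
end WS

namespace WS
section
variable {K : Type} [Field K] {p : ℕ}

noncomputable def mr (p : ℕ) {B : Type} [CommRing B] (u : B) : B[X] := C u + X ^ p - X

noncomputable def Mr (p : ℕ) (Q : K[X][X]) {B : Type} [CommRing B] [Algebra K B] (u : B) : B[X][X] :=
  Q.map (aeval (mr p u) : K[X] →ₐ[K] B[X]).toRingHom

noncomputable def Fh {n1 n2 d p : ℕ} (F : Idx n1 n2 d p → K) {B : Type} [CommRing B] [Algebra K B]
    (u v : B) : B[X][X] :=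
  evF F (C (C u)) (C (C v)) (C (mr p u)) X (C X)

lemma mr_map {B B' : Type} [CommRing B] [CommRing B'] (φ : B →+* B') (u : B) :
    (mr p u).map φ = mr p (φ u) := by simp [mr]

lemma Mr_map (Q : K[X][X]) {B B' : Type} [CommRing B] [Algebra K B] [CommRing B'] [Algebra K B']
    (φ : B →ₐ[K] B') (u : B) : (Mr p Q u).map (mapRingHom φ.toRingHom) = Mr p Q (φ u) := by
  rw [Mr, map_map, Mr]
  congr 1
  apply Polynomial.ringHom_ext
  · intro a
    simp [Polynomial.algebraMap_apply]
  · simp [mr]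

lemma Fh_map {n1 n2 d p : ℕ} (F : Idx n1 n2 d p → K) {B B' : Type} [CommRing B] [Algebra K B]
    [CommRing B'] [Algebra K B'] (φ : B →ₐ[K] B') (u v : B) :
    (Fh F u v).map (mapRingHom φ.toRingHom) = Fh F (φ u) (φ v) := by
  have := evF_map (Polynomial.mapAlgHom (Polynomial.mapAlgHom φ)) F (C (C u)) (C (C v)) (C (mr p u)) X (C X)
  simp only [Polynomial.coe_mapAlgHom, Polynomial.map_C, Polynomial.map_X, RingHom.coe_coe] at this
  rw [Fh, Fh]
  have e : ((Polynomial.mapAlgHom φ : B[X] →ₐ[K] B'[X]) : B[X] →+* B'[X]) = mapRingHom φ.toRingHom := by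
    apply Polynomial.ringHom_ext <;> simp
  rw [e] at this
  rw [this]
  simp [mr]

lemma ev_Mr (Q : K[X][X]) {κ B : Type} [Field κ] [Algebra K κ] [CommRing B] [Algebra K B]
    [Algebra κ B] [IsScalarTower K κ B] (u : κ) (x y : B) :
    ev (Mr p Q u) x y = ev Q (algebraMap κ B u + x ^ p - x) y := by
  rw [ev, Mr, eval₂_map, ev]
  congr 1
  apply Polynomial.ringHom_ext
  · intro a
    simp [Polynomial.algebraMap_apply, ← IsScalarTower.algebraMap_apply]
  · simp [mr]

lemma ev_Fh {n1 n2 d p : ℕ} (F : Idx n1 n2 d p → K) {κ B : Type} [Field κ] [Algebra K κ] [CommRing B]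
    [Algebra K B] [Algebra κ B] [IsScalarTower K κ B] (u v : κ) (x y : B) :
    ev (Fh F u v) x y = evF F (algebraMap κ B u) (algebraMap κ B v)
      (algebraMap κ B u + x ^ p - x) y x := by
  let θ : κ[X][X] →ₐ[K] B :=
    { eval₂RingHom (aeval x : κ[X] →ₐ[κ] B).toRingHom y with
      commutes' := fun r => by
        simp [Polynomial.algebraMap_apply, ← IsScalarTower.algebraMap_apply] }
  have hθ : ∀ z, θ z = ev z x y := fun z => rfl
  rw [← hθ, Fh, evF_map]
  simp [hθ, ev, mr, eval₂_pow]

lemma indep_mr {B : Type} [CommRing B] [IsDomain B] {m : B[X]} (hm : m.Monic) {p : ℕ}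
    (hp : m.natDegree = p) : ∀ (n : ℕ) (g : ℕ → B[X]), (∀ i, (g i).degree < p) →
    ∑ i ∈ Finset.range n, m ^ i * g i = 0 → ∀ i < n, g i = 0 := by
  intro n
  induction n with
  | zero => intro g _ _ i hi; omega
  | succ n ih =>
    intro g hg hs
    rw [Finset.sum_range_succ'] at hs
    have h1 : ∑ i ∈ Finset.range n, m ^ (i + 1) * g (i + 1) =
        m * ∑ i ∈ Finset.range n, m ^ i * g (i + 1) := by
      rw [Finset.mul_sum]; refine Finset.sum_congr rfl fun i _ => by ring
    rw [h1] at hs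
    simp only [pow_zero, one_mul] at hs
    have h0 : g 0 = 0 := by
      have hd : m ∣ g 0 := ⟨-∑ i ∈ Finset.range n, m ^ i * g (i + 1), by linear_combination hs⟩
      by_contra hne
      have := Polynomial.degree_le_of_dvd hd hne
      have h3 := hg 0
      rw [degree_eq_natDegree hm.ne_zero, hp] at this
      exact absurd (lt_of_le_of_lt this h3) (lt_irrefl _)
    rw [h0, add_zero] at hs
    have h2 := (mul_eq_zero.1 hs).resolve_left hm.ne_zero
    intro i hi
    cases i with
    | zero => exact h0
    | succ i => exact ih (fun i => g (i + 1)) (fun i => hg _) h2 i (by omega)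

lemma mr_monic {B : Type} [CommRing B] [IsDomain B] (hp : 1 < p) (u : B) :
    (mr p u).Monic ∧ (mr p u).natDegree = p := by
  have h : mr p u = X ^ p + (C u - X) := by rw [mr]; ring
  have hd : (C u - X : B[X]).degree < p := by
    refine (degree_sub_le _ _).trans_lt ?_
    rw [max_lt_iff]
    exact ⟨degree_C_le.trans_lt (by exact_mod_cast (by omega : 0 < p)),
      degree_X_le.trans_lt (by exact_mod_cast hp)⟩
  rw [h]
  exact ⟨monic_X_pow_add hd, by
    rw [natDegree_add_eq_left_of_degree_lt (by rwa [degree_X_pow]), natDegree_X_pow]⟩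

/-- no low degree relation -/
lemma no_rel {O : Type} [CommRing O] [IsDomain O] [Algebra K O] {Q H : K[X][X]} {d : ℕ} (hm : Q.Monic)
    (hirr : Irreducible Q) (hdeg : Q.natDegree = d) {u v : O} (hu : Transcendental K u)
    (h0 : ev Q u v = 0) (hHd : H.degree < d) (hH : ev H u v = 0) : H = 0 := by
  by_contra hne
  have hres := resultant_ne hm hirr hdeg hne hHd
  obtain ⟨f, g, -, -, hfg⟩ := exists_mul_add_mul_eq_C_resultant Q H (m := d) (n := d) hdeg.le
    (natDegree_le_of_degree_le hHd.le) (by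
      have : 0 < d := by
        rw [← hdeg]
        by_contra h00
        have : Q = 1 := hm.natDegree_eq_zero.1 (by omega)
        exact hirr.not_isUnit (this ▸ isUnit_one)
      omega)
  have h1 := congrArg (fun T => eval₂ (aeval u : K[X] →ₐ[K] O).toRingHom v T) hfg
  simp only [eval₂_add, eval₂_mul, eval₂_C] at h1
  rw [show eval₂ _ v Q = 0 from h0, show eval₂ _ v H = 0 from hH] at h1
  simp only [zero_mul, add_zero] at h1
  exact hres ((transcendental_iff.1 hu) _ h1.symm)

lemma dsum_lt {R ι : Type} [CommRing R] {n : ℕ} (s : Finset ι) (f : ι → R[X])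
    (h : ∀ i ∈ s, (f i).degree < n) : (∑ i ∈ s, f i).degree < n := by
  rw [← mem_degreeLT]
  exact Submodule.sum_mem _ fun i hi => mem_degreeLT.2 (h i hi)

lemma Fh_ne_zero {O : Type} [CommRing O] [IsDomain O] [Algebra K O] {Q : K[X][X]} {d : ℕ} (hp : 1 < p)
    (hm : Q.Monic)
    (hirr : Irreducible Q) (hdeg : Q.natDegree = d) {u v : O} (hu : Transcendental K u)
    (h0 : ev Q u v = 0) {n1 n2 : ℕ} (F : Idx n1 n2 d p → K) (hF : Fh F u v = 0) : F = 0 := by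
  classical
  obtain ⟨hmm, hmd⟩ := mr_monic hp u
  let c : Fin n2 → Fin d → Fin p → O := fun α' j l =>
    ∑ α : Fin n1, ∑ i : Fin d, F (α, i, α', j, l) • (u ^ (α : ℕ) * v ^ (i : ℕ))
  -- coefficient of Y^j
  have hj : ∀ j : Fin d, ∑ α' : Fin n2, mr p u ^ (α' : ℕ) * ∑ l : Fin p, C (c α' j l) * X ^ (l : ℕ) = 0 := by
    intro j
    have h1 := congrArg (fun T => coeff T (j : ℕ)) hF
    simp only [Fh, evF, finsetSum_coeff, coeff_zero] at h1
    have ht : ∀ x : Idx n1 n2 d p, coeff (F x • ((C (C u) : O[X][X]) ^ (x.1 : ℕ) * C (C v) ^ (x.2.1 : ℕ) *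
        C (mr p u) ^ (x.2.2.1 : ℕ) * X ^ (x.2.2.2.1 : ℕ) * C X ^ (x.2.2.2.2 : ℕ))) (j : ℕ) =
        if j = x.2.2.2.1 then mr p u ^ (x.2.2.1 : ℕ) * (C (F x • (u ^ (x.1 : ℕ) * v ^ (x.2.1 : ℕ))) *
          X ^ (x.2.2.2.2 : ℕ)) else 0 := by
      intro x
      have e : ((C (C u) : O[X][X]) ^ (x.1 : ℕ) * C (C v) ^ (x.2.1 : ℕ) *
        C (mr p u) ^ (x.2.2.1 : ℕ) * X ^ (x.2.2.2.1 : ℕ) * C X ^ (x.2.2.2.2 : ℕ)) =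
        C (C (u ^ (x.1 : ℕ) * v ^ (x.2.1 : ℕ)) * mr p u ^ (x.2.2.1 : ℕ) * X ^ (x.2.2.2.2 : ℕ)) *
          X ^ (x.2.2.2.1 : ℕ) := by
        simp only [map_mul, map_pow]; ring
      rw [e, coeff_smul, coeff_C_mul, coeff_X_pow]
      by_cases hjx : j = x.2.2.2.1
      · rw [if_pos hjx, if_pos (by rw [hjx]), mul_one, ← smul_C, smul_mul_assoc, mul_smul_comm]
        congr 1; ring
      · rw [if_neg hjx, if_neg (fun e => hjx (Fin.ext e)), mul_zero, smul_zero]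
    rw [Finset.sum_congr rfl fun x _ => ht x] at h1
    simp only [Fintype.sum_prod_type, Finset.sum_ite_eq, Finset.sum_ite_irrel, Finset.sum_const_zero,
      Finset.mem_univ, if_true] at h1
    rw [← h1]
    simp only [c, map_sum, Finset.sum_mul, Finset.mul_sum]
    symm
    calc _ = ∑ α : Fin n1, ∑ α' : Fin n2, ∑ i : Fin d, ∑ l : Fin p, mr p u ^ (α' : ℕ) *
          (C (F (α, i, α', j, l) • (u ^ (α : ℕ) * v ^ (i : ℕ))) * X ^ (l : ℕ)) :=
          Finset.sum_congr rfl fun _ _ => Finset.sum_comm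
      _ = ∑ α' : Fin n2, ∑ α : Fin n1, ∑ i : Fin d, ∑ l : Fin p, mr p u ^ (α' : ℕ) *
          (C (F (α, i, α', j, l) • (u ^ (α : ℕ) * v ^ (i : ℕ))) * X ^ (l : ℕ)) := Finset.sum_comm
      _ = ∑ α' : Fin n2, ∑ α : Fin n1, ∑ l : Fin p, ∑ i : Fin d, mr p u ^ (α' : ℕ) *
          (C (F (α, i, α', j, l) • (u ^ (α : ℕ) * v ^ (i : ℕ))) * X ^ (l : ℕ)) :=
          Finset.sum_congr rfl fun _ _ => Finset.sum_congr rfl fun _ _ => Finset.sum_comm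
      _ = _ := Finset.sum_congr rfl fun _ _ => Finset.sum_comm
  have hc : ∀ α' j l, c α' j l = 0 := by
    intro α' j l
    have h1 := indep_mr hmm hmd n2 (fun i => if hi : i < n2 then ∑ l : Fin p, C (c ⟨i, hi⟩ j l) * X ^ (l : ℕ) else 0)
      (by
        intro i
        split_ifs with hi
        · refine dsum_lt _ _ ?_
          intro l _
          exact (degree_C_mul_X_pow_le _ _).trans_lt (by exact_mod_cast l.2)
        · rw [degree_zero]; exact WithBot.bot_lt_coe p) (by
        rw [← Fin.sum_univ_eq_sum_range (fun i => mr p u ^ i * if hi : i < n2 then ∑ l : Fin p, C (c ⟨i, hi⟩ j l) * X ^ (l : ℕ) else 0)]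
        rw [← hj j]
        refine Finset.sum_congr rfl fun i _ => ?_
        rw [dif_pos i.2]) α' α'.2
    rw [dif_pos α'.2] at h1
    have h2 := congrArg (fun T => coeff T (l : ℕ)) h1
    simp only [finsetSum_coeff, coeff_C_mul, coeff_X_pow, coeff_zero, mul_ite, mul_one, mul_zero] at h2
    rw [Finset.sum_eq_single l] at h2
    · simpa using h2
    · intro b _ hb
      rw [if_neg]
      intro e; exact hb (Fin.ext e.symm)
    · simp
  funext ⟨α, i, α', j, l⟩
  let H : K[X][X] := ∑ i : Fin d, C (∑ α : Fin n1, C (F (α, i, α', j, l)) * X ^ (α : ℕ)) * X ^ (i : ℕ)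
  have hH0 : H = 0 := by
    apply no_rel hm hirr hdeg hu h0
    · refine dsum_lt _ _ ?_
      intro l _
      exact (degree_C_mul_X_pow_le _ _).trans_lt (by exact_mod_cast l.2)
    · rw [← hc α' j l]
      simp only [H, ev, c, eval₂_finsetSum, eval₂_mul, eval₂_C, eval₂_X_pow]
      rw [Finset.sum_comm]
      simp [Finset.sum_mul, Algebra.smul_def, mul_assoc]
  have h1 := congrArg (fun T => coeff (coeff T (i : ℕ)) (α : ℕ)) hH0
  simp only [H, finsetSum_coeff, coeff_C_mul, coeff_X_pow, coeff_zero, mul_ite, mul_one, mul_zero] at h1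
  rw [Finset.sum_eq_single i] at h1
  · simp only [if_true, finsetSum_coeff, coeff_C_mul, coeff_X_pow, mul_ite, mul_one, mul_zero] at h1
    rw [Finset.sum_eq_single α] at h1
    · simpa using h1
    · intro b _ hb
      rw [if_neg]
      intro e; exact hb (Fin.ext e.symm)
    · simp
  · intro b _ hb
    rw [if_neg]
    · simp
    intro e; exact hb (Fin.ext e.symm)
  · simp
end
end WS

namespace WS
section
variable {K : Type} [Field K]

noncomputable def disc' (Q : K[X][X]) (d : ℕ) : K[X] := resultant Q (derivative Q) d d

lemma deriv_deg {Q : K[X][X]} {d : ℕ} (hd : 1 ≤ d) (hdeg : Q.natDegree = d) :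
    (derivative Q).degree < d := by
  have h0 : Q ≠ 0 := by rintro rfl; simp at hdeg; omega
  have := degree_derivative_lt h0
  rwa [degree_eq_natDegree h0, hdeg] at this

lemma disc_ne {p : ℕ} [hp : Fact p.Prime] [CharP K p] {Q : K[X][X]} {d : ℕ} (hd : 1 ≤ d) (hm : Q.Monic)
    (hirr : Irreducible Q)
    (hdeg : Q.natDegree = d) (hdp : d < p) : disc' Q d ≠ 0 := by
  refine resultant_ne hm hirr hdeg ?_ (deriv_deg hd hdeg)
  intro h
  have h1 := congrArg (fun T => coeff T (d - 1)) h
  simp only [coeff_derivative, coeff_zero] at h1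
  have e : d - 1 + 1 = d := by omega
  have h2 : Q.coeff d = 1 := by rw [← hdeg]; exact hm
  have h3 : ((d - 1 : ℕ) : K[X]) + 1 = ((d : ℕ) : K[X]) := by
    rw [← Nat.cast_succ]; congr 1
  rw [e, h2, h3, one_mul] at h1
  have : ((d : ℕ) : K) = 0 := by
    have := congrArg (eval 0) h1
    simpa using this
  rw [CharP.cast_eq_zero_iff K p] at this
  exact absurd (Nat.le_of_dvd (by omega) this) (by omega)

lemma sep_roots {κ : Type} [Field κ] [IsAlgClosed κ] [Algebra K κ] {Q : K[X][X]} {d : ℕ} (hd : 1 ≤ d)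
    (hm : Q.Monic) (hdeg : Q.natDegree = d) (x : κ) (hx : aeval x (disc' Q d) ≠ 0) :
    ∃ R : Finset κ, R.card = d ∧ ∀ β ∈ R, ev Q x β = 0 := by
  classical
  set θ : K[X] →+* κ := (aeval x : K[X] →ₐ[K] κ).toRingHom with hθ
  have hfd : (Q.map θ).natDegree = d := by rw [hm.natDegree_map, hdeg]
  have hfm := hm.map θ
  have h1 : resultant (Q.map θ) (derivative (Q.map θ)) d d ≠ 0 := by
    rw [derivative_map, resultant_map_map]; exact hx
  obtain ⟨f, g, -, -, hfg⟩ := exists_mul_add_mul_eq_C_resultant (Q.map θ) (derivative (Q.map θ))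
    (m := d) (n := d) hfd.le ((natDegree_derivative_le _).trans (by omega)) (by omega)
  have hsep : (Q.map θ).Separable := by
    refine ⟨C (resultant (Q.map θ) (derivative (Q.map θ)) d d)⁻¹ * f,
      C (resultant (Q.map θ) (derivative (Q.map θ)) d d)⁻¹ * g, ?_⟩
    rw [mul_assoc, mul_assoc, ← mul_add, mul_comm f, mul_comm g, hfg, ← C_mul, inv_mul_cancel₀ h1, C_1]
  refine ⟨(Q.map θ).roots.toFinset, ?_, ?_⟩
  · rw [Multiset.toFinset_card_of_nodup (nodup_roots hsep), ← hfd]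
    exact IsAlgClosed.card_roots_eq_natDegree
  · intro β hβ
    rw [Multiset.mem_toFinset, mem_roots hfm.ne_zero, IsRoot, eval_map] at hβ
    exact hβ

theorem core_res {p : ℕ} [hp : Fact p.Prime] [CharP K p] {O : Type} [CommRing O] [IsDomain O]
    [Algebra K O] [IsIntegrallyClosed O[X]]
    (ε : O →ₐ[K] K) {Q : K[X][X]} {d : ℕ} (hm : Q.Monic) (hirr : Irreducible Q)
    (hdeg : Q.natDegree = d) (hdp : d < p) {u v : O} (hu : Transcendental K u)
    (h0 : ev Q u v = 0) {n1 n2 : ℕ} (F : Idx n1 n2 d p → K) (hF : F ≠ 0) :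
    resultant (Mr p Q u) (Fh F u v) d d ≠ 0 := by
  have hd : 0 < d := by
    rw [← hdeg]
    by_contra h00
    have : Q = 1 := hm.natDegree_eq_zero.1 (by omega)
    exact hirr.not_isUnit (this ▸ isUnit_one)
  apply resultant_ne (hm.map _)
  · apply Monic.irreducible_of_irreducible_map (mapRingHom ε.toRingHom) _ (hm.map _)
    change Irreducible ((Mr p Q u).map _)
    rw [Mr_map]
    exact irr_AS hm hirr (by omega) (ε u)
  · rw [hm.natDegree_map, hdeg]
  · exact fun h => hF (Fh_ne_zero hp.out.one_lt hm hirr hdeg hu h0 F h)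
  · refine dsum_lt _ _ ?_
    intro x _
    refine (degree_smul_le _ _).trans_lt ?_
    have e : ((C (C u) : O[X][X]) ^ (x.1 : ℕ) * C (C v) ^ (x.2.1 : ℕ) *
        C (mr p u) ^ (x.2.2.1 : ℕ) * X ^ (x.2.2.2.1 : ℕ) * C X ^ (x.2.2.2.2 : ℕ)) =
        C (C (u ^ (x.1 : ℕ) * v ^ (x.2.1 : ℕ)) * mr p u ^ (x.2.2.1 : ℕ) * X ^ (x.2.2.2.2 : ℕ)) *
          X ^ (x.2.2.2.1 : ℕ) := by
        simp only [map_mul, map_pow]; ring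
    rw [e]
    exact (degree_C_mul_X_pow_le _ _).trans_lt (by exact_mod_cast x.2.2.2.1.2)

lemma Mr_coeff_deg {p : ℕ} (hp : 1 < p) {κ : Type} [Field κ] [Algebra K κ] {Q : K[X][X]} {h w : ℕ}
    (hQ : Wt h w Q) (u : κ) (i : ℕ) : ((Mr p Q u).coeff i).natDegree ≤ p * w := by
  rw [Mr, coeff_map]
  change (aeval (mr p u) (Q.coeff i)).natDegree ≤ _
  rw [aeval_eq_sum_range]
  refine natDegree_sum_le_of_forall_le _ _ ?_
  intro j hj
  have hj' := (Finset.mem_range_succ_iff.1 hj).trans (Wt_coeff hQ i)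
  refine (natDegree_smul_le _ _).trans ?_
  refine natDegree_pow_le.trans ?_
  rw [(mr_monic hp u).2, mul_comm]
  exact Nat.mul_le_mul_left _ hj'

lemma Fh_coeff_deg {p : ℕ} (hp : 1 < p) {κ : Type} [Field κ] [Algebra K κ] {n1 n2 d : ℕ}
    (F : Idx n1 n2 d p → K) (u v : κ) (i : ℕ) : ((Fh F u v).coeff i).natDegree ≤ p * n2 + p := by
  rw [Fh, evF, finsetSum_coeff]
  refine natDegree_sum_le_of_forall_le _ _ ?_
  intro x _
  have e : ((C (C u) : κ[X][X]) ^ (x.1 : ℕ) * C (C v) ^ (x.2.1 : ℕ) *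
        C (mr p u) ^ (x.2.2.1 : ℕ) * X ^ (x.2.2.2.1 : ℕ) * C X ^ (x.2.2.2.2 : ℕ)) =
        C (C (u ^ (x.1 : ℕ) * v ^ (x.2.1 : ℕ)) * mr p u ^ (x.2.2.1 : ℕ) * X ^ (x.2.2.2.2 : ℕ)) *
          X ^ (x.2.2.2.1 : ℕ) := by
        simp only [map_mul, map_pow]; ring
  rw [e, coeff_smul, coeff_C_mul, coeff_X_pow]
  refine (natDegree_smul_le _ _).trans ?_
  split_ifs
  · rw [mul_one]
    refine natDegree_mul_le.trans (Nat.add_le_add ?_ ?_)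
    · refine natDegree_C_mul_le _ _ |>.trans (natDegree_pow_le.trans ?_)
      rw [(mr_monic hp u).2, mul_comm]
      exact Nat.mul_le_mul_left _ x.2.2.1.2.le
    · rw [natDegree_X_pow]; exact x.2.2.2.2.2.le
  · simp
end
end WS

namespace WS
section
variable {K : Type} [Field K] {p : ℕ} [hp : Fact p.Prime] [CharP K p]

lemma psUnit {κ : Type} [Field κ] (z : PowerSeries κ) (h : PowerSeries.constantCoeff z ≠ 0) : IsUnit z :=
  PowerSeries.isUnit_iff_constantCoeff.2 (isUnit_iff_ne_zero.2 h)

lemma psMem {κ : Type} [Field κ] {l : ℕ} {z : PowerSeries κ} :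
    z ∈ Ideal.span {(PowerSeries.X : PowerSeries κ) ^ l} ↔ PowerSeries.X ^ l ∣ z :=
  Ideal.mem_span_singleton

/-- transfer of vanishing between approximate roots in a power series ring -/
lemma transfer {κ : Type} [Field κ] [Algebra K κ] {n1 n2 d : ℕ} (F : Idx n1 n2 d p → K) (Q : K[X][X])
    {l : ℕ} {u v x' y y0 r : PowerSeries κ} (h1 : ev Q x' y0 = 0) (h2 : PowerSeries.X ^ l ∣ ev Q x' y)
    (hy : PowerSeries.constantCoeff y = PowerSeries.constantCoeff y0)
    (hD : PowerSeries.constantCoeff (ev (derivative Q) x' y) ≠ 0)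
    (hF : PowerSeries.X ^ l ∣ evF F u v x' y r) : PowerSeries.X ^ l ∣ evF F u v x' y0 r := by
  have hc := cmp_roots PowerSeries.constantCoeff psUnit (Ideal.span {(PowerSeries.X : PowerSeries κ) ^ l}) Q
    (psMem.2 h2) (h1 ▸ Submodule.zero_mem _) hy hD
  have h3 := evF_congr _ F (u := u) (v := v) (u' := x') (r := r) hc
  rw [psMem] at h3
  exact (dvd_sub_right hF).1 h3

lemma Rs_sub_nat {κ : Type} [Field κ] [Algebra K κ] {a : ℕ} (u : κ) (c : K) (hc : c ^ p = c) :
    (Rs p a u - algebraMap K κ c) ^ p - (Rs p a u - algebraMap K κ c) = u ^ p ^ a - u := by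
  rw [fr_sub (K := K), ← map_pow, hc, ← Rs_fr (K := K)]; ring

lemma nat_fr (c : ℕ) : ((c : K)) ^ p = c := by
  rw [← frobenius_def]; exact map_natCast (frobenius K p) _

lemma evdC {κ : Type} [Field κ] [Algebra K κ] (T : K[X][X]) (x y : κ) :
    ev T (PowerSeries.C x) (PowerSeries.C y) = PowerSeries.C (ev T x y) :=
  (ev_map (psC K κ) T x y).symm

lemma trans_pow {κ : Type} [Field κ] [Algebra K κ] {u : κ} (hu : Transcendental K u) {q : ℕ} (hq : 1 < q) :
    u ^ q - u ≠ 0 := by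
  intro h
  have h1 := (transcendental_iff.1 hu) (X ^ q - X) (by simpa using h)
  exact FiniteField.X_pow_card_sub_X_ne_zero K hq h1

open Classical in
theorem mu_sum {a : ℕ} [Fintype K] (ha : 1 ≤ a) (hq : Fintype.card K = p ^ a)
    {h d : ℕ} 
    (hd : 1 ≤ d) {Q : K[X][X]} (hQ : Wt h (h * d) Q) (hm : Q.Monic) (hirr : Irreducible Q)
    (hdeg : Q.natDegree = d) (hdp : d < p)
    {A : Type} [CommRing A] [Algebra K A] {u v : A}
    (huniv : ∀ (B : Type) [CommRing B] [Algebra K B] (x y : B), ev Q x y = 0 →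
        ∃ φ : A →ₐ[K] B, φ u = x ∧ φ v = y)
    {n1 n2 : ℕ} (F : Idx n1 n2 d p → K) (N : ℕ) (al : Fin p → ℤ)
    (hF : ∀ b : Fin p, (0 ≤ al b → VanP Q F N ((b : ℕ) : K) (al b).natAbs) ∧
      (al b < 0 → VanM Q F N ((b : ℕ) : K) (al b).natAbs))
    (hN : ∀ b, (al b).natAbs ≤ N)
    (Ψ : Fin p → A[X])
    (hΨ : ∀ (c : Fin p) (B : Type) [CommRing B] [Algebra K B] (φ : A →ₐ[K] B) (σ : B), ∃ w : B, ∀ r : B,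
        r = Rs p a (φ u) - algebraMap K B ((c : ℕ) : K) +
          (ev (derivative Q) (φ u ^ p ^ a) (φ v ^ p ^ a)) ^ 2 * σ →
        σ ^ N ∣ ev Q (φ u + r ^ p - r) (φ v ^ p ^ a + σ * w) ∧
        evp φ σ (Ψ c) = evF F (φ u) (φ v) (φ u + r ^ p - r) (φ v ^ p ^ a + σ * w) r)
    (m : Fin p → ℕ) (hmN : ∀ c, m c ≤ N) (hmΨ : ∀ c, X ^ (m c) ∣ Ψ c)
    {κ : Type} [Field κ] [IsAlgClosed κ] [Algebra K κ] (x v0 : κ) (hx : Transcendental K x)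
    (hv0 : ev Q x v0 = 0) (hres : resultant (Mr p Q x) (Fh F x v0) d d ≠ 0) :
    ∑ b : Fin p, (al b).natAbs * kk d (al b) + ∑ c, m c ≤ d * (p * n2 + p) + d * (p * (h * d)) := by
  have hp1 := hp.out.one_lt
  have hq1 : 1 < p ^ a := Nat.one_lt_pow (by omega) hp1
  obtain ⟨R, hRc, hRr⟩ := sep_roots hd hm hdeg x (fun h => disc_ne hd hm hirr hdeg hdp ((transcendental_iff.1 hx) _ h))
  have hQm := bc_monic κ hm
  have hQd : (bc κ Q).natDegree = d := by rw [bc_natDegree κ hm, hdeg]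
  have hsimp : ∀ β, ev Q x β = 0 → β ∈ R ∧ ev (derivative Q) x β ≠ 0 := by
    intro β hβ
    have := simple_of_card hQm x R (by rw [hRc, hQd]) (fun β hβ => by rw [ev_bc]; exact hRr β hβ)
      (β := β) (by rw [ev_bc]; exact hβ)
    rwa [bc_derivative, ev_bc] at this
  have hMm : (Mr p Q x).Monic := hm.map _
  have hMd : (Mr p Q x).natDegree = d := by rw [Mr, hm.natDegree_map, hdeg]
  have hFd : (Fh F x v0).natDegree ≤ d := by
    refine natDegree_sum_le_of_forall_le _ _ ?_
    intro y _
    refine (natDegree_smul_le _ _).trans ?_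
    have e : ((C (C x) : κ[X][X]) ^ (y.1 : ℕ) * C (C v0) ^ (y.2.1 : ℕ) *
        C (mr p x) ^ (y.2.2.1 : ℕ) * X ^ (y.2.2.2.1 : ℕ) * C X ^ (y.2.2.2.2 : ℕ)) =
        C (C (x ^ (y.1 : ℕ) * v0 ^ (y.2.1 : ℕ)) * mr p x ^ (y.2.2.1 : ℕ) * X ^ (y.2.2.2.2 : ℕ)) *
          X ^ (y.2.2.2.1 : ℕ) := by
        simp only [map_mul, map_pow]; ring
    rw [e]
    exact (natDegree_C_mul_X_pow_le _ _).trans y.2.2.2.1.2.le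
  have hdegr := resultant_natDegree_le (Mr p Q x) (Fh F x v0) (Mr_coeff_deg hp1 hQ x)
    (Fh_coeff_deg hp1 F x v0) (d := d) (d' := d)
  have hev0 : ∀ (x0 β : κ), ((Mr p Q x).map (evalRingHom x0)).eval β = ev Q (x + x0 ^ p - x0) β := by
    intro x0 β
    rw [eval_map_ev, ev_Mr]; rfl
  have halg : ∀ z : κ, algebraMap κ (PowerSeries κ) z = PowerSeries.C z := fun z => by
    rw [PowerSeries.algebraMap_apply]; rfl
  -- the points
  let pt : Fin p ⊕ Fin p → κ := Sum.elim (fun b => ((b : ℕ) : κ))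
    (fun c => Rs p a x - algebraMap K κ ((c : ℕ) : K))
  let o : Fin p ⊕ Fin p → ℕ := Sum.elim (fun b => (al b).natAbs * kk d (al b)) m
  have : CharP κ p := charP_alg K p κ
  have hcast : ∀ b c : Fin p, ((b : ℕ) : κ) = ((c : ℕ) : κ) → b = c := by
    intro b c hbc
    have := (CharP.natCast_eq_natCast κ p).1 hbc
    rw [Nat.ModEq, Nat.mod_eq_of_lt b.2, Nat.mod_eq_of_lt c.2] at this
    exact Fin.ext this
  have hnf : ∀ b : ℕ, ((b : κ)) ^ p = b := fun b => nat_fr b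
  have hcross : ∀ b c : ℕ, (b : κ) ≠ Rs p a x - algebraMap K κ ((c : ℕ) : K) := by
    intro b c hbc
    have h1 := Rs_sub_nat (a := a) x ((c : ℕ) : K) (nat_fr c)
    rw [← hbc, hnf, sub_self] at h1
    exact trans_pow hx hq1 h1.symm
  have hinj : Set.InjOn pt (Finset.univ : Finset (Fin p ⊕ Fin p)) := by
    rintro (b | b) _ (c | c) _ hbc
    · rw [hcast b c hbc]
    · exact absurd hbc (hcross _ _)
    · exact absurd hbc.symm (hcross _ _)
    · simp only [pt, Sum.elim_inr, sub_right_inj, map_natCast] at hbc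
      rw [hcast b c hbc]
  have key := sum_orders_le _ hres Finset.univ pt hinj o ?_
  · rw [Fintype.sum_sum_type] at key
    exact key.trans hdegr
  rintro (b | c) -
  · -- the diagonal points
    simp only [pt, o, Sum.elim_inl]
    have hxb : x + ((b : ℕ) : κ) ^ p - ((b : ℕ) : κ) = x := by rw [hnf]; ring
    have hsum : (al b).natAbs * kk d (al b) = ∑ β ∈ R, (if (0 ≤ al b ↔ β = v0) then (al b).natAbs else 0) := by
      have hv0R := (hsimp v0 hv0).1
      by_cases h0 : 0 ≤ al b
      · simp [h0, kk, hv0R]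
      · simp only [h0, kk, false_iff, if_false]
        rw [← Finset.sum_filter, Finset.sum_const, Finset.filter_ne', Finset.card_erase_of_mem hv0R, hRc,
          smul_eq_mul, mul_comm]
    rw [hsum]
    refine local_order _ _ hMm hMd hFd _ R hRc (fun β hβ => by rw [hev0, hxb]; exact hRr β hβ)
      (fun β => if (0 ≤ al b ↔ β = v0) then (al b).natAbs else 0) ?_
    intro β hβ y hyβ hy
    split_ifs with hmatch
    swap
    · simp
    have hz : (shf ((b : ℕ) : κ)) ^ p - shf ((b : ℕ) : κ) = PowerSeries.X ^ p - PowerSeries.X := by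
      rw [shf, fr_add (K := K), ← map_pow, hnf]; ring
    have hz' : PowerSeries.C x + (shf ((b : ℕ) : κ)) ^ p - shf ((b : ℕ) : κ) =
        PowerSeries.C x + PowerSeries.X ^ p - PowerSeries.X := by linear_combination hz
    rw [ev_Mr, halg, hz'] at hy
    rw [ev_Fh, halg, halg, hz']
    have hβQ := hRr β hβ
    have hs := (hsimp β hβQ).2
    obtain ⟨w, hw1, hw2⟩ : ∃ w, PowerSeries.X ^ N ∣ ev Q (PowerSeries.C x + PowerSeries.X ^ p - PowerSeries.X)
        (PowerSeries.C β + PowerSeries.X * w) ∧ PowerSeries.X ^ (al b).natAbs ∣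
          evF F (PowerSeries.C x) (PowerSeries.C v0) (PowerSeries.C x + PowerSeries.X ^ p - PowerSeries.X)
          (PowerSeries.C β + PowerSeries.X * w) (algebraMap K (PowerSeries κ) ((b : ℕ) : K) + PowerSeries.X) := by
      rcases le_or_gt 0 (al b) with h0 | h0
      · have hβv := hmatch.1 h0
        subst hβv
        exact (hF b).1 h0 (PowerSeries κ) (PowerSeries.C x) (PowerSeries.C β) (by rw [evdC, hβQ, map_zero])
          (by rw [evdC]; exact (isUnit_iff_ne_zero.2 hs).map _) PowerSeries.X
      · exact (hF b).2 h0 (PowerSeries κ) (PowerSeries.C x) (PowerSeries.C v0) (PowerSeries.C β)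
          (by rw [evdC, hv0, map_zero]) (by rw [evdC, hβQ, map_zero])
          (fun e => absurd (hmatch.2 (PowerSeries.C_injective e)) (by omega))
          (by rw [evdC]; exact (isUnit_iff_ne_zero.2 hs).map _) PowerSeries.X
    have hsh : algebraMap K (PowerSeries κ) ((b : ℕ) : K) + PowerSeries.X = shf ((b : ℕ) : κ) := by
      rw [shf, map_natCast, map_natCast]
    rw [hsh] at hw2
    refine transfer F Q hy ((pow_dvd_pow _ (hN b)).trans hw1) (by simp [hyβ]) ?_ hw2
    rw [ev_congr_hom PowerSeries.constantCoeff (derivative Q) (x' := PowerSeries.C x) (y' := PowerSeries.C β)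
      (by simp [hp.out.ne_zero]) (by simp), evdC, PowerSeries.constantCoeff_C]
    exact hs
  · -- the graph points
    simp only [pt, o, Sum.elim_inr]
    set r0 := Rs p a x - algebraMap K κ ((c : ℕ) : K) with hr0
    have hxb : x + r0 ^ p - r0 = x ^ p ^ a := by
      have := Rs_sub_nat (a := a) x ((c : ℕ) : K) (nat_fr c)
      rw [← hr0] at this
      linear_combination this
    have hpow : ∀ β, ev Q x β = 0 → ev Q (x ^ p ^ a) (β ^ p ^ a) = 0 := by
      intro β hβ
      have h1 := ev_pow_card Q x β
      rw [hβ, zero_pow Fintype.card_ne_zero, hq] at h1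
      exact h1
    set D := ev (derivative Q) (x ^ p ^ a) (v0 ^ p ^ a) with hD
    have hD0 : D ≠ 0 := by
      have h1 := ev_pow_card (derivative Q) x v0
      rw [hq] at h1
      rw [hD, h1]
      exact pow_ne_zero _ (hsimp v0 hv0).2
    have hfi : Function.Injective (fun β : κ => β ^ p ^ a) := by
      intro β γ hβγ
      exact iterateFrobenius_inj κ p a (by simpa [iterateFrobenius_def] using hβγ)
    have hRc' : (R.image (fun β : κ => β ^ p ^ a)).card = d := by
      rw [Finset.card_image_of_injective _ hfi, hRc]
    have hsum : m c = ∑ β ∈ R.image (fun β : κ => β ^ p ^ a), (if β = v0 ^ p ^ a then m c else 0) := by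
      rw [Finset.sum_ite_eq', if_pos (Finset.mem_image_of_mem _ (hsimp v0 hv0).1)]
    rw [hsum]
    refine local_order _ _ hMm hMd hFd _ _ hRc' (fun β hβ => by
        rw [hev0, hxb]
        obtain ⟨γ, hγ, rfl⟩ := Finset.mem_image.1 hβ
        exact hpow γ (hRr γ hγ)) (fun β => if β = v0 ^ p ^ a then m c else 0) ?_
    intro β hβ y hyβ hy
    split_ifs with hmatch
    swap
    · simp
    subst hmatch
    rw [ev_Mr, halg] at hy
    rw [ev_Fh, halg, halg]
    obtain ⟨φ, hφu, hφv⟩ := huniv (PowerSeries κ) (PowerSeries.C x) (PowerSeries.C v0) (by rw [evdC, hv0, map_zero])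
    set σ : PowerSeries κ := PowerSeries.C (D ^ 2)⁻¹ * PowerSeries.X with hσ
    obtain ⟨w, hw⟩ := hΨ c (PowerSeries κ) φ σ
    have hσX : ∀ n, (PowerSeries.X : PowerSeries κ) ^ n ∣ σ ^ n := fun n =>
      pow_dvd_pow_of_dvd (Dvd.intro_left _ rfl) n
    obtain ⟨hw1, hw2⟩ := hw (shf r0) (by
      rw [hφu, hφv, ← map_pow, ← map_pow, evdC, ← hD, hσ, ← mul_assoc, ← map_pow, ← map_mul,
        mul_inv_cancel₀ (pow_ne_zero _ hD0), map_one, one_mul, shf, hr0, map_sub]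
      congr 2
      · exact Rs_map (K := K) (psC K κ) a x
      · simp)
    rw [hφu, hφv] at hw1 hw2
    have hdv : PowerSeries.X ^ m c ∣ evp φ σ (Ψ c) := by
      obtain ⟨G, hG⟩ := hmΨ c
      rw [hG, map_mul, map_pow, evp_X]
      exact (hσX _).trans (Dvd.intro _ rfl)
    rw [hw2] at hdv
    refine transfer F Q hy (((pow_dvd_pow _ (hmN c)).trans (hσX N)).trans hw1) (by simp [hyβ, hσ]) ?_ hdv
    rw [ev_congr_hom PowerSeries.constantCoeff (derivative Q) (x' := PowerSeries.C (x ^ p ^ a))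
      (y' := PowerSeries.C (v0 ^ p ^ a))
      (by simp [shf, hxb]) (by simp [hσ]), evdC, PowerSeries.constantCoeff_C]
    exact hD0
end
end WS

namespace WS
section
variable {K : Type} [Field K] {p : ℕ} [hp : Fact p.Prime] [CharP K p]

lemma shf_trans (a0 : K) : Transcendental K (shf a0) := by
  rw [transcendental_iff]
  intro f hf
  rw [shf_aeval, Polynomial.coe_eq_zero_iff] at hf
  have := congrArg (fun g => g.comp (X - C a0)) hf
  simpa [comp_assoc] using this

theorem exists_gen {Q : K[X][X]} {d : ℕ} (hm : Q.Monic)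
    (hirr : Irreducible Q) (hdeg : Q.natDegree = d) (hdp : d < p) (a0 β0 : K) (h0 : ev Q a0 β0 = 0)
    (h1 : ev (derivative Q) a0 β0 ≠ 0) : ∃ (κ : Type) (_ : Field κ) (_ : IsAlgClosed κ) (_ : Algebra K κ)
      (x v0 : κ), Transcendental K x ∧ ev Q x v0 = 0 ∧ ∀ {n1 n2 : ℕ} (F : Idx n1 n2 d p → K), F ≠ 0 →
        resultant (Mr p Q x) (Fh F x v0) d d ≠ 0 := by
  obtain ⟨v, hv, hvc⟩ := lift_root hm a0 β0 h0 h1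
  let κ := AlgebraicClosure (FractionRing (PowerSeries K))
  let ι : PowerSeries K →ₐ[K] κ := (IsScalarTower.toAlgHom K (FractionRing (PowerSeries K)) κ).comp
    (IsScalarTower.toAlgHom K (PowerSeries K) (FractionRing (PowerSeries K)))
  have hι : Function.Injective ι := by
    have := Function.Injective.comp (algebraMap (FractionRing (PowerSeries K)) κ).injective
      (IsFractionRing.injective (PowerSeries K) (FractionRing (PowerSeries K)))
    exact this
  refine ⟨κ, inferInstance, inferInstance, inferInstance, ι (shf a0), ι v, ?_, ?_, ?_⟩
  · rw [transcendental_iff]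
    intro f hf
    rw [aeval_algHom_apply] at hf
    exact (transcendental_iff.1 (shf_trans a0)) f ((map_eq_zero_iff ι hι).1 hf)
  · rw [← ev_map, hv, map_zero]
  · intro n1 n2 F hF
    let ε : PowerSeries K →ₐ[K] K := { PowerSeries.constantCoeff (R := K) with
      commutes' := fun r => by simp [PowerSeries.algebraMap_apply] }
    have := core_res (p := p) ε hm hirr hdeg hdp (shf_trans a0) hv F hF
    rw [← Mr_map, ← Fh_map, resultant_map_map]
    have hinj : Function.Injective (mapRingHom ι.toRingHom) :=
      Polynomial.map_injective _ hι
    exact (map_ne_zero_iff _ hinj).2 this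

open Classical in
theorem stepA {a : ℕ} [Fintype K] (ha : 1 ≤ a) (hq : Fintype.card K = p ^ a)
    {h d : ℕ} (hh : 1 ≤ h)
    (hd : 1 ≤ d) {Q : K[X][X]} (hQ : Wt h (h * d) Q) (hm : Q.Monic) (hirr : Irreducible Q)
    (hdeg : Q.natDegree = d) (hdp : d < p) (a0 β0 : K) (h0 : ev Q a0 β0 = 0)
    (h1 : ev (derivative Q) a0 β0 ≠ 0) (n1 n2 : ℕ) (al : Fin p → ℤ)
    (hcount : ∑ b, ∑ n ∈ Finset.range (al b).natAbs,
      d * kk d (al b) * (n1 + n2 + 2 * (h * d) + 2 * (h * d) * n + 1) < n1 * d * n2 * d * p) :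
    ∃ m : Fin p → ℕ,
      ∑ b : Fin p, (al b).natAbs * kk d (al b) + ∑ c, m c ≤ d * (p * n2 + p) + d * (p * (h * d)) ∧
      ∀ (c : Fin p) (bb : K → Fin p) (_ : ∀ x, ((bb x : ℕ) : K) = Rs p a x - ((c : ℕ) : K))
        (κ : Type) [Field κ] [Algebra K κ] (Gd : Finset K) (R : K → Finset κ)
        (_ : ∀ x ∈ Gd, (R x).card = d) (_ : ∀ x ∈ Gd, ∀ β ∈ R x, ev Q (algebraMap K κ x) β = 0),
        ∑ x ∈ Gd, ∑ β ∈ R x, (if (0 ≤ al (bb x) ↔ β ^ p ^ a = β) then (al (bb x)).natAbs - m c else 0) ≤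
          d * (n1 + h * d + p ^ a * (n2 + h * d) + p ^ a + 2 * (h * d) * p ^ a * m c) + d * (h * d) := by
  set T := d * (p * n2 + p) + d * (p * (h * d)) with hT
  set N := T + ∑ b, (al b).natAbs + 1 with hN
  have hNb : ∀ b, (al b).natAbs ≤ N := fun b => by
    have := Finset.single_le_sum (f := fun b => (al b).natAbs) (fun _ _ => Nat.zero_le _) (Finset.mem_univ b)
    omega
  obtain ⟨F, hF0, hF⟩ := exists_F hh hd hp.out.two_le hQ hm hdeg N n1 n2 al hcount
  obtain ⟨A, _, _, u, v, huv, huniv⟩ := ringD Q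
  have hΨ := fun c : Fin p => gamma_exp ha hq hh hd hQ huv F N ((c : ℕ) : K) (nat_fr c)
  choose Ψ hΨm hΨ using hΨ
  obtain ⟨κ, _, _, _, x, v0, hx, hv0, hres⟩ := exists_gen hm hirr hdeg hdp a0 β0 h0 h1
  let m : Fin p → ℕ := fun c => if Ψ c = 0 then N else min N (Ψ c).natTrailingDegree
  have hsum := mu_sum ha hq hd hQ hm hirr hdeg hdp huniv F N al hF hNb Ψ hΨ m (by
    intro c
    simp only [m]
    split_ifs
    · exact le_rfl
    · exact min_le_left _ _) (by
    intro c
    simp only [m]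
    split_ifs with hc
    · rw [hc]; exact dvd_zero _
    · rw [X_pow_dvd_iff]
      intro n hn
      exact coeff_eq_zero_of_lt_natTrailingDegree (lt_of_lt_of_le hn (min_le_right _ _))) x v0 hx hv0 (hres F hF0)
  refine ⟨m, hsum, ?_⟩
  intro c bb hbb κ _ _ Gd R hR hRr
  have hmc : m c < N := by
    have := Finset.single_le_sum (f := m) (fun _ _ => Nat.zero_le _) (Finset.mem_univ c)
    omega
  have hc0 : (Ψ c).coeff (m c) ≠ 0 := by
    by_cases hc : Ψ c = 0
    · simp [m, hc] at hmc
    · have e : m c = (Ψ c).natTrailingDegree := by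
        simp only [m, hc, if_false] at hmc ⊢
        omega
      rw [e]
      exact (trailingCoeff_nonzero_iff_nonzero).2 hc
  exact zero_count ha hq hh hd hQ hm hirr hdeg huv huniv F N al hF hNb ((c : ℕ) : K) (nat_fr c) bb hbb
    (Ψ c) _ (hΨm c) (hΨ c) Gd R hR hRr (m c) hmc hc0
end
end WS

namespace WS
section
variable {K : Type} [Field K]

lemma fix_iff [Fintype K] {κ : Type} [Field κ] [Algebra K κ] (β : κ) :
    β ^ Fintype.card K = β ↔ ∃ y : K, algebraMap K κ y = β := by
  constructor
  · intro h
    have h1 := FiniteField.roots_X_pow_card_sub_X K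
    have hne : (X ^ Fintype.card K - X : K[X]) ≠ 0 := FiniteField.X_pow_card_sub_X_ne_zero K Fintype.one_lt_card
    have h2 := Polynomial.roots_map_of_injective_of_card_eq_natDegree (p := (X ^ Fintype.card K - X : K[X]))
      (algebraMap K κ).injective (by
        rw [h1, FiniteField.X_pow_card_sub_X_natDegree_eq K Fintype.one_lt_card]; simp)
    have h3 : β ∈ ((X ^ Fintype.card K - X : K[X]).map (algebraMap K κ)).roots := by
      rw [mem_roots ((Polynomial.map_ne_zero_iff (algebraMap K κ).injective).2 hne)]
      simp [h]
    rw [← h2] at h3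
    obtain ⟨y, -, hy⟩ := Multiset.mem_map.1 h3
    exact ⟨y, hy⟩
  · rintro ⟨y, rfl⟩
    rw [← map_pow, FiniteField.pow_card]

open Classical in
noncomputable def nn [Fintype K] (Q : K[X][X]) (x : K) : ℕ :=
  (Finset.univ.filter fun y : K => ev Q x y = 0).card

lemma ev_self (Q : K[X][X]) (x y : K) : ev Q x y = (Q.map (evalRingHom x)).eval y :=
  (eval_map_ev Q x y).symm

lemma card_roots_le (K : Type) [Field K] [Fintype K] [DecidableEq K] {f : K[X]} (hf : f ≠ 0) :
    (Finset.univ.filter fun y : K => f.eval y = 0).card ≤ f.natDegree := by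
  refine le_trans ?_ (card_roots' f)
  refine le_trans (Finset.card_le_card (t := f.roots.toFinset) ?_) (Multiset.toFinset_card_le _)
  intro y hy
  rw [Multiset.mem_toFinset, mem_roots hf]
  exact (Finset.mem_filter.1 hy).2

lemma nn_le [Fintype K] {Q : K[X][X]} (hm : Q.Monic) (x : K) : nn Q x ≤ Q.natDegree := by
  classical
  rw [nn]
  have := card_roots_le K (f := Q.map (evalRingHom x)) (hm.map _).ne_zero
  rw [hm.natDegree_map] at this
  refine le_trans (le_of_eq ?_) this
  congr 1
  ext y
  simp [ev_self]

open Classical in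
lemma cnt_fix [Fintype K] {Q : K[X][X]} (hm : Q.Monic) {κ : Type} [Field κ] [Algebra K κ] (x : K) (R : Finset κ)
    (hR : R.card = Q.natDegree) (hRr : ∀ β ∈ R, ev Q (algebraMap K κ x) β = 0) :
    (R.filter fun β => β ^ Fintype.card K = β).card = nn Q x := by
  rw [nn]
  symm
  refine Finset.card_bij (fun y _ => algebraMap K κ y) ?_ ?_ ?_
  · intro y hy
    rw [Finset.mem_filter, fix_iff]
    refine ⟨?_, y, rfl⟩
    refine (simple_of_card (bc_monic κ hm) (algebraMap K κ x) R (by rw [hR, bc_natDegree κ hm])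
      (fun β hβ => by rw [ev_bc]; exact hRr β hβ) ?_).1
    rw [ev_bc]
    have := ev_map (Algebra.ofId K κ) Q x y
    rw [(Finset.mem_filter.1 hy).2, map_zero] at this
    exact this.symm
  · intro y _ z _ h
    exact (algebraMap K κ).injective h
  · intro β hβ
    obtain ⟨h1, h2⟩ := Finset.mem_filter.1 hβ
    obtain ⟨y, rfl⟩ := (fix_iff β).1 h2
    refine ⟨y, ?_, rfl⟩
    rw [Finset.mem_filter]
    refine ⟨Finset.mem_univ _, ?_⟩
    have h3 := hRr _ h1
    have := ev_map (Algebra.ofId K κ) Q x y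
    rw [show ev Q ((Algebra.ofId K κ) x) ((Algebra.ofId K κ) y) = 0 from h3] at this
    exact (algebraMap K κ).injective (by rw [map_zero]; exact this)

lemma disc_deg {Q : K[X][X]} {h d : ℕ} (hQ : Wt h (h * d) Q) :
    (disc' Q d).natDegree ≤ 2 * (d * (h * d)) := by
  have := resultant_natDegree_le Q (derivative Q) (d := d) (d' := d) (n := h * d) (e := h * d)
    (fun i => Wt_coeff hQ i) (fun i => ?_)
  · rw [disc']; omega
  · rw [coeff_derivative]
    refine natDegree_mul_le.trans ?_
    have : ((i : K[X]) + 1).natDegree = 0 := by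
      rw [← Nat.cast_succ]; exact natDegree_natCast _
    rw [this]; exact Wt_coeff hQ _

/-- the pointwise identity -/
lemma pt_ident (d n : ℕ) (hn : n ≤ d) (hd : 1 ≤ d) (g : ℤ) :
    ((g.natAbs : ℤ)) * (if 0 ≤ g then (n : ℤ) else (d : ℤ) - n) = g * ((n : ℤ) - 1) + (g.natAbs * kk d g : ℕ) := by
  by_cases h : 0 ≤ g
  · simp only [h, kk, if_true]
    rw [Int.natAbs_of_nonneg h]; push_cast; rw [abs_of_nonneg h]; ring
  · simp only [h, kk, if_false]
    push_cast [Nat.cast_sub hd]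
    rw [abs_of_neg (by omega)]; ring

open Classical in
theorem stepB {p : ℕ} [hp : Fact p.Prime] [CharP K p] {a : ℕ} [Fintype K] (ha : 1 ≤ a) (hq : Fintype.card K = p ^ a)
    {h d : ℕ} (hh : 1 ≤ h)
    (hd : 1 ≤ d) {Q : K[X][X]} (hQ : Wt h (h * d) Q) (hm : Q.Monic) (hirr : Irreducible Q)
    (hdeg : Q.natDegree = d) (hdp : d < p) (a0 β0 : K) (h0 : ev Q a0 β0 = 0)
    (h1 : ev (derivative Q) a0 β0 ≠ 0) (n1 n2 : ℕ) (al : Fin p → ℤ) (L : ℕ) (hL : ∀ b, (al b).natAbs ≤ L)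
    (hcount : ∑ b, ∑ n ∈ Finset.range (al b).natAbs,
      d * kk d (al b) * (n1 + n2 + 2 * (h * d) + 2 * (h * d) * n + 1) < n1 * d * n2 * d * p) :
    ∃ m : Fin p → ℕ,
      ∑ b : Fin p, (al b).natAbs * kk d (al b) + ∑ c, m c ≤ d * (p * n2 + p) + d * (p * (h * d)) ∧
      ∀ (c : Fin p) (bb : K → Fin p) (_ : ∀ x, ((bb x : ℕ) : K) = Rs p a x - ((c : ℕ) : K)),
        ∑ x : K, (al (bb x) * ((nn Q x : ℤ) - 1) + ((al (bb x)).natAbs * kk d (al (bb x)) : ℕ)) ≤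
          ((d * (n1 + h * d + p ^ a * (n2 + h * d) + p ^ a + 2 * (h * d) * p ^ a * m c) + d * (h * d) +
            p ^ a * (d * m c) + 2 * (d * (h * d)) * (L * d) : ℕ) : ℤ) := by
  obtain ⟨m, hm1, hm2⟩ := stepA ha hq hh hd hQ hm hirr hdeg hdp a0 β0 h0 h1 n1 n2 al hcount
  refine ⟨m, hm1, ?_⟩
  intro c bb hbb
  let κ := AlgebraicClosure K
  let Gd : Finset K := Finset.univ.filter fun x => ¬ (disc' Q d).eval x = 0
  have hex : ∀ x : K, ∃ R : Finset κ, x ∈ Gd → R.card = d ∧ ∀ β ∈ R, ev Q (algebraMap K κ x) β = 0 := by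
    intro x
    by_cases hx : x ∈ Gd
    · obtain ⟨R, hR⟩ := sep_roots (κ := κ) hd hm hdeg (algebraMap K κ x) (by
        rw [aeval_algebraMap_apply, Ne, map_eq_zero]
        simpa [coe_aeval_eq_eval] using (Finset.mem_filter.1 hx).2)
      exact ⟨R, fun _ => hR⟩
    · exact ⟨∅, fun h => absurd h hx⟩
  choose R hR using hex
  have key := hm2 c bb hbb κ Gd R (fun x hx => (hR x hx).1) (fun x hx => (hR x hx).2)
  have hbad : (Finset.univ.filter fun x => (disc' Q d).eval x = 0).card ≤ 2 * (d * (h * d)) :=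
    (card_roots_le K (disc_ne hd hm hirr hdeg hdp)).trans (disc_deg hQ)
  have hnd : ∀ x, nn Q x ≤ d := fun x => hdeg ▸ nn_le hm x
  have hcard : Gd.card ≤ p ^ a := by
    rw [← hq]; exact Finset.card_le_univ _
  rw [Finset.sum_congr rfl fun x _ => (pt_ident d (nn Q x) (hnd x) hd (al (bb x))).symm,
    ← Finset.sum_filter_add_sum_filter_not Finset.univ (fun x => ¬ (disc' Q d).eval x = 0)]
  have hgood : ∑ x ∈ Gd, (((al (bb x)).natAbs : ℤ)) * (if 0 ≤ al (bb x) then (nn Q x : ℤ) else (d : ℤ) - nn Q x) ≤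
      ((d * (n1 + h * d + p ^ a * (n2 + h * d) + p ^ a + 2 * (h * d) * p ^ a * m c) + d * (h * d) +
            p ^ a * (d * m c) : ℕ) : ℤ) := by
    rw [Nat.cast_add _ (p ^ a * (d * m c))]
    have e1 : ∑ x ∈ Gd, (((al (bb x)).natAbs : ℤ)) * (if 0 ≤ al (bb x) then (nn Q x : ℤ) else (d : ℤ) - nn Q x) ≤
      ∑ x ∈ Gd, (((∑ β ∈ R x, (if (0 ≤ al (bb x) ↔ β ^ p ^ a = β) then (al (bb x)).natAbs - m c else 0) : ℕ) : ℤ)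
        + ((d * m c : ℕ) : ℤ)) := by
      refine Finset.sum_le_sum fun x hx => ?_
      have hc := cnt_fix hm x (R x) (by rw [(hR x hx).1, hdeg]) (hR x hx).2
      rw [hq] at hc
      have hcn : ((R x).filter fun β => ¬ (β ^ p ^ a = β)).card + nn Q x = d := by
        rw [← hc, add_comm, Finset.card_filter_add_card_filter_not, (hR x hx).1]
      rw [← Finset.sum_filter, Finset.sum_const, smul_eq_mul]
      have hnx := hnd x
      have hsub : ((al (bb x)).natAbs : ℤ) ≤ (((al (bb x)).natAbs - m c : ℕ) : ℤ) + m c := by omega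
      by_cases hs : 0 ≤ al (bb x)
      · simp only [hs, true_iff, if_true]
        rw [hc]
        push_cast
        push_cast at hsub
        have : ((nn Q x : ℤ)) * (m c) ≤ d * m c := by exact_mod_cast Nat.mul_le_mul_right _ hnx
        nlinarith [mul_le_mul_of_nonneg_left hsub (Int.natCast_nonneg (nn Q x))]
      · simp only [hs, false_iff, if_false]
        have hcn' : (d : ℤ) - nn Q x = (((R x).filter fun β => ¬ (β ^ p ^ a = β)).card : ℤ) := by
          rw [← hcn]; push_cast; ring
        rw [hcn']
        have hle : ((R x).filter fun β => ¬ (β ^ p ^ a = β)).card ≤ d := by omega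
        generalize ((R x).filter fun β => ¬ (β ^ p ^ a = β)).card = r at *
        have : (r : ℤ) * (m c) ≤ d * m c := by exact_mod_cast Nat.mul_le_mul_right _ hle
        push_cast
        push_cast at hsub
        nlinarith [mul_le_mul_of_nonneg_left hsub (Int.natCast_nonneg r)]
    refine e1.trans ?_
    rw [Finset.sum_add_distrib, ← Nat.cast_sum]
    refine add_le_add (by exact_mod_cast key) ?_
    rw [Finset.sum_const, nsmul_eq_mul]
    exact_mod_cast Nat.mul_le_mul_right _ hcard
  rw [Nat.cast_add _ (2 * (d * (h * d)) * (L * d))]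
  refine add_le_add hgood ?_
  refine (Finset.sum_le_card_nsmul _ _ ((L * d : ℕ) : ℤ) ?_).trans ?_
  · intro x _
    push_cast
    have h2 := hnd x
    have h3 := hL (bb x)
    have : (if 0 ≤ al (bb x) then (nn Q x : ℤ) else (d : ℤ) - nn Q x) ≤ d := by
      split_ifs <;> omega
    have h4 : 0 ≤ (if 0 ≤ al (bb x) then (nn Q x : ℤ) else (d : ℤ) - nn Q x) := by
      split_ifs <;> omega
    rw [← Int.natCast_natAbs]
    exact mul_le_mul (by exact_mod_cast h3) this h4 (by positivity)
  · rw [nsmul_eq_mul]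
    simp only [not_not]
    exact_mod_cast Nat.mul_le_mul_right _ hbad
end
end WS

namespace WS
theorem arith_fin (d g L q n1 n2 mc X : ℕ) (hq1 : 1 ≤ q) (hL1 : L ≤ L ^ 2) (hLq : L ^ 2 ≤ 16 * q)
    (hn1 : n1 = L * (L + 2 * g * L + 2 * g + 3) + 1)
    (e1 : q * (d * n2) ≤ X + 2 * (q * d)) :
    d * (n1 + g + q * (n2 + g) + q + 2 * g * q * mc) + d * g + q * (d * mc) + 2 * (d * g) * (L * d)
      ≤ X + 200 * d ^ 2 * (g + 1) * q * (1 + mc) := by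
  have e2 : n1 ≤ q * (65 + 64 * g) := by
    have h1 : n1 ≤ L ^ 2 * (4 + 4 * g) + 1 := by
      have := Nat.mul_le_mul_left (2 * g) hL1
      calc n1 = L ^ 2 + 2 * g * L ^ 2 + 2 * g * L + 3 * L + 1 := by rw [hn1]; ring
        _ ≤ L ^ 2 + 2 * g * L ^ 2 + 2 * g * L ^ 2 + 3 * L ^ 2 + 1 := by omega
        _ = _ := by ring
    calc n1 ≤ L ^ 2 * (4 + 4 * g) + 1 := h1
      _ ≤ 16 * q * (4 + 4 * g) + q := Nat.add_le_add (Nat.mul_le_mul_right _ hLq) hq1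
      _ = _ := by ring
  have e3 : 2 * (d * g) * (L * d) ≤ q * (32 * (d ^ 2 * g)) := by
    calc 2 * (d * g) * (L * d) = (2 * (d ^ 2 * g)) * L := by ring
      _ ≤ (2 * (d ^ 2 * g)) * (16 * q) := Nat.mul_le_mul_left _ (hL1.trans hLq)
      _ = _ := by ring
  have e4 : d ≤ d ^ 2 := Nat.le_self_pow (by norm_num) d
  have e5 : d * g ≤ d ^ 2 * g := Nat.mul_le_mul_right _ e4
  have e6 : d * n1 ≤ d * (q * (65 + 64 * g)) := Nat.mul_le_mul_left d e2
  have e7 : d * g ≤ q * (d * g) := Nat.le_mul_of_pos_left _ hq1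
  have e8 : q * d ≤ q * d ^ 2 := Nat.mul_le_mul_left _ e4
  have e9 : q * (d * g) ≤ q * (d ^ 2 * g) := Nat.mul_le_mul_left _ e5
  have e10 : q * d * mc ≤ q * d ^ 2 * mc := Nat.mul_le_mul_right _ e8
  have e11 : q * (d * g) * mc ≤ q * (d ^ 2 * g) * mc := Nat.mul_le_mul_right _ e9
  have t1 : 0 ≤ q * d ^ 2 := Nat.zero_le _
  have t2 : 0 ≤ q * (d ^ 2 * g) := Nat.zero_le _
  have t3 : 0 ≤ q * d ^ 2 * mc := Nat.zero_le _
  have t4 : 0 ≤ q * (d ^ 2 * g) * mc := Nat.zero_le _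
  linarith

section
variable {K : Type} [Field K]

lemma equi {ι β : Type} [Fintype ι] [Fintype β] [DecidableEq β] (bb : ι → β) (M : ℕ)
    (hf : ∀ b, (Finset.univ.filter fun x => bb x = b).card ≤ M)
    (hc : Fintype.card ι = Fintype.card β * M) (f : β → ℕ) : ∑ x, f (bb x) = M * ∑ b, f b := by
  have h1 : ∑ b, (Finset.univ.filter fun x => bb x = b).card = ∑ _b : β, M := by
    rw [Finset.sum_const, Finset.card_univ, smul_eq_mul, ← hc, ← Finset.card_univ]
    exact (Finset.card_eq_sum_card_fiberwise (fun x _ => Finset.mem_univ _)).symm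
  have h2 : ∀ b, (Finset.univ.filter fun x => bb x = b).card = M := fun b =>
    (Finset.sum_eq_sum_iff_of_le (fun b _ => hf b)).1 h1 b (Finset.mem_univ b)
  rw [← Finset.sum_fiberwise Finset.univ bb, Finset.mul_sum]
  refine Finset.sum_congr rfl fun b _ => ?_
  rw [Finset.sum_congr rfl (g := fun _ => f b), Finset.sum_const, h2, smul_eq_mul]
  intro x hx
  rw [(Finset.mem_filter.1 hx).2]

lemma Rs_fib [Fintype K] [DecidableEq K] {p : ℕ} (hp : 1 < p) (a : ℕ) (s : K) :
    (Finset.univ.filter fun x : K => Rs p (a + 1) x = s).card ≤ p ^ a := by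
  let g : K[X] := ∑ i ∈ Finset.range a, X ^ p ^ i - C s
  have hg : g.degree < ((p ^ a : ℕ) : WithBot ℕ) := by
    refine (degree_sub_le _ _).trans_lt (max_lt ?_ ?_)
    · refine dsum_lt _ _ fun i hi => ?_
      rw [degree_X_pow]
      exact_mod_cast Nat.pow_lt_pow_right hp (Finset.mem_range.1 hi)
    · exact degree_C_le.trans_lt (by exact_mod_cast Nat.pow_pos (by omega))
  have hm : (X ^ p ^ a + g).Monic := monic_X_pow_add hg
  have hd : (X ^ p ^ a + g).natDegree = p ^ a := by
    rw [natDegree_add_eq_left_of_degree_lt (by rwa [degree_X_pow]), natDegree_X_pow]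
  have := card_roots_le K hm.ne_zero
  rw [hd] at this
  refine le_trans (Finset.card_le_card ?_) this
  intro x hx
  have h1 := (Finset.mem_filter.1 hx).2
  rw [Finset.mem_filter]
  refine ⟨Finset.mem_univ _, ?_⟩
  rw [Rs, Finset.sum_range_succ] at h1
  simp [g, eval_finsetSum, ← h1]

theorem stepC {p : ℕ} [hp : Fact p.Prime] [CharP K p] {a : ℕ} [Fintype K] (ha : 1 ≤ a) (hq : Fintype.card K = p ^ a)
    {h d : ℕ} (hh : 1 ≤ h)
    (hd : 1 ≤ d) {Q : K[X][X]} (hQ : Wt h (h * d) Q) (hm : Q.Monic) (hirr : Irreducible Q)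
    (hdeg : Q.natDegree = d) (hdp : d < p) (a0 β0 : K) (h0 : ev Q a0 β0 = 0)
    (h1 : ev (derivative Q) a0 β0 ≠ 0) (al : Fin p → ℤ) (L : ℕ) (hL : ∀ b, (al b).natAbs ≤ L)
    (hL1 : 1 ≤ L) (hLq : L ^ 2 ≤ 16 * p ^ a) :
    ∃ m : Fin p → ℕ, ∑ c, m c ≤ p * (d * (3 + h * d)) ∧
      ∀ (c : Fin p) (bb : K → Fin p) (_ : ∀ x, ((bb x : ℕ) : K) = Rs p a x - ((c : ℕ) : K)),
        ∑ x : K, al (bb x) * ((nn Q x : ℤ) - 1) ≤ ((200 * d ^ 2 * (h * d + 1) * p ^ a * (1 + m c) : ℕ) : ℤ) := by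
  classical
  set g := h * d with hg
  set Λ := ∑ b : Fin p, (al b).natAbs * kk d (al b) with hΛ
  have hp0 := hp.out.pos
  have hkk : ∀ b, kk d (al b) ≤ d := fun b => by rw [kk]; split_ifs <;> omega
  have hΛL : Λ ≤ p * (L * d) := by
    refine (Finset.sum_le_card_nsmul _ _ (L * d) fun b _ => Nat.mul_le_mul (hL b) (hkk b)).trans ?_
    simp
  set n2 := Λ / (p * d) + 2 with hn2
  have hpd : 0 < p * d := Nat.mul_pos hp0 hd
  have hn2l : Λ + p * d < n2 * (p * d) := by
    have := Nat.lt_div_mul_add hpd (a := Λ)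
    rw [hn2, add_mul]; omega
  have hn2u : n2 * (p * d) ≤ Λ + 2 * (p * d) := by
    rw [hn2, add_mul]
    exact Nat.add_le_add_right (Nat.div_mul_le_self _ _) _
  have hn2L : n2 ≤ L + 2 := by
    rw [hn2]
    refine Nat.add_le_add_right ?_ 2
    refine Nat.div_le_of_le_mul (hΛL.trans (le_of_eq (by ring)))
  set n1 := L * (L + 2 * g * L + 2 * g + 3) + 1 with hn1
  have hcount : ∑ b, ∑ n ∈ Finset.range (al b).natAbs,
      d * kk d (al b) * (n1 + n2 + 2 * g + 2 * g * n + 1) < n1 * d * n2 * d * p := by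
    set W := n1 + n2 + 2 * g + 2 * g * L + 1 with hW
    have e1 : ∑ b, ∑ n ∈ Finset.range (al b).natAbs,
      d * kk d (al b) * (n1 + n2 + 2 * g + 2 * g * n + 1) ≤ d * Λ * W := by
      rw [hΛ, Finset.mul_sum, Finset.sum_mul]
      refine Finset.sum_le_sum fun b _ => ?_
      refine (Finset.sum_le_card_nsmul _ _ (d * kk d (al b) * W) fun n hn => ?_).trans ?_
      · refine Nat.mul_le_mul_left _ ?_
        have h2 : n ≤ L := (Finset.mem_range.1 hn).le.trans (hL b)
        have : 2 * g * n ≤ 2 * g * L := Nat.mul_le_mul_left _ h2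
        omega
      · rw [Finset.card_range, smul_eq_mul]
        exact le_of_eq (by ring)
    refine e1.trans_lt ?_
    have e2 : L * (n2 + 2 * g + 2 * g * L + 1) < n1 := by
      rw [hn1, Nat.lt_succ_iff]
      exact Nat.mul_le_mul_left _ (by omega)
    have e3 : Λ * (n2 + 2 * g + 2 * g * L + 1) ≤ p * d * n1 := by
      calc Λ * (n2 + 2 * g + 2 * g * L + 1) ≤ p * (L * d) * (n2 + 2 * g + 2 * g * L + 1) :=
            Nat.mul_le_mul_right _ hΛL
        _ = p * d * (L * (n2 + 2 * g + 2 * g * L + 1)) := by ring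
        _ ≤ p * d * n1 := Nat.mul_le_mul_left _ e2.le
    have hn1p : 0 < n1 := by omega
    calc d * Λ * W = d * (n1 * Λ + Λ * (n2 + 2 * g + 2 * g * L + 1)) := by rw [hW]; ring
      _ ≤ d * (n1 * Λ + p * d * n1) := Nat.mul_le_mul_left _ (Nat.add_le_add_left e3 _)
      _ = (d * n1) * (Λ + p * d) := by ring
      _ < (d * n1) * (n2 * (p * d)) := Nat.mul_lt_mul_of_pos_left hn2l (Nat.mul_pos hd hn1p)
      _ = _ := by ring
  obtain ⟨m, hm1, hm2⟩ := stepB ha hq hh hd hQ hm hirr hdeg hdp a0 β0 h0 h1 n1 n2 al L hL hcount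
  refine ⟨m, ?_, ?_⟩
  · have : d * (p * n2 + p) + d * (p * (h * d)) = n2 * (p * d) + d * p + p * (d * g) := by ring
    rw [this] at hm1
    have : p * (d * (3 + g)) = 3 * (p * d) + p * (d * g) := by ring
    rw [this]
    have : d * p = p * d := mul_comm _ _
    omega
  · intro c bb hbb
    have key := hm2 c bb hbb
    obtain ⟨a', rfl⟩ : ∃ a', a = a' + 1 := ⟨a - 1, by omega⟩
    have heq := equi bb (p ^ a') (fun b => by
      refine le_trans (Finset.card_le_card ?_) (Rs_fib (K := K) hp.out.one_lt a' (((b : ℕ) : K) + ((c : ℕ) : K)))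
      intro x hx
      rw [Finset.mem_filter] at hx ⊢
      refine ⟨hx.1, ?_⟩
      rw [← hx.2, hbb]; ring) (by rw [hq, Fintype.card_fin]; ring)
      (fun b => (al b).natAbs * kk d (al b))
    rw [Finset.sum_add_distrib, ← Nat.cast_sum, heq, ← hΛ] at key
    have hfin : (d * (n1 + g + p ^ (a' + 1) * (n2 + g) + p ^ (a' + 1) + 2 * g * p ^ (a' + 1) * m c) + d * g +
            p ^ (a' + 1) * (d * m c) + 2 * (d * g) * (L * d)) ≤ p ^ a' * Λ +
            200 * d ^ 2 * (g + 1) * p ^ (a' + 1) * (1 + m c) := by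
      have e1 : p ^ (a' + 1) * (d * n2) ≤ p ^ a' * Λ + 2 * (p ^ (a' + 1) * d) := by
        calc p ^ (a' + 1) * (d * n2) = p ^ a' * (n2 * (p * d)) := by ring
          _ ≤ p ^ a' * (Λ + 2 * (p * d)) := Nat.mul_le_mul_left _ hn2u
          _ = _ := by ring
      exact arith_fin d g L (p ^ (a' + 1)) n1 n2 (m c) (p ^ a' * Λ) (Nat.one_le_iff_ne_zero.2 (by positivity))
        (Nat.le_self_pow (by norm_num) L) hLq hn1 e1
    have hfin' : ((d * (n1 + g + p ^ (a' + 1) * (n2 + g) + p ^ (a' + 1) + 2 * g * p ^ (a' + 1) * m c) + d * g +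
            p ^ (a' + 1) * (d * m c) + 2 * (d * g) * (L * d) : ℕ) : ℤ) ≤ ((p ^ a' * Λ : ℕ) : ℤ) +
            ((200 * d ^ 2 * (g + 1) * p ^ (a' + 1) * (1 + m c) : ℕ) : ℤ) := by exact_mod_cast hfin
    linarith
end
end WS

namespace WS

local notation "ee" => (ZMod.stdAddChar : AddChar (ZMod _) ℂ)

theorem ee_sum {p : ℕ} [Fact p.Prime] (a : ZMod p) (ha : a ≠ 0) :
    ∑ c : ZMod p, ee (c * a) = 0 := by
  rw [AddChar.sum_mulShift a (ZMod.isPrimitive_stdAddChar p), if_neg ha]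
  simp

theorem ee_norm {p : ℕ} [Fact p.Prime] (a : ZMod p) : ‖(ee a : ℂ)‖ = 1 := by
  exact Circle.norm_coe (ZMod.toCircle a)

theorem ee_conj {p : ℕ} [Fact p.Prime] (a : ZMod p) : ee (-a) = (starRingEnd ℂ) (ee a) := by
  rw [AddChar.map_neg_eq_inv, Complex.inv_def, Complex.normSq_eq_norm_sq, ee_norm]; simp

theorem wsum {p : ℕ} [Fact p.Prime] (hp3 : 3 ≤ p) (ω : ℂ) (t : ZMod p) :
    ∑ c : ZMod p, (1 + (ee c).re) * (ω * ee (t - c)).re = p / 2 * (ω * ee t).re := by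
  have h2 : (2 : ZMod p) ≠ 0 := by
    intro h
    have : ((2 : ℕ) : ZMod p) = 0 := by exact_mod_cast h
    rw [ZMod.natCast_eq_zero_iff] at this
    have := Nat.le_of_dvd (by norm_num) this
    omega
  have key : ∑ c : ZMod p, ((1 + (ee c).re : ℝ) : ℂ) * (ω * ee (t - c)) = p / 2 * (ω * ee t) := by
    have h1 : ∀ c : ZMod p, ((1 + (ee c).re : ℝ) : ℂ) * (ω * ee (t - c)) =
        ω * ee t * ee (c * (-1)) + ω * ee t / 2 + ω * ee t / 2 * ee (c * (-2)) := by
      intro c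
      have e1 : (((ee c).re : ℝ) : ℂ) = (ee c + ee (-c)) / 2 := by
        rw [ee_conj, Complex.add_conj]; push_cast; ring
      have e2 : ee (t - c) = ee t * ee (-c) := by rw [sub_eq_add_neg, AddChar.map_add_eq_mul]
      have e3 : ee (c * (-2)) = ee (-c) * ee (-c) := by
        rw [← AddChar.map_add_eq_mul]; congr 1; ring
      have e4 : ee c * ee (-c) = 1 := by rw [← AddChar.map_add_eq_mul]; simp
      rw [Complex.ofReal_add, e1, e2, e3, show c * (-1) = -c by ring, Complex.ofReal_one]
      linear_combination (ω * ee t / 2) * e4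
    rw [Finset.sum_congr rfl fun c _ => h1 c, Finset.sum_add_distrib, Finset.sum_add_distrib,
      ← Finset.mul_sum, ← Finset.mul_sum, ee_sum _ (by simp), ee_sum _ (neg_ne_zero.2 h2)]
    simp [ZMod.card]
    ring
  have := congrArg Complex.re key
  rw [Complex.re_sum] at this
  simp only [Complex.re_ofReal_mul] at this
  rw [this]
  rw [show ((p : ℂ) / 2) = (((p : ℝ) / 2 : ℝ) : ℂ) by push_cast; rfl, Complex.re_ofReal_mul]

theorem avg_bound {p : ℕ} [Fact p.Prime] (hp3 : 3 ≤ p) {X : Type} [Fintype X] (T : X → ZMod p)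
    (N : X → ℤ) (d q B M l : ℕ) (hX : Fintype.card X = q) (hN : ∀ x, |(N x : ℝ)| ≤ d)
    (H : ∀ al : ZMod p → ℤ, (∀ b, (al b).natAbs ≤ l + 1) → ∃ m : ZMod p → ℕ, ∑ c, m c ≤ p * M ∧
      ∀ c, ∑ x, al (T x - c) * N x ≤ ((B * q * (1 + m c) : ℕ) : ℤ)) :
    (l : ℝ) * ‖∑ x, (N x : ℂ) * ee (T x)‖ ≤ 4 * B * q * (1 + M) + 4 * d * q := by
  set S := ∑ x, (N x : ℂ) * ee (T x) with hS
  obtain ⟨ω, hω1, hω2⟩ : ∃ ω : ℂ, ‖ω‖ = 1 ∧ (ω * S).re = ‖S‖ := by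
    by_cases h0 : S = 0
    · exact ⟨1, by simp, by simp [h0]⟩
    · have hn : ‖S‖ ≠ 0 := by simpa using h0
      refine ⟨(starRingEnd ℂ) S / ‖S‖, by simp [hn], ?_⟩
      have : (starRingEnd ℂ) S / ‖S‖ * S = ((‖S‖ : ℝ) : ℂ) := by
        rw [div_mul_eq_mul_div, mul_comm, Complex.mul_conj, Complex.normSq_eq_norm_sq]
        have : (‖S‖ : ℂ) ≠ 0 := by exact_mod_cast hn
        field_simp
        push_cast; ring
      rw [this, Complex.ofReal_re]
  let r : ZMod p → ℝ := fun z => (ω * ee z).re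
  have hr : ∀ z, |r z| ≤ 1 := fun z => by
    refine (Complex.abs_re_le_norm _).trans ?_
    rw [norm_mul, hω1, ee_norm, one_mul]
  let al : ZMod p → ℤ := fun z => ⌊(l : ℝ) * r z⌋
  have hal : ∀ b, (al b).natAbs ≤ l + 1 := by
    intro b
    have h1 := abs_le.1 (hr b)
    have hl : (0 : ℝ) ≤ l := Nat.cast_nonneg _
    have h2 : (l : ℝ) * r b ≤ l := by nlinarith
    have h3 : -(l : ℝ) ≤ l * r b := by nlinarith
    have h4 : al b ≤ l := by
      have : ((al b : ℤ) : ℝ) ≤ l := (Int.floor_le _).trans h2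
      exact_mod_cast this
    have h5 : -(l : ℤ) ≤ al b := by
      apply Int.le_floor.2; push_cast; exact h3
    omega
  obtain ⟨m, hm1, hm2⟩ := H al hal
  have hm1' : ∑ c, (m c : ℝ) ≤ p * M := by exact_mod_cast hm1
  have hc : ∀ c, ∑ x, (l : ℝ) * r (T x - c) * N x ≤ B * q * (1 + m c) + d * q := by
    intro c
    have h1 : ∑ x, (al (T x - c) : ℝ) * N x ≤ B * q * (1 + m c) := by exact_mod_cast hm2 c
    have h2 : ∑ x, ((l : ℝ) * r (T x - c) * N x - (al (T x - c) : ℝ) * N x) ≤ ∑ x : X, (d : ℝ) := by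
      refine Finset.sum_le_sum fun x _ => ?_
      rw [← sub_mul]
      refine (le_abs_self _).trans ?_
      rw [abs_mul]
      have h3 : |(l : ℝ) * r (T x - c) - al (T x - c)| ≤ 1 := by
        have := Int.floor_le ((l : ℝ) * r (T x - c))
        have := Int.lt_floor_add_one ((l : ℝ) * r (T x - c))
        rw [abs_le]; constructor <;> simp only [al] <;> linarith
      calc _ ≤ 1 * (d : ℝ) := mul_le_mul h3 (hN x) (abs_nonneg _) zero_le_one
        _ = d := one_mul _
    rw [Finset.sum_sub_distrib, Finset.sum_const, Finset.card_univ, hX, nsmul_eq_mul] at h2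
    linarith
  have hw : ∀ c : ZMod p, 0 ≤ 1 + (ee c).re ∧ 1 + (ee c).re ≤ 2 := by
    intro c
    have := abs_le.1 ((Complex.abs_re_le_norm (ee c)).trans (ee_norm c).le)
    constructor <;> linarith
  have h1 : ∑ c : ZMod p, (1 + (ee c).re) * ∑ x, (l : ℝ) * r (T x - c) * N x ≤
      ∑ c : ZMod p, 2 * (B * q * (1 + (m c : ℝ)) + d * q) := by
    refine Finset.sum_le_sum fun c _ => ?_
    have h5 : (0 : ℝ) ≤ B * q * (1 + (m c : ℝ)) + d * q := by positivity
    exact (mul_le_mul_of_nonneg_left (hc c) (hw c).1).trans (mul_le_mul_of_nonneg_right (hw c).2 h5)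
  have h2 : ∑ c : ZMod p, (1 + (ee c).re) * ∑ x, (l : ℝ) * r (T x - c) * N x =
      l * (p / 2) * ‖S‖ := by
    calc _ = ∑ x, (l : ℝ) * N x * ∑ c : ZMod p, (1 + (ee c).re) * r (T x - c) := by
          simp_rw [Finset.mul_sum]
          rw [Finset.sum_comm]
          refine Finset.sum_congr rfl fun x _ => Finset.sum_congr rfl fun c _ => by ring
      _ = ∑ x, (l : ℝ) * N x * (p / 2 * (ω * ee (T x)).re) := by
          refine Finset.sum_congr rfl fun x _ => ?_
          rw [wsum hp3]
      _ = l * (p / 2) * ∑ x, (ω * ((N x : ℂ) * ee (T x))).re := by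
          rw [Finset.mul_sum]
          refine Finset.sum_congr rfl fun x _ => ?_
          rw [show ω * ((N x : ℂ) * ee (T x)) = (((N x : ℝ)) : ℂ) * (ω * ee (T x)) by push_cast; ring,
            Complex.re_ofReal_mul]
          ring
      _ = _ := by rw [← Complex.re_sum, ← Finset.mul_sum, ← hS, hω2]
  have h3 : ∑ c : ZMod p, 2 * (B * q * (1 + (m c : ℝ)) + d * q) ≤
      2 * B * q * (p + p * M) + 2 * d * q * p := by
    have : ∑ c : ZMod p, 2 * (B * q * (1 + (m c : ℝ)) + d * q) =
        2 * B * q * (p + ∑ c, (m c : ℝ)) + 2 * d * q * p := by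
      rw [← Finset.mul_sum, Finset.sum_add_distrib, ← Finset.mul_sum, Finset.sum_add_distrib]
      simp [ZMod.card]; ring
    rw [this]
    gcongr
  rw [h2] at h1
  have hp0 : (0 : ℝ) < p := by exact_mod_cast (by omega : 0 < p)
  have h4 := h1.trans h3
  have : (p : ℝ) / 2 * (l * ‖S‖) ≤ p / 2 * (4 * B * q * (1 + M) + 4 * d * q) := by linarith
  exact le_of_mul_le_mul_left this (by positivity)

noncomputable def psi (K : Type) [Field K] (p : ℕ) [Fact p.Prime] [CharP K p] : AddChar K ℂ :=
  letI := ZMod.algebra K p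
  (ZMod.stdAddChar : AddChar (ZMod p) ℂ).compAddMonoidHom (Algebra.trace (ZMod p) K).toAddMonoidHom

section
variable {K : Type} [Field K]

theorem psi_ne (p : ℕ) [Fact p.Prime] [CharP K p] [Fintype K] : psi K p ≠ 1 := by
  letI := ZMod.algebra K p
  obtain ⟨x, hx⟩ := Algebra.trace_surjective (ZMod p) K 1
  intro h
  have h1 : psi K p x = 1 := by rw [h]; simp
  have h2 : ee (1 : ZMod p) = ee (0 : ZMod p) := by
    rw [← hx, AddChar.map_zero_eq_one]; exact h1
  exact one_ne_zero (ZMod.injective_stdAddChar h2)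

theorem trace_Rs {p : ℕ} [Fact p.Prime] [CharP K p] [Fintype K] {a : ℕ} (hq : Fintype.card K = p ^ a) (x : K) :
    letI := ZMod.algebra K p
    algebraMap (ZMod p) K (Algebra.trace (ZMod p) K x) = Rs p a x := by
  letI := ZMod.algebra K p
  have h1 : Module.finrank (ZMod p) K = a := by
    have := Module.card_eq_pow_finrank (K := ZMod p) (V := K)
    rw [hq, ZMod.card] at this
    exact (Nat.pow_right_injective (Fact.out : p.Prime).two_le this).symm
  rw [FiniteField.algebraMap_trace_eq_sum_pow, h1, Rs]
  simp

/-- main exponential sum, smooth-point case -/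
theorem expS1 {p : ℕ} [hp : Fact p.Prime] [CharP K p] {a : ℕ} [Fintype K] (ha : 1 ≤ a)
    (hq : Fintype.card K = p ^ a) (hp3 : 3 ≤ p)
    {h d : ℕ} (hh : 1 ≤ h)
    (hd : 1 ≤ d) {Q : K[X][X]} (hQ : Wt h (h * d) Q) (hm : Q.Monic) (hirr : Irreducible Q)
    (hdeg : Q.natDegree = d) (hdp : d < p) (a0 β0 : K) (h0 : ev Q a0 β0 = 0)
    (h1 : ev (derivative Q) a0 β0 ≠ 0) :
    ‖∑ x, (nn Q x : ℂ) * psi K p x‖ ≤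
      (4 * (200 * d ^ 2 * (h * d + 1)) * (1 + d * (3 + h * d)) + 4 * d : ℕ) * Real.sqrt (Fintype.card K) := by
  classical
  letI := ZMod.algebra K p
  set q := Fintype.card K with hqd
  let T : K → ZMod p := fun x => Algebra.trace (ZMod p) K x
  have hq1 : 1 ≤ q := Fintype.card_pos
  set s := Nat.sqrt q with hs
  have hs1 : 1 ≤ s := Nat.sqrt_pos.2 hq1
  have hss : s ^ 2 ≤ q := by rw [sq]; exact Nat.sqrt_le q
  have key := avg_bound hp3 T (fun x => (nn Q x : ℤ) - 1) d q (200 * d ^ 2 * (h * d + 1))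
    (d * (3 + h * d)) (s + 1) rfl (fun x => by
      have := nn_le hm x
      rw [hdeg] at this
      have h2 : (nn Q x : ℝ) ≤ d := by exact_mod_cast this
      have h3 : (1 : ℝ) ≤ d := by exact_mod_cast hd
      have h4 : (0 : ℝ) ≤ nn Q x := Nat.cast_nonneg _
      push_cast
      rw [abs_le]; constructor <;> linarith) (by
      intro al hal
      have hZF : ∀ c : Fin p, ((c : ℕ) : ZMod p).val = c := fun c => ZMod.val_natCast_of_lt c.2
      obtain ⟨m, hm1, hm2⟩ := stepC ha (hqd ▸ hq) hh hd hQ hm hirr hdeg hdp a0 β0 h0 h1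
        (fun b => al ((b : ℕ) : ZMod p)) (s + 2) (fun b => hal _) (by omega) (by rw [← hq]; nlinarith)
      let zf : ZMod p ≃ Fin p :=
        { toFun := fun z => ⟨z.val, z.val_lt⟩
          invFun := fun b => ((b : ℕ) : ZMod p)
          left_inv := fun z => by simp
          right_inv := fun b => by ext; exact hZF b }
      refine ⟨fun c => m (zf c), ?_, fun c => ?_⟩
      · rw [Equiv.sum_comp zf m]; exact hm1
      · have := hm2 (zf c) (fun x => zf (T x - c)) (fun x => by
          have e : ∀ z : ZMod p, (((zf z : Fin p) : ℕ) : K) = algebraMap (ZMod p) K z := by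
            intro z
            conv_rhs => rw [← ZMod.natCast_zmod_val z]
            rw [map_natCast]; rfl
          rw [e, e, map_sub, trace_Rs (hqd ▸ hq)])
        rw [← hq] at this
        have e2 : ∀ z : ZMod p, (((zf z : Fin p) : ℕ) : ZMod p) = z := fun z => zf.left_inv z
        simp only [e2] at this
        exact this)
  have hS : ∑ x, (((nn Q x : ℤ) - 1 : ℤ) : ℂ) * ee (T x) = ∑ x, (nn Q x : ℂ) * psi K p x := by
    have h5 : ∑ x, psi K p x = 0 := AddChar.sum_eq_zero_of_ne_one (psi_ne p)
    have h6 : ∀ x, ee (T x) = psi K p x := fun x => rfl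
    simp only [h6]
    push_cast
    simp only [sub_mul, one_mul, Finset.sum_sub_distrib, h5, sub_zero]
  rw [hS] at key
  set Z := ‖∑ x, (nn Q x : ℂ) * psi K p x‖
  have hr0 : 0 < Real.sqrt q := Real.sqrt_pos.2 (by exact_mod_cast hq1)
  have hle : Real.sqrt q ≤ (s + 1 : ℕ) := by
    rw [Real.sqrt_le_iff]
    refine ⟨by positivity, ?_⟩
    have := (Nat.lt_succ_sqrt q).le
    rw [sq]; exact_mod_cast this
  have h7 : Real.sqrt q * Z ≤ Real.sqrt q * ((4 * (200 * d ^ 2 * (h * d + 1)) * (1 + d * (3 + h * d)) + 4 * d : ℕ) * Real.sqrt q) := by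
    refine (mul_le_mul_of_nonneg_right hle (norm_nonneg _)).trans (key.trans (le_of_eq ?_))
    have h8 := Real.mul_self_sqrt (Nat.cast_nonneg (α := ℝ) q)
    rw [mul_left_comm, h8]
    push_cast; ring
  exact le_of_mul_le_mul_left h7 hr0
end
end WS

namespace WS
section
variable {K : Type} [Field K]

theorem res_eval {f g : K[X][X]} {m n : ℕ} (hf : f.natDegree ≤ m) (hg : g.natDegree ≤ n) (hmn : m ≠ 0 ∨ n ≠ 0)
    (x y : K) (h1 : ev f x y = 0) (h2 : ev g x y = 0) : (resultant f g m n).eval x = 0 := by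
  obtain ⟨a, b, -, -, h⟩ := exists_mul_add_mul_eq_C_resultant f g hf hg hmn
  have := congrArg (fun T => (T.map (evalRingHom x)).eval y) h
  simp only [Polynomial.map_add, Polynomial.map_mul, eval_add, eval_mul, ← ev_self, h1, h2, zero_mul, add_zero,
    map_C, eval_C, coe_evalRingHom] at this
  exact this.symm

def EB (d h : ℕ) : ℕ := (4 * (200 * d ^ 2 * (h * d + 1)) * (1 + d * (3 + h * d)) + 4 * d) + 2 * (d * (h * d)) * d

theorem EB_mono {d k h : ℕ} (hdk : d ≤ k) : EB d h ≤ EB k h := by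
  unfold EB; gcongr

theorem expS {p : ℕ} [hp : Fact p.Prime] [CharP K p] [Fintype K] (hp3 : 3 ≤ p)
    {h d : ℕ} (hh : 1 ≤ h)
    (hd : 1 ≤ d) {Q : K[X][X]} (hQ : Wt h (h * d) Q) (hm : Q.Monic) (hirr : Irreducible Q)
    (hdeg : Q.natDegree = d) (hdp : d < p) :
    ‖∑ x, (nn Q x : ℂ) * psi K p x‖ ≤ (EB d h : ℕ) * Real.sqrt (Fintype.card K) := by
  classical
  obtain ⟨a, -, hq⟩ := FiniteField.card K p
  have hs1 : 1 ≤ Real.sqrt (Fintype.card K) := by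
    rw [Real.one_le_sqrt]; exact_mod_cast Fintype.card_pos (α := K)
  by_cases hex : ∃ a0 β0 : K, ev Q a0 β0 = 0 ∧ ev (derivative Q) a0 β0 ≠ 0
  · obtain ⟨a0, β0, h0, h1⟩ := hex
    refine (expS1 a.2 hq hp3 hh hd hQ hm hirr hdeg hdp a0 β0 h0 h1).trans ?_
    refine mul_le_mul_of_nonneg_right ?_ (Real.sqrt_nonneg _)
    exact_mod_cast Nat.le_add_right _ _
  · push Not at hex
    have hz : ∀ x, (disc' Q d).eval x ≠ 0 → nn Q x = 0 := by
      intro x hx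
      rw [nn, Finset.card_eq_zero, Finset.filter_eq_empty_iff]
      intro y _ hy
      refine hx (res_eval hdeg.le ?_ (Or.inl (by omega)) x y hy (hex x y hy))
      exact (natDegree_derivative_le _).trans (by omega)
    have hb := (card_roots_le K (disc_ne hd hm hirr hdeg hdp)).trans (disc_deg hQ)
    have h1 : ‖∑ x, (nn Q x : ℂ) * psi K p x‖ ≤ (2 * (d * (h * d)) * d : ℕ) := by
      rw [← Finset.sum_filter_of_ne (p := fun x => (disc' Q d).eval x = 0)]
      · refine (norm_sum_le_of_le _ (f := fun x => (nn Q x : ℂ) * psi K p x) (n := fun _ => (d : ℝ)) fun x _ => ?_).trans ?_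
        · rw [norm_mul, AddChar.norm_apply, mul_one, Complex.norm_natCast]
          exact_mod_cast hdeg ▸ nn_le hm x
        · rw [Finset.sum_const, nsmul_eq_mul]
          exact_mod_cast Nat.mul_le_mul_right d hb
      · intro x _ hx
        by_contra hc
        rw [hz x hc] at hx
        simp at hx
    refine h1.trans ?_
    have h2 : ((2 * (d * (h * d)) * d : ℕ) : ℝ) ≤ (EB d h : ℕ) := by exact_mod_cast Nat.le_add_left _ _
    refine h2.trans (le_mul_of_one_le_right (Nat.cast_nonneg _) hs1)
end
end WS

namespace WS
section
variable {K : Type} [Field K]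

def ud (h : ℕ) (g : K[X][X]) : Prop := ∀ i, (g.coeff i).natDegree ≤ h

theorem coeff_swap (g : K[X][X]) (i j : ℕ) :
    ((Bivariate.swap g).coeff j).coeff i = (g.coeff i).coeff j := by
  induction g using Polynomial.induction_on' with
  | add a b ha hb => simp [ha, hb]
  | monomial n a =>
    induction a using Polynomial.induction_on' with
    | add a b ha hb => simp only [map_add, coeff_add, ha, hb]
    | monomial m r =>
      rw [Bivariate.swap_monomial_monomial]
      simp only [coeff_monomial]
      by_cases h1 : m = j <;> by_cases h2 : n = i <;> simp [h1, h2, coeff_monomial]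

theorem ud_iff {h : ℕ} {g : K[X][X]} : ud h g ↔ (Bivariate.swap g).natDegree ≤ h := by
  rw [natDegree_le_iff_coeff_eq_zero]
  constructor
  · intro H N hN
    ext i
    rw [coeff_swap, coeff_zero]
    exact coeff_eq_zero_of_natDegree_lt (lt_of_le_of_lt (H i) hN)
  · intro H i
    rw [natDegree_le_iff_coeff_eq_zero]
    intro N hN
    rw [← coeff_swap, H N hN, coeff_zero]

theorem ud_factor {h : ℕ} {g a b : K[X][X]} (hg : g ≠ 0) (hab : g = a * b) (H : ud h g) : ud h a := by
  have ha : a ≠ 0 := by rintro rfl; simp at hab; exact hg hab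
  have hb : b ≠ 0 := by rintro rfl; simp at hab; exact hg hab
  rw [ud_iff] at H ⊢
  rw [hab, map_mul, natDegree_mul (by simpa using ha) (by simpa using hb)] at H
  omega

theorem ud_Wt {h d : ℕ} {g : K[X][X]} (hm : g.Monic) (hd : g.natDegree = d) (H : ud h g) : Wt h (h * d) g := by
  intro i j hij
  rcases lt_trichotomy i d with hi | hi | hi
  · have h1 : j ≤ h := (le_natDegree_of_ne_zero hij).trans (H i)
    have h2 : h * (i + 1) ≤ h * d := Nat.mul_le_mul_left _ hi
    rw [mul_add] at h2
    omega
  · subst hi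
    rw [← hd, hm.coeff_natDegree, coeff_one] at hij
    have : j = 0 := by by_contra hc; simp [hc] at hij
    omega
  · have h0 : g.coeff i = 0 := coeff_eq_zero_of_natDegree_lt (by omega)
    rw [h0] at hij
    simp at hij

theorem resultant_ne' {R : Type} [CommRing R] [IsDomain R] [IsIntegrallyClosed R] {M G : R[X]}
    (hM : M.Monic) (hirr : Irreducible M) (hG : ¬ M ∣ G) :
    resultant M G M.natDegree G.natDegree ≠ 0 := by
  let L := FractionRing R
  have hinj : Function.Injective (algebraMap R L) := IsFractionRing.injective R L
  have h1 : Irreducible (M.map (algebraMap R L)) :=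
    (Monic.irreducible_iff_irreducible_map_fraction_map hM).1 hirr
  have hcop : IsCoprime (M.map (algebraMap R L)) (G.map (algebraMap R L)) := by
    refine (h1.coprime_iff_not_dvd).2 fun hdvd => hG ?_
    exact (map_dvd_map _ hinj hM).1 hdvd
  have h2 := Polynomial.resultant_ne_zero _ _ hcop
  rw [hM.natDegree_map, natDegree_map_eq_of_injective hinj, resultant_map_map] at h2
  intro h
  rw [h, map_zero] at h2
  exact h2 rfl

theorem ev_mul' (f g : K[X][X]) (x y : K) : ev (f * g) x y = ev f x y * ev g x y := by
  simp [ev_self]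

theorem exists_monic_irr {g : K[X][X]} (hm : g.Monic) (hd : 1 ≤ g.natDegree) :
    ∃ a b : K[X][X], g = a * b ∧ a.Monic ∧ Irreducible a ∧ b.Monic ∧ 1 ≤ a.natDegree := by
  have hnu : ¬ IsUnit g := fun hu => by
    have := hm.eq_one_of_isUnit hu
    rw [this] at hd; simp at hd
  obtain ⟨π, hπ, hπd⟩ := WfDvdMonoid.exists_irreducible_factor hnu hm.ne_zero
  have hu := hm.isUnit_leadingCoeff_of_dvd hπd
  have huC : IsUnit (C (hu.unit⁻¹ : K[X]ˣ).1 : K[X][X]) := isUnit_C.2 (Units.isUnit _)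
  set a := C (hu.unit⁻¹ : K[X]ˣ).1 * π with ha
  have hass : Associated a π := by
    rw [ha]; exact associated_unit_mul_left _ _ huC
  have ham : a.Monic := by
    rw [Monic, ha, leadingCoeff_mul, leadingCoeff_C]
    exact hu.val_inv_mul
  have hai : Irreducible a := hass.irreducible_iff.2 hπ
  obtain ⟨b, hb⟩ := (hass.dvd_iff_dvd_left).2 hπd
  refine ⟨a, b, hb, ham, hai, ham.of_mul_monic_left (hb ▸ hm), ?_⟩
  exact natDegree_pos_of_not_isUnit_of_dvd_monic hm hai.not_isUnit ⟨b, hb⟩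

def MB (k h : ℕ) : ℕ := EB k h + 2 * k * h * k

theorem monicS {p : ℕ} [hp : Fact p.Prime] [CharP K p] [Fintype K] (hp3 : 3 ≤ p)
    {h k : ℕ} (hh : 1 ≤ h) (hkp : k < p) (n : ℕ) : n ≤ k → ∀ g : K[X][X], g.Monic → g.natDegree ≤ n → ud h g →
    ‖∑ x, (nn g x : ℂ) * psi K p x‖ ≤ (n * MB k h : ℕ) * Real.sqrt (Fintype.card K) := by
  classical
  have hs1 : 1 ≤ Real.sqrt (Fintype.card K) := by
    rw [Real.one_le_sqrt]; exact_mod_cast Fintype.card_pos (α := K)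
  induction n with
  | zero =>
    intro _ g hm hd _
    have : g = 1 := hm.natDegree_eq_zero.1 (by omega)
    subst this
    have : ∀ x : K, nn (1 : K[X][X]) x = 0 := fun x => by
      have := nn_le (K := K) hm x
      simpa using this
    simp [this]
  | succ n ih =>
    intro hnk g hm hd hud
    by_cases hd0 : g.natDegree ≤ n
    · refine (ih (by omega) g hm hd0 hud).trans ?_
      refine mul_le_mul_of_nonneg_right ?_ (Real.sqrt_nonneg _)
      exact_mod_cast Nat.mul_le_mul_right _ (Nat.le_succ n)
    obtain ⟨a, b, hab, ham, hai, hbm, had⟩ := exists_monic_irr hm (by omega)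
    have hdeg : g.natDegree = a.natDegree + b.natDegree := by rw [hab, ham.natDegree_mul hbm]
    have hua : ud h a := ud_factor hm.ne_zero hab hud
    have hub : ud h b := ud_factor hm.ne_zero (hab.trans (mul_comm _ _)) hud
    have hb := ih (by omega) b hbm (by omega) hub
    by_cases hdvd : a ∣ b
    · have : ∀ x, nn g x = nn b x := by
        intro x
        rw [nn, nn]
        congr 1
        ext y
        simp only [Finset.mem_filter, Finset.mem_univ, true_and]
        rw [hab, ev_mul', mul_eq_zero]
        constructor
        · rintro (h1 | h1)
          · obtain ⟨c, rfl⟩ := hdvd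
            rw [ev_mul', h1, zero_mul]
          · exact h1
        · exact Or.inr
      simp only [this]
      refine hb.trans ?_
      refine mul_le_mul_of_nonneg_right ?_ (Real.sqrt_nonneg _)
      exact_mod_cast Nat.mul_le_mul_right _ (Nat.le_succ n)
    · have ha := expS (p := p) hp3 hh had (ud_Wt ham rfl hua) ham hai rfl (by omega)
      set cm : K → ℕ := fun x => (Finset.univ.filter fun y : K => ev a x y = 0 ∧ ev b x y = 0).card with hcm
      have hid : ∀ x, nn g x + cm x = nn a x + nn b x := by
        intro x
        rw [nn, nn, nn, hcm]
        simp only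
        refine Eq.trans ?_ (Finset.card_union_add_card_inter _ _)
        congr 2
        · ext y; simp [hab, ev_mul']
        · ext y; simp
      have hres := resultant_ne' ham hai hdvd
      set R := resultant a b a.natDegree b.natDegree with hR
      have hRd : R.natDegree ≤ 2 * k * h := by
        refine (resultant_natDegree_le a b hua hub).trans ?_
        rw [← add_mul]
        exact Nat.mul_le_mul_right _ (by omega)
      have hz : ∀ x, R.eval x ≠ 0 → cm x = 0 := by
        intro x hx
        rw [hcm, Finset.card_eq_zero, Finset.filter_eq_empty_iff]
        rintro y - ⟨h1, h2⟩
        exact hx (res_eval le_rfl le_rfl (Or.inl (by omega)) x y h1 h2)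
      have hcmk : ∀ x, cm x ≤ k := by
        intro x
        refine le_trans ?_ ((nn_le ham x).trans (by omega : a.natDegree ≤ k))
        refine Finset.card_le_card fun y hy => ?_
        simp only [Finset.mem_filter, Finset.mem_univ, true_and] at hy ⊢
        exact hy.1
      have h1 : ‖∑ x, (cm x : ℂ) * psi K p x‖ ≤ (2 * k * h * k : ℕ) := by
        rw [← Finset.sum_filter_of_ne (p := fun x => R.eval x = 0)]
        · refine (norm_sum_le_of_le _ (f := fun x => (cm x : ℂ) * psi K p x) (n := fun _ => (k : ℝ)) fun x _ => ?_).trans ?_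
          · rw [norm_mul, AddChar.norm_apply, mul_one, Complex.norm_natCast]
            exact_mod_cast hcmk x
          · rw [Finset.sum_const, nsmul_eq_mul]
            exact_mod_cast Nat.mul_le_mul_right k ((card_roots_le K hres).trans hRd)
        · intro x _ hx
          by_contra hc
          rw [hz x hc] at hx
          simp at hx
      have hsum : ∑ x, (nn g x : ℂ) * psi K p x = ∑ x, (nn a x : ℂ) * psi K p x +
          ∑ x, (nn b x : ℂ) * psi K p x - ∑ x, (cm x : ℂ) * psi K p x := by
        rw [← Finset.sum_add_distrib, ← Finset.sum_sub_distrib]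
        refine Finset.sum_congr rfl fun x _ => ?_
        have : (nn g x : ℂ) + cm x = nn a x + nn b x := by exact_mod_cast hid x
        linear_combination psi K p x * this
      rw [hsum]
      refine (norm_sub_le _ _).trans ((add_le_add (norm_add_le _ _) h1).trans ?_)
      have h2 : ((EB a.natDegree h : ℕ) : ℝ) ≤ (EB k h : ℕ) := by exact_mod_cast EB_mono (by omega)
      have h3 := ha.trans (mul_le_mul_of_nonneg_right h2 (Real.sqrt_nonneg _))
      have h4 : ((2 * k * h * k : ℕ) : ℝ) ≤ (2 * k * h * k : ℕ) * Real.sqrt (Fintype.card K) :=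
        le_mul_of_one_le_right (Nat.cast_nonneg _) hs1
      have h5 : (((n + 1) * MB k h : ℕ) : ℝ) = (n * MB k h : ℕ) + (EB k h : ℕ) + (2 * k * h * k : ℕ) := by
        rw [MB]; push_cast; ring
      rw [h5, add_mul, add_mul]
      linarith

def GB (k e : ℕ) : ℕ := k * MB k (e * k) + e * (2 * k)

theorem genS {p : ℕ} [hp : Fact p.Prime] [CharP K p] [Fintype K] (hp3 : 3 ≤ p)
    {e k : ℕ} (he : 1 ≤ e) (hk : 1 ≤ k) (hkp : k < p) {f : K[X][X]} (hfk : f.natDegree ≤ k) (hue : ud e f)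
    (hf : ∀ u : K, f.map (evalRingHom u) ≠ 0) :
    ‖∑ x, (nn f x : ℂ) * psi K p x‖ ≤ (GB k e : ℕ) * Real.sqrt (Fintype.card K) := by
  classical
  have hs1 : 1 ≤ Real.sqrt (Fintype.card K) := by
    rw [Real.one_le_sqrt]; exact_mod_cast Fintype.card_pos (α := K)
  have hf0 : f ≠ 0 := by rintro rfl; exact hf 0 (by simp)
  have hnk : ∀ u, nn f u ≤ k := by
    intro u
    have := card_roots_le K (hf u)
    refine le_trans (le_of_eq ?_) (this.trans (natDegree_map_le.trans hfk))
    rw [nn]; congr 1; ext y; simp [ev_self]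
  by_cases hD : f.natDegree = 0
  · have : ∀ u, nn f u = 0 := by
      intro u
      rw [nn, Finset.card_eq_zero, Finset.filter_eq_empty_iff]
      intro y _ hy
      rw [eq_C_of_natDegree_eq_zero hD] at hy
      apply hf u
      rw [ev_self, map_C, eval_C] at hy
      rw [eq_C_of_natDegree_eq_zero hD, map_C, hy, C_0]
    simp only [this]
    simp only [Nat.cast_zero, zero_mul, Finset.sum_const_zero, norm_zero]
    positivity
  · set D := f.natDegree with hDd
    set g := integralNormalization f with hg
    have hgm : g.Monic := monic_integralNormalization hf0
    have hgd : g.natDegree = D := natDegree_integralNormalization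
    have hug : ud (e * k) g := by
      intro i
      rcases lt_trichotomy i D with hi | hi | hi
      · rw [hg, integralNormalization_coeff_ne_natDegree (by omega)]
        have h1 : (f.leadingCoeff ^ (f.natDegree - 1 - i)).natDegree ≤ (f.natDegree - 1 - i) * e :=
          natDegree_pow_le.trans (Nat.mul_le_mul_left _ (hue _))
        refine natDegree_mul_le.trans ((Nat.add_le_add (hue i) h1).trans ?_)
        calc e + (f.natDegree - 1 - i) * e = (f.natDegree - 1 - i + 1) * e := by ring
          _ ≤ k * e := Nat.mul_le_mul_right _ (by omega)
          _ = e * k := mul_comm _ _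
      · rw [hi, ← hgd, hgm.coeff_natDegree]; simp
      · rw [coeff_eq_zero_of_natDegree_lt (by omega)]; simp
    have hek : 1 ≤ e * k := Nat.mul_pos he hk
    have hmain := monicS (p := p) hp3 hek hkp k le_rfl g hgm (by omega) hug
    have hgk : ∀ u, nn g u ≤ k := fun u => (nn_le hgm u).trans (by omega)
    have heq : ∀ u, f.leadingCoeff.eval u ≠ 0 → nn f u = nn g u := by
      intro u hu
      rw [nn, nn]
      have hev : ∀ y, ev g u (f.leadingCoeff.eval u * y) = f.leadingCoeff.eval u ^ (D - 1) * ev f u y := by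
        intro y
        have := integralNormalization_eval₂_leadingCoeff_mul (p := f) (by omega) (evalRingHom u) y
        rw [ev_self, ev_self, eval_map, eval_map]
        exact this
      refine Finset.card_bij (fun y _ => f.leadingCoeff.eval u * y) ?_ ?_ ?_
      · intro y hy
        simp only [Finset.mem_filter, Finset.mem_univ, true_and] at hy ⊢
        rw [hev, hy, mul_zero]
      · intro y _ z _ hyz
        exact mul_left_cancel₀ hu hyz
      · intro z hz
        simp only [Finset.mem_filter, Finset.mem_univ, true_and] at hz
        have hz' : f.leadingCoeff.eval u * (z / f.leadingCoeff.eval u) = z := by field_simp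
        refine ⟨z / f.leadingCoeff.eval u, ?_, hz'⟩
        simp only [Finset.mem_filter, Finset.mem_univ, true_and]
        have := hev (z / f.leadingCoeff.eval u)
        rw [hz', hz] at this
        exact (mul_eq_zero.1 this.symm).resolve_left (pow_ne_zero _ hu)
    have hlc : f.leadingCoeff ≠ 0 := leadingCoeff_ne_zero.2 hf0
    have h1 : ‖∑ x, ((nn f x : ℂ) - nn g x) * psi K p x‖ ≤ (e * (2 * k) : ℕ) := by
      rw [← Finset.sum_filter_of_ne (p := fun x => f.leadingCoeff.eval x = 0)]
      · refine (norm_sum_le_of_le _ (f := fun x => ((nn f x : ℂ) - nn g x) * psi K p x) (n := fun _ => (2 * k : ℝ)) fun x _ => ?_).trans ?_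
        · rw [norm_mul, AddChar.norm_apply, mul_one]
          refine (norm_sub_le _ _).trans ?_
          rw [Complex.norm_natCast, Complex.norm_natCast]
          have h2 : (nn f x : ℝ) ≤ k := by exact_mod_cast hnk x
          have h3 : (nn g x : ℝ) ≤ k := by exact_mod_cast hgk x
          linarith
        · rw [Finset.sum_const, nsmul_eq_mul]
          exact_mod_cast Nat.mul_le_mul_right (2 * k) ((card_roots_le K hlc).trans (hue _))
      · intro x _ hx
        by_contra hc
        rw [heq x hc] at hx
        simp at hx
    have hsum : ∑ x, (nn f x : ℂ) * psi K p x = ∑ x, (nn g x : ℂ) * psi K p x +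
        ∑ x, ((nn f x : ℂ) - nn g x) * psi K p x := by
      rw [← Finset.sum_add_distrib]
      refine Finset.sum_congr rfl fun x _ => by ring
    rw [hsum]
    refine (norm_add_le _ _).trans ((add_le_add hmain h1).trans ?_)
    have h4 : ((e * (2 * k) : ℕ) : ℝ) ≤ (e * (2 * k) : ℕ) * Real.sqrt (Fintype.card K) :=
      le_mul_of_one_le_right (Nat.cast_nonneg _) hs1
    rw [GB, Nat.cast_add, add_mul]
    linarith
end
end WS

namespace WS
section
variable {K : Type} [Field K]

def dot (m z : Fin 2 → K) : K := m 0 * z 0 + m 1 * z 1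

noncomputable def sub2 (v w : Fin 2 → K) (P : MvPolynomial (Fin 2) K) : K[X][X] :=
  MvPolynomial.aeval (fun i => C (C (v i) * X) + C (C (w i)) * X : Fin 2 → K[X][X]) P

theorem aeval_deg (L : Fin 2 → K[X][X]) (hL : ∀ i, (L i).natDegree ≤ 1) (P : MvPolynomial (Fin 2) K) :
    (MvPolynomial.aeval L P).natDegree ≤ P.totalDegree := by
  rw [MvPolynomial.aeval_def, MvPolynomial.eval₂_eq']
  refine natDegree_sum_le_of_forall_le _ _ fun d hd => ?_
  refine natDegree_mul_le.trans ?_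
  have h1 : (algebraMap K K[X][X] (P.coeff d)).natDegree = 0 := by
    rw [show algebraMap K K[X][X] (P.coeff d) = C (C (P.coeff d)) from rfl, natDegree_C]
  rw [h1, zero_add]
  have h2 := MvPolynomial.le_totalDegree hd
  rw [Finsupp.sum_fintype _ _ (fun _ => rfl), Fin.sum_univ_two] at h2
  rw [Fin.prod_univ_two]
  refine natDegree_mul_le.trans (le_trans (Nat.add_le_add ?_ ?_) h2)
  · exact natDegree_pow_le.trans (by have := Nat.mul_le_mul_left (d 0) (hL 0); omega)
  · exact natDegree_pow_le.trans (by have := Nat.mul_le_mul_left (d 1) (hL 1); omega)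

theorem sub2_deg (v w : Fin 2 → K) (P : MvPolynomial (Fin 2) K) : (sub2 v w P).natDegree ≤ P.totalDegree := by
  refine aeval_deg _ (fun i => ?_) P
  refine natDegree_add_le_of_degree_le ?_ ?_
  · rw [natDegree_C]; omega
  · exact natDegree_C_mul_le _ _ |>.trans natDegree_X_le

theorem sub2_swap (v w : Fin 2 → K) (P : MvPolynomial (Fin 2) K) : Bivariate.swap (sub2 v w P) = sub2 w v P := by
  rw [sub2, sub2, ← AlgEquiv.coe_algHom, MvPolynomial.comp_aeval_apply]
  congr 2
  funext i
  simp only [AlgEquiv.coe_algHom, map_add, map_mul, C_mul, Bivariate.swap_C_C, Bivariate.swap_X, Bivariate.swap_Y]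
  ring

theorem sub2_ud (v w : Fin 2 → K) (P : MvPolynomial (Fin 2) K) : ud P.totalDegree (sub2 v w P) := by
  rw [ud_iff, sub2_swap]; exact sub2_deg _ _ _

theorem sub2_ev (v w : Fin 2 → K) (P : MvPolynomial (Fin 2) K) (u y : K) :
    ev (sub2 v w P) u y = MvPolynomial.eval (fun i => u * v i + y * w i) P := by
  rw [ev_self, sub2, MvPolynomial.aeval_def, ← coe_evalRingHom, ← coe_mapRingHom, ← RingHom.comp_apply,
    MvPolynomial.hom_eval₂, MvPolynomial.eval, MvPolynomial.coe_eval₂Hom]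
  congr 1
  · ext a
    simp [show algebraMap K K[X][X] a = C (C a) from rfl]
  · funext i
    simp
    ring

theorem basis_ex (m : Fin 2 → K) (hm : m ≠ 0) : ∃ v w m' : Fin 2 → K, dot m v = 1 ∧ dot m w = 0 ∧
    dot m' v = 0 ∧ dot m' w = 1 ∧ ∀ i, ∀ z : Fin 2 → K, dot m z * v i + dot m' z * w i = z i := by
  by_cases h0 : m 0 = 0
  · have h1 : m 1 ≠ 0 := by
      intro h1; apply hm; funext i; fin_cases i <;> simp [h0, h1]
    refine ⟨![0, (m 1)⁻¹], ![1, 0], ![1, 0], ?_, ?_, ?_, ?_, ?_⟩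
    any_goals simp [dot, h0, h1]
    intro z
    field_simp
  · refine ⟨![(m 0)⁻¹, 0], ![-(m 1) / m 0, 1], ![0, 1], ?_, ?_, ?_, ?_, ?_⟩
    any_goals simp [dot, h0]
    · field_simp; ring
    · intro z
      field_simp; ring

theorem sub2_nondeg (P : MvPolynomial (Fin 2) K) (m v w m' : Fin 2 → K)
    (hz : ∀ i, ∀ z : Fin 2 → K, dot m z * v i + dot m' z * w i = z i)
    (hP : ¬ ∃ (G : Polynomial K) (α β : K),
            P = Polynomial.eval₂ (MvPolynomial.C : K →+* MvPolynomial (Fin 2) K)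
                  (MvPolynomial.C α * MvPolynomial.X 0 +
                   MvPolynomial.C β * MvPolynomial.X 1) G) : (sub2 v w P).natDegree ≠ 0 := by
  intro h
  apply hP
  set l : MvPolynomial (Fin 2) K := MvPolynomial.C (m 0) * MvPolynomial.X 0 + MvPolynomial.C (m 1) * MvPolynomial.X 1
  set l' : MvPolynomial (Fin 2) K := MvPolynomial.C (m' 0) * MvPolynomial.X 0 + MvPolynomial.C (m' 1) * MvPolynomial.X 1
  let θ : K[X][X] →ₐ[K] MvPolynomial (Fin 2) K := aevalAeval l l'
  have h1 : θ (sub2 v w P) = P := by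
    rw [sub2, MvPolynomial.comp_aeval_apply]
    conv_rhs => rw [← MvPolynomial.aeval_X_left_apply P]
    congr 2
    funext i
    have e0 := hz i ![1, 0]
    have e1 := hz i ![0, 1]
    simp [dot] at e0 e1
    have : θ (C (C (v i) * X) + C (C (w i)) * X) = MvPolynomial.C (v i) * l + MvPolynomial.C (w i) * l' := by
      simp [θ, MvPolynomial.algebraMap_eq]
    rw [this]
    have e2 : MvPolynomial.C (v i) * l + MvPolynomial.C (w i) * l' =
      MvPolynomial.C (m 0 * v i + m' 0 * w i) * MvPolynomial.X 0 + MvPolynomial.C (m 1 * v i + m' 1 * w i) * MvPolynomial.X 1 := by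
      simp only [l, l', map_add, map_mul]; ring
    rw [e2, e0, e1]
    fin_cases i <;> simp
  refine ⟨(sub2 v w P).coeff 0, m 0, m 1, ?_⟩
  conv_lhs => rw [← h1, eq_C_of_natDegree_eq_zero h]
  simp only [θ, aevalAeval_C]
  rw [aeval_def]
  rfl

/-- level-set exponential sum -/
noncomputable def SS [Fintype K] [DecidableEq K] (ψ : AddChar K ℂ) (P : MvPolynomial (Fin 2) K) (t : K) (m : Fin 2 → K) : ℂ :=
  ∑ z : Fin 2 → K, if MvPolynomial.eval z P = t then ψ (dot m z) else 0

theorem SS_eq [Fintype K] [DecidableEq K] (ψ : AddChar K ℂ) (P : MvPolynomial (Fin 2) K) (t : K) (m v w m' : Fin 2 → K)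
    (h1 : dot m v = 1) (h2 : dot m w = 0) (h3 : dot m' v = 0) (h4 : dot m' w = 1)
    (hz : ∀ i, ∀ z : Fin 2 → K, dot m z * v i + dot m' z * w i = z i) :
    SS ψ P t m = ∑ u, (nn (sub2 v w P - C (C t)) u : ℂ) * ψ u := by
  classical
  have hev : ∀ u y, ev (sub2 v w P - C (C t)) u y = MvPolynomial.eval (fun i => u * v i + y * w i) P - t := by
    intro u y
    rw [← sub2_ev, ev_self, ev_self]; simp
  have hR : ∀ u, (nn (sub2 v w P - C (C t)) u : ℂ) * ψ u =
      ∑ y, if MvPolynomial.eval (fun i => u * v i + y * w i) P = t then ψ u else 0 := by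
    intro u
    rw [nn, ← Finset.sum_filter, Finset.sum_const, nsmul_eq_mul]
    congr 3
    ext y
    simp [hev, sub_eq_zero]
  rw [Finset.sum_congr rfl fun u _ => hR u, ← Fintype.sum_prod_type' (f := fun u y => if MvPolynomial.eval (fun i => u * v i + y * w i) P = t then ψ u else 0), SS]
  have lin : ∀ (n : Fin 2 → K) (u y : K), dot n (fun i => u * v i + y * w i) = u * dot n v + y * dot n w := by
    intro n u y; simp only [dot]; ring
  refine Fintype.sum_equiv
    { toFun := fun z => (dot m z, dot m' z)
      invFun := fun a i => a.1 * v i + a.2 * w i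
      left_inv := fun z => by funext i; exact hz i z
      right_inv := fun a => by
        ext
        · simp [lin, h1, h2]
        · simp [lin, h3, h4] } _ _ fun z => ?_
  simp only [Equiv.coe_fn_mk]
  rw [show (fun i => dot m z * v i + dot m' z * w i) = z from funext fun i => hz i z]

theorem level_card [Fintype K] [DecidableEq K] {k : ℕ} (hk : 1 ≤ k) (P : MvPolynomial (Fin 2) K) (hP : P.totalDegree = k) (t : K) :
    (Finset.univ.filter fun z : Fin 2 → K => MvPolynomial.eval z P = t).card ≤ k * Fintype.card K := by
  have hne : P - MvPolynomial.C t ≠ 0 := by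
    intro h
    rw [sub_eq_zero] at h
    rw [h, MvPolynomial.totalDegree_C] at hP
    omega
  have h1 := MvPolynomial.schwartz_zippel_totalDegree hne (Finset.univ : Finset K)
  have hdeg : (P - MvPolynomial.C t).totalDegree ≤ k := by
    refine (MvPolynomial.totalDegree_sub _ _).trans ?_
    rw [MvPolynomial.totalDegree_C, hP]; simp
  have hq : (0 : ℚ≥0) < Fintype.card K := by exact_mod_cast Fintype.card_pos (α := K)
  rw [Finset.card_univ, div_le_div_iff₀ (by positivity) hq] at h1
  have h2 : (Finset.filter (fun f => MvPolynomial.eval f (P - MvPolynomial.C t) = 0) (Fintype.piFinset fun _ => (Finset.univ : Finset K))) =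
      Finset.univ.filter fun z : Fin 2 → K => MvPolynomial.eval z P = t := by
    ext z; simp [sub_eq_zero]
  rw [h2] at h1
  have h3 : (Finset.univ.filter fun z : Fin 2 → K => MvPolynomial.eval z P = t).card * Fintype.card K ≤
      (P - MvPolynomial.C t).totalDegree * Fintype.card K ^ 2 := by exact_mod_cast h1
  have h4 : (Finset.univ.filter fun z : Fin 2 → K => MvPolynomial.eval z P = t).card * Fintype.card K ≤
      (k * Fintype.card K) * Fintype.card K := by
    refine h3.trans ?_
    rw [sq, ← mul_assoc]
    exact Nat.mul_le_mul_right _ (Nat.mul_le_mul_right _ hdeg)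
  exact Nat.le_of_mul_le_mul_right h4 Fintype.card_pos

theorem SS_sq {p : ℕ} [hp : Fact p.Prime] [CharP K p] [Fintype K] [DecidableEq K] (hp3 : 3 ≤ p)
    {k : ℕ} (hk : 1 ≤ k) (hkp : k < p) (P : MvPolynomial (Fin 2) K) (hPk : P.totalDegree = k)
    (hP : ¬ ∃ (G : Polynomial K) (α β : K),
            P = Polynomial.eval₂ (MvPolynomial.C : K →+* MvPolynomial (Fin 2) K)
                  (MvPolynomial.C α * MvPolynomial.X 0 +
                   MvPolynomial.C β * MvPolynomial.X 1) G)
    (m : Fin 2 → K) (hm : m ≠ 0) :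
    ∑ t, ‖SS (psi K p) P t m‖ ^ 2 ≤ ((GB k k) ^ 2 + k ^ 3 : ℕ) * (Fintype.card K : ℝ) ^ 2 := by
  classical
  obtain ⟨v, w, m', h1, h2, h3, h4, hz⟩ := basis_ex m hm
  set f := sub2 v w P with hf
  have hfd : f.natDegree ≤ k := hPk ▸ sub2_deg v w P
  have hfu : ud k f := hPk ▸ sub2_ud v w P
  have hfn : f.natDegree ≠ 0 := sub2_nondeg P m v w m' hz hP
  have hf0 : f ≠ 0 := by rintro h; rw [h] at hfn; simp at hfn
  have hlc : f.leadingCoeff ≠ 0 := leadingCoeff_ne_zero.2 hf0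
  set U := Finset.univ.filter fun u : K => f.leadingCoeff.eval u = 0 with hU
  have hUc : U.card ≤ k := (card_roots_le K hlc).trans (hfu _)
  set B : Finset K := U.image fun u => (f.coeff 0).eval u with hB
  have hBc : B.card ≤ k := Finset.card_image_le.trans hUc
  set q := Fintype.card K with hq
  have hgood : ∀ t, t ∉ B → ‖SS (psi K p) P t m‖ ^ 2 ≤ ((GB k k) ^ 2 : ℕ) * (q : ℝ) := by
    intro t ht
    rw [SS_eq (psi K p) P t m v w m' h1 h2 h3 h4 hz]
    have key := genS (p := p) hp3 hk hk hkp (f := f - C (C t)) (by rw [natDegree_sub_C]; exact hfd) (by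
        intro i
        rw [coeff_sub, coeff_C]
        split_ifs
        · rw [natDegree_sub_C]; exact hfu i
        · rw [sub_zero]; exact hfu i) (by
        intro u hu
        apply ht
        have hc : ∀ i, eval u ((f - C (C t)).coeff i) = 0 := by
          intro i
          have := congrArg (fun T => coeff T i) hu
          simpa only [coeff_map, coe_evalRingHom, coeff_zero] using this
        rw [hB, Finset.mem_image]
        refine ⟨u, ?_, ?_⟩
        · rw [hU, Finset.mem_filter]
          refine ⟨Finset.mem_univ _, ?_⟩
          have := hc f.natDegree
          rw [coeff_sub, coeff_C, if_neg hfn, sub_zero] at this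
          exact this
        · have := hc 0
          rw [coeff_sub, coeff_C_zero, eval_sub, eval_C, sub_eq_zero] at this
          exact this)
    have h5 := pow_le_pow_left₀ (norm_nonneg _) key 2
    rw [mul_pow, Real.sq_sqrt (Nat.cast_nonneg _)] at h5
    exact_mod_cast h5
  have hbad : ∀ t, ‖SS (psi K p) P t m‖ ^ 2 ≤ (k : ℝ) ^ 2 * (q : ℝ) ^ 2 := by
    intro t
    rw [← mul_pow]
    refine pow_le_pow_left₀ (norm_nonneg _) ?_ 2
    rw [SS, ← Finset.sum_filter]
    refine (norm_sum_le_of_le _ (n := fun _ => (1 : ℝ)) fun z _ => ?_).trans ?_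
    · rw [AddChar.norm_apply]
    · rw [Finset.sum_const, nsmul_eq_mul, mul_one]
      exact_mod_cast level_card hk P hPk t
  have hpt : ∀ t, ‖SS (psi K p) P t m‖ ^ 2 ≤ ((GB k k) ^ 2 : ℕ) * (q : ℝ) + if t ∈ B then (k : ℝ) ^ 2 * (q : ℝ) ^ 2 else 0 := by
    intro t
    by_cases ht : t ∈ B
    · rw [if_pos ht]
      have : (0 : ℝ) ≤ ((GB k k) ^ 2 : ℕ) * (q : ℝ) := by positivity
      linarith [hbad t]
    · rw [if_neg ht, add_zero]; exact hgood t ht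
  refine (Finset.sum_le_sum fun t _ => hpt t).trans ?_
  rw [Finset.sum_add_distrib, Finset.sum_const, Finset.card_univ, ← Finset.sum_filter, Finset.sum_const, nsmul_eq_mul, nsmul_eq_mul]
  have h6 : ((Finset.univ.filter fun t => t ∈ B).card : ℝ) ≤ k := by
    rw [Finset.filter_univ_mem]; exact_mod_cast hBc
  have h7 := mul_le_mul_of_nonneg_right h6 (by positivity : (0 : ℝ) ≤ (k : ℝ) ^ 2 * (q : ℝ) ^ 2)
  push_cast
  rw [← hq]
  linarith
end
end WS

namespace WS
section
variable {K : Type} [Field K] [Fintype K] [DecidableEq K]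

theorem dot_add (m y z : Fin 2 → K) : dot m (y + z) = dot m y + dot m z := by simp [dot]; ring
theorem dot_sub (m y z : Fin 2 → K) : dot m (y - z) = dot m y - dot m z := by simp [dot]; ring
theorem dot_neg (m z : Fin 2 → K) : dot (-m) z = - dot m z := by simp [dot]; ring

theorem ortho (ψ : AddChar K ℂ) (hψ : ψ ≠ 1) (z : Fin 2 → K) :
    ∑ m : Fin 2 → K, ψ (dot m z) = if z = 0 then ((Fintype.card K : ℂ)) ^ 2 else 0 := by
  split_ifs with h
  · subst h; simp [dot]
  · let φ : (Fin 2 → K) →+ K := { toFun := fun m => dot m z, map_zero' := by simp [dot], map_add' := fun a b => by simp [dot]; ring }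
    have hne : ψ.compAddMonoidHom φ ≠ 1 := by
      obtain ⟨c, hc⟩ := AddChar.ne_one_iff.1 hψ
      obtain ⟨i, hi⟩ := Function.ne_iff.1 h
      rw [AddChar.ne_one_iff]
      refine ⟨Pi.single i (c / z i), ?_⟩
      have : φ (Pi.single i (c / z i)) = c := by
        have hi' : z i ≠ 0 := hi
        change dot _ z = c
        fin_cases i <;> simp [dot] at hi' ⊢ <;> field_simp
      rw [AddChar.compAddMonoidHom_apply, this]
      exact hc
    exact AddChar.sum_eq_zero_of_ne_one hne

theorem parseval (ψ : AddChar K ℂ) (hψ : ψ ≠ 1) (g : (Fin 2 → K) → ℂ) :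
    ∑ m : Fin 2 → K, ‖∑ y, g y * ψ (dot m y)‖ ^ 2 = (Fintype.card K : ℝ) ^ 2 * ∑ y, ‖g y‖ ^ 2 := by
  have key : ∑ m : Fin 2 → K, (∑ y, g y * ψ (dot m y)) * (starRingEnd ℂ) (∑ y, g y * ψ (dot m y)) =
      (Fintype.card K : ℂ) ^ 2 * ∑ y, g y * (starRingEnd ℂ) (g y) := by
    have h1 : ∀ m : Fin 2 → K, (∑ y, g y * ψ (dot m y)) * (starRingEnd ℂ) (∑ y, g y * ψ (dot m y)) =
        ∑ y, ∑ y', g y * (starRingEnd ℂ) (g y') * ψ (dot m (y - y')) := by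
      intro m
      rw [map_sum, Finset.sum_mul_sum]
      refine Finset.sum_congr rfl fun y _ => Finset.sum_congr rfl fun y' _ => ?_
      rw [map_mul, ← AddChar.map_neg_eq_conj, dot_sub, sub_eq_add_neg, AddChar.map_add_eq_mul]
      ring
    rw [Finset.sum_congr rfl fun m _ => h1 m, Finset.sum_comm, Finset.mul_sum]
    refine Finset.sum_congr rfl fun y _ => ?_
    rw [Finset.sum_comm]
    simp_rw [← Finset.mul_sum, ortho ψ hψ, sub_eq_zero]
    simp only [mul_ite, mul_zero, Finset.sum_ite_eq, Finset.mem_univ, if_true]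
    ring
  simp_rw [Complex.mul_conj, Complex.normSq_eq_norm_sq] at key
  exact_mod_cast key

noncomputable def NN (E : Finset (Fin 2 → K)) (P : MvPolynomial (Fin 2) K) (t : K) (y : Fin 2 → K) : ℕ :=
  (E.filter fun x => MvPolynomial.eval (x - y) P = t).card

theorem NN_ft (ψ : AddChar K ℂ) (E : Finset (Fin 2 → K)) (P : MvPolynomial (Fin 2) K) (t : K) (m : Fin 2 → K) :
    ∑ y, (NN E P t y : ℂ) * ψ (dot m y) = (∑ x ∈ E, ψ (dot m x)) * SS ψ P t (-m) := by
  have h1 : ∀ y, (NN E P t y : ℂ) * ψ (dot m y) = ∑ x ∈ E, if MvPolynomial.eval (x - y) P = t then ψ (dot m y) else 0 := by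
    intro y
    rw [← Finset.sum_filter, Finset.sum_const, nsmul_eq_mul]; rfl
  rw [Finset.sum_congr rfl fun y _ => h1 y, Finset.sum_comm, Finset.sum_mul]
  refine Finset.sum_congr rfl fun x _ => ?_
  rw [SS, Finset.mul_sum]
  refine Fintype.sum_equiv (Equiv.subLeft x) _ _ fun y => ?_
  simp only [Equiv.subLeft_apply, mul_ite, mul_zero]
  congr 1
  rw [← AddChar.map_add_eq_mul]
  congr 1
  rw [dot_neg, dot_sub]; ring

noncomputable def CT (P : MvPolynomial (Fin 2) K) (t : K) : ℕ :=
  (Finset.univ.filter fun z : Fin 2 → K => MvPolynomial.eval z P = t).card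

theorem SS_zero (ψ : AddChar K ℂ) (P : MvPolynomial (Fin 2) K) (t : K) : SS ψ P t 0 = CT P t := by
  rw [SS, CT, ← Finset.sum_filter]
  simp [dot]

theorem CT_sum (P : MvPolynomial (Fin 2) K) : ∑ t, CT P t = Fintype.card K ^ 2 := by
  have := Finset.card_eq_sum_card_fiberwise (f := fun z : Fin 2 → K => MvPolynomial.eval z P) (s := Finset.univ) (t := Finset.univ) (by simp)
  simp only [CT]
  rw [← this]; simp

theorem NN_sum (E : Finset (Fin 2 → K)) (P : MvPolynomial (Fin 2) K) (t : K) :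
    ∑ y, (NN E P t y : ℝ) = E.card * CT P t := by
  have := NN_ft (1 : AddChar K ℂ) E P t 0
  rw [neg_zero, SS_zero] at this
  simp at this
  exact_mod_cast this

theorem variance (ψ : AddChar K ℂ) (hψ : ψ ≠ 1) (E : Finset (Fin 2 → K)) (P : MvPolynomial (Fin 2) K) (A : ℝ)
    (hA : ∀ m : Fin 2 → K, m ≠ 0 → ∑ t, ‖SS ψ P t m‖ ^ 2 ≤ A * (Fintype.card K : ℝ) ^ 2) (hA0 : 0 ≤ A) :
    ∑ t, ∑ y, ((NN E P t y : ℝ) - E.card * CT P t / (Fintype.card K : ℝ) ^ 2) ^ 2 ≤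
      A * (Fintype.card K : ℝ) ^ 2 * E.card := by
  set q : ℝ := (Fintype.card K : ℝ) with hq
  have hq0 : 0 < q := by rw [hq]; exact_mod_cast Fintype.card_pos (α := K)
  have h1 : ∀ t, ∑ y, ((NN E P t y : ℝ) - E.card * CT P t / q ^ 2) ^ 2 =
      ∑ y, (NN E P t y : ℝ) ^ 2 - ((E.card : ℝ) * CT P t) ^ 2 / q ^ 2 := by
    intro t
    set a := (E.card : ℝ) * CT P t / q ^ 2 with ha
    have : ∀ y, ((NN E P t y : ℝ) - a) ^ 2 = (NN E P t y : ℝ) ^ 2 - 2 * a * NN E P t y + a ^ 2 := fun y => by ring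
    rw [Finset.sum_congr rfl fun y _ => this y, Finset.sum_add_distrib, Finset.sum_sub_distrib, ← Finset.mul_sum, NN_sum,
      Finset.sum_const, Finset.card_univ, nsmul_eq_mul]
    have hc : ((Fintype.card (Fin 2 → K) : ℕ) : ℝ) = q ^ 2 := by simp [hq]
    rw [hc, ha]
    field_simp
    ring
  have h2 : ∀ t, q ^ 2 * ∑ y, (NN E P t y : ℝ) ^ 2 =
      ∑ m : Fin 2 → K, ‖∑ x ∈ E, ψ (dot m x)‖ ^ 2 * ‖SS ψ P t (-m)‖ ^ 2 := by
    intro t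
    have := parseval ψ hψ (fun y => (NN E P t y : ℂ))
    simp only [Complex.norm_natCast] at this
    rw [← this]
    refine Finset.sum_congr rfl fun m _ => ?_
    rw [NN_ft, norm_mul, mul_pow]
  have h3 : ∑ m : Fin 2 → K, ‖∑ x ∈ E, ψ (dot m x)‖ ^ 2 = q ^ 2 * E.card := by
    have := parseval ψ hψ (fun y => if y ∈ E then 1 else 0)
    simp only [ite_mul, one_mul, zero_mul, Finset.sum_ite_mem, Finset.univ_inter] at this
    rw [this]
    congr 1
    have : ∀ y : Fin 2 → K, ‖(if y ∈ E then 1 else 0 : ℂ)‖ ^ 2 = if y ∈ E then (1 : ℝ) else 0 := by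
      intro y; split_ifs <;> simp
    simp [this]
  have h4 : ∑ t, q ^ 2 * ∑ y, (NN E P t y : ℝ) ^ 2 ≤ ∑ t, ((E.card : ℝ) * CT P t) ^ 2 + A * q ^ 2 * (q ^ 2 * E.card) := by
    rw [Finset.sum_congr rfl fun t _ => h2 t, Finset.sum_comm]
    simp_rw [← Finset.mul_sum]
    rw [← Finset.add_sum_erase _ _ (Finset.mem_univ (0 : Fin 2 → K))]
    refine add_le_add (le_of_eq ?_) ?_
    · rw [neg_zero, Finset.mul_sum]
      refine Finset.sum_congr rfl fun t _ => ?_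
      rw [SS_zero, Complex.norm_natCast, mul_pow]
      congr 2
      simp [dot]
    · rw [← h3, Finset.mul_sum]
      refine (Finset.sum_le_sum (g := fun m => A * q ^ 2 * ‖∑ x ∈ E, ψ (dot m x)‖ ^ 2) fun m hm => ?_).trans ?_
      · rw [mul_comm]
        exact mul_le_mul_of_nonneg_right (hA (-m) (neg_ne_zero.2 (Finset.ne_of_mem_erase hm))) (by positivity)
      · exact Finset.sum_le_sum_of_subset_of_nonneg (Finset.erase_subset _ _) fun _ _ _ => by positivity
  rw [← Finset.mul_sum] at h4
  rw [Finset.sum_congr rfl fun t _ => h1 t, Finset.sum_sub_distrib, ← Finset.sum_div]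
  rw [sub_le_iff_le_add]
  have h5 : 0 < q ^ 2 := by positivity
  rw [← mul_le_mul_iff_right₀ h5, mul_add, mul_div_cancel₀ _ h5.ne']
  linarith

theorem final_comb (ψ : AddChar K ℂ) (hψ : ψ ≠ 1) {k : ℕ} (hk : 1 ≤ k) (P : MvPolynomial (Fin 2) K) (hPk : P.totalDegree = k) (A : ℝ)
    (hA : ∀ m : Fin 2 → K, m ≠ 0 → ∑ t, ‖SS ψ P t m‖ ^ 2 ≤ A * (Fintype.card K : ℝ) ^ 2) (hA0 : 0 ≤ A)
    (E F : Finset (Fin 2 → K)) (hEF : 1 * (Fintype.card K : ℝ) ^ 3 ≤ (E.card : ℝ) * (F.card : ℝ)) :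
    ∃ F₀ ⊆ F, (1 / 2 : ℝ) * (F.card : ℝ) ≤ (F₀.card : ℝ) ∧ ∀ y ∈ F₀,
      1 / (4 * (k + A)) * (Fintype.card K : ℝ) ≤ ((E.image (fun x => MvPolynomial.eval (x - y) P)).card : ℝ) := by
  have hvar := variance ψ hψ E P A hA hA0
  set q : ℝ := (Fintype.card K : ℝ) with hq
  have hq0 : 0 < q := by rw [hq]; exact_mod_cast Fintype.card_pos (α := K)
  set e : ℝ := (E.card : ℝ) with he
  set f : ℝ := (F.card : ℝ) with hf
  have he0 : 0 < e := by
    rcases (Nat.cast_nonneg (α := ℝ) E.card).eq_or_lt with h | h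
    · rw [he, ← h, zero_mul] at hEF
      have : 0 < q ^ 3 := by positivity
      linarith
    · exact h
  have hf0 : 0 ≤ f := Nat.cast_nonneg _
  have hk1 : (1 : ℝ) ≤ k := by exact_mod_cast hk
  let a : K → ℝ := fun t => e * CT P t / q ^ 2
  let W : (Fin 2 → K) → ℝ := fun y => ∑ t, (NN E P t y : ℝ) ^ 2
  have hW0 : ∀ y, 0 ≤ W y := fun y => Finset.sum_nonneg fun t _ => by positivity
  have ha2 : ∑ t, a t ^ 2 ≤ k * e ^ 2 / q := by
    have h1 : ∀ t, a t ^ 2 ≤ e ^ 2 / q ^ 4 * (k * q) * CT P t := by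
      intro t
      have h2 : (CT P t : ℝ) ≤ k * q := by rw [hq]; exact_mod_cast level_card hk P hPk t
      calc a t ^ 2 = e ^ 2 / q ^ 4 * ((CT P t : ℝ) * CT P t) := by simp only [a]; field_simp
        _ ≤ e ^ 2 / q ^ 4 * (k * q * CT P t) := by gcongr
        _ = _ := by ring
    refine (Finset.sum_le_sum fun t _ => h1 t).trans (le_of_eq ?_)
    rw [← Finset.mul_sum]
    have : ∑ t, (CT P t : ℝ) = q ^ 2 := by rw [hq]; exact_mod_cast CT_sum P
    rw [this]
    field_simp
  have hWF : ∑ y ∈ F, W y ≤ 2 * (k + A) * e ^ 2 / q * f := by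
    have h1 : ∀ y t, (NN E P t y : ℝ) ^ 2 ≤ 2 * a t ^ 2 + 2 * ((NN E P t y : ℝ) - a t) ^ 2 := by
      intro y t; nlinarith [sq_nonneg ((NN E P t y : ℝ) - 2 * a t)]
    have h2 : ∑ y ∈ F, W y ≤ ∑ y ∈ F, (2 * (k * e ^ 2 / q) + 2 * ∑ t, ((NN E P t y : ℝ) - a t) ^ 2) := by
      refine Finset.sum_le_sum fun y _ => ?_
      refine (Finset.sum_le_sum fun t _ => h1 y t).trans ?_
      rw [Finset.sum_add_distrib, ← Finset.mul_sum, ← Finset.mul_sum]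
      linarith
    rw [Finset.sum_add_distrib, Finset.sum_const, nsmul_eq_mul, ← Finset.mul_sum] at h2
    have h3 : ∑ y ∈ F, ∑ t, ((NN E P t y : ℝ) - a t) ^ 2 ≤ A * q ^ 2 * e := by
      refine le_trans (Finset.sum_le_sum_of_subset_of_nonneg (Finset.subset_univ F) fun y _ _ => Finset.sum_nonneg fun t _ => sq_nonneg _) ?_
      rw [Finset.sum_comm]
      exact hvar
    have h4 : A * q ^ 2 * e ≤ A * e ^ 2 / q * f := by
      have h5 : A * q ^ 2 * e = A * e / q * (1 * q ^ 3) := by field_simp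
      rw [h5]
      calc _ ≤ A * e / q * (e * f) := mul_le_mul_of_nonneg_left hEF (by positivity)
        _ = _ := by ring
    calc _ ≤ _ := h2
      _ ≤ f * (2 * (k * e ^ 2 / q)) + 2 * (A * e ^ 2 / q * f) := by linarith
      _ = _ := by ring
  set M : ℝ := 2 * (k + A) * e ^ 2 / q with hM
  have hM0 : 0 < M := by positivity
  refine ⟨F.filter fun y => W y ≤ 2 * M, Finset.filter_subset _ _, ?_, ?_⟩
  · have h1 : ((F.filter fun y => ¬ W y ≤ 2 * M).card : ℝ) * (2 * M) ≤ M * f := by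
      refine le_trans ?_ hWF
      refine le_trans ?_ (Finset.sum_le_sum_of_subset_of_nonneg (Finset.filter_subset (fun y => ¬ W y ≤ 2 * M) F) fun y _ _ => hW0 y)
      rw [← nsmul_eq_mul]
      exact Finset.card_nsmul_le_sum _ _ _ fun y hy => (not_le.1 (Finset.mem_filter.1 hy).2).le
    have h2 : ((F.filter fun y => W y ≤ 2 * M).card : ℝ) + ((F.filter fun y => ¬ W y ≤ 2 * M).card : ℝ) = f := by
      rw [hf]; exact_mod_cast Finset.card_filter_add_card_filter_not _
    have h3 : ((F.filter fun y => ¬ W y ≤ 2 * M).card : ℝ) ≤ f / 2 := by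
      have : M * (((F.filter fun y => ¬ W y ≤ 2 * M).card : ℝ)) ≤ M * (f / 2) := by linarith
      exact le_of_mul_le_mul_left this hM0
    linarith
  · intro y hy
    have hWy := (Finset.mem_filter.1 hy).2
    set D := E.image (fun x => MvPolynomial.eval (x - y) P) with hD
    have h1 : e = ∑ t ∈ D, (NN E P t y : ℝ) := by
      have := Finset.card_eq_sum_card_image (fun x => MvPolynomial.eval (x - y) P) E
      rw [he]; exact_mod_cast this
    have h2 : e ^ 2 ≤ D.card * W y := by
      rw [h1]
      refine sq_sum_le_card_mul_sum_sq.trans ?_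
      refine mul_le_mul_of_nonneg_left ?_ (Nat.cast_nonneg _)
      exact Finset.sum_le_sum_of_subset_of_nonneg (Finset.subset_univ _) fun _ _ _ => by positivity
    have h3 : e ^ 2 ≤ D.card * (2 * M) := h2.trans (mul_le_mul_of_nonneg_left hWy (Nat.cast_nonneg _))
    have hkA : 0 < k + A := by linarith
    have h4 : e ^ 2 * q ≤ e ^ 2 * (D.card * (4 * (k + A))) := by
      have : (D.card : ℝ) * (2 * M) * q = e ^ 2 * (D.card * (4 * (k + A))) := by rw [hM]; field_simp; ring
      rw [← this]
      exact mul_le_mul_of_nonneg_right h3 hq0.le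
    have h5 := le_of_mul_le_mul_left h4 (by positivity)
    rw [div_mul_eq_mul_div, one_mul, div_le_iff₀ (by positivity)]
    exact h5
end
end WS
/-- Pinned distances for non-degenerate polynomials in two variables:
if `P ∈ F_q[x₁,x₂]` is non-degenerate of degree `k` (over a field of large enough
characteristic) and `|E||F| ≥ C q³`, then there is `F₀ ⊆ F` with `|F₀| ≥ c'|F|`
such that `|Δ_P(E,y)| ≥ c q` for all `y ∈ F₀`. A polynomial is non-degenerate if
it is not of the form `G(L(x₁,x₂))` for a one-variable polynomial `G` and a
linear form `L`. -/
theorem stmt9 (k : ℕ) (hk : 2 ≤ k) :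
    ∃ C : ℝ, 0 < C ∧ ∃ c : ℝ, 0 < c ∧ ∃ c' : ℝ, 0 < c' ∧ ∃ p₀ : ℕ,
      ∀ (K : Type) [Field K] [Fintype K] [DecidableEq K],
        p₀ ≤ ringChar K →
        ∀ P : MvPolynomial (Fin 2) K, P.totalDegree = k →
          (¬ ∃ (G : Polynomial K) (α β : K),
            P = Polynomial.eval₂ (MvPolynomial.C : K →+* MvPolynomial (Fin 2) K)
                  (MvPolynomial.C α * MvPolynomial.X 0 +
                   MvPolynomial.C β * MvPolynomial.X 1) G) →
          ∀ E F : Finset (Fin 2 → K),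
            C * (Fintype.card K : ℝ) ^ 3 ≤ (E.card : ℝ) * (F.card : ℝ) →
            ∃ F₀ ⊆ F, c' * (F.card : ℝ) ≤ (F₀.card : ℝ) ∧
              ∀ y ∈ F₀,
                c * (Fintype.card K : ℝ) ≤
                  ((E.image (fun x => MvPolynomial.eval (x - y) P)).card : ℝ) := by
  refine ⟨1, one_pos, 1 / (4 * ((k : ℝ) + ((WS.GB k k) ^ 2 + k ^ 3 : ℕ))), ?_, 1 / 2, by norm_num, k + 1, ?_⟩
  · have : (0 : ℝ) < k := by exact_mod_cast (by omega : 0 < k)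
    positivity
  · intro K _ _ _ hchar P hPk hP E F hEF
    haveI : Fact (ringChar K).Prime := ⟨CharP.char_is_prime K (ringChar K)⟩
    exact WS.final_comb (WS.psi K (ringChar K)) (WS.psi_ne (ringChar K)) (by omega) P hPk _
      (fun m hm => WS.SS_sq (by omega) (by omega) (by omega) P hPk hP m hm) (Nat.cast_nonneg _) E F hEF
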